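/- Let q be a power of an odd prime with q ≡ 1 (mod 8) or q ≡ 7 (mod 8) (i.e., q ≡ ±1 mod 8), let n ≥ 2, and let S = PSp_{2n}(q) be the quotient of the symplectic group Sp_{2n}(q) over the field with q elements by its center. Then every odd-degree irreducible complex character χ of S satisfies χ^σ = χ for every σ ∈ ℋ_2. -/

import Mathlib

/-- `χ : G → ℂ` is an irreducible (ordinary) character of `G`:
it is the character of some simple finite-dimensional complex representation of `G`. -/
def IsIrrChar (G : Type) [Group G] (χ : G → ℂ) : Prop :=
  ∃ V : FDRep ℂ G, CategoryTheory.Simple V ∧ χ = V.character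

/-- Membership in the Galois group `ℋ_2`: there is `r ≥ 0` with `σ ζ = ζ ^ 2 ^ r`
for every root of unity `ζ` of odd order. -/
def InGalH2 (σ : ℂ ≃+* ℂ) : Prop :=
  ∃ r : ℕ, ∀ (n : ℕ) (ζ : ℂ), ¬ 2 ∣ n → ζ ^ n = 1 → σ ζ = ζ ^ 2 ^ r

/-- The symplectic group `Sp_{2n}(F)` of `2n × 2n` matrices over `F` preserving the
standard symplectic form. -/
abbrev Sp (n : ℕ) (F : Type) [Field F] [Fintype F] : Type :=
  ↥(Matrix.symplecticGroup (Fin n) F)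

/-- The projective symplectic group `PSp_{2n}(F)`, the quotient of `Sp_{2n}(F)` by its
center. -/
abbrev PSp (n : ℕ) (F : Type) [Field F] [Fintype F] : Type :=
  Sp n F ⧸ Subgroup.center (Sp n F)


namespace SpP

section Generic

variable {G : Type} [Group G] {X : Type} [AddCommGroup X] [Module ℂ X]

/-- `Y` is stable under the subgroup `H`. -/
def Stab (ρ : Representation ℂ G X) (H : Subgroup G) (Y : Submodule ℂ X) : Prop :=
  ∀ g ∈ H, ∀ y ∈ Y, ρ g y ∈ Y

/-- `Y` is an irreducible `H`-submodule. -/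
def Irr (ρ : Representation ℂ G X) (H : Subgroup G) (Y : Submodule ℂ X) : Prop :=
  Stab ρ H Y ∧ Y ≠ ⊥ ∧ ∀ Z ≤ Y, Stab ρ H Z → Z = ⊥ ∨ Z = Y

/-- fixed points of `H`. -/
def fix (ρ : Representation ℂ G X) (H : Subgroup G) : Submodule ℂ X where
  carrier := {x | ∀ g ∈ H, ρ g x = x}
  add_mem' := by
    intro a b ha hb g hg
    rw [map_add, ha g hg, hb g hg]
  zero_mem' := by
    intro g _
    simp
  smul_mem' := by
    intro c x hx g hg
    rw [map_smul, hx g hg]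

theorem mem_fix {ρ : Representation ℂ G X} {H : Subgroup G} {x : X} :
    x ∈ fix ρ H ↔ ∀ g ∈ H, ρ g x = x := Iff.rfl

theorem fix_mono {ρ : Representation ℂ G X} {H K : Subgroup G} (h : H ≤ K) :
    fix ρ K ≤ fix ρ H := fun _ hx g hg => hx g (h hg)

theorem Stab.mono {ρ : Representation ℂ G X} {H K : Subgroup G} {Y : Submodule ℂ X}
    (h : Stab ρ K Y) (hHK : H ≤ K) : Stab ρ H Y := fun g hg y hy => h g (hHK hg) y hy

theorem Stab.inf {ρ : Representation ℂ G X} {H : Subgroup G} {Y Z : Submodule ℂ X}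
    (h : Stab ρ H Y) (h' : Stab ρ H Z) : Stab ρ H (Y ⊓ Z) :=
  fun g hg y hy => ⟨h g hg y hy.1, h' g hg y hy.2⟩

theorem Stab.sup {ρ : Representation ℂ G X} {H : Subgroup G} {Y Z : Submodule ℂ X}
    (h : Stab ρ H Y) (h' : Stab ρ H Z) : Stab ρ H (Y ⊔ Z) := by
  intro g hg y hy
  obtain ⟨a, ha, b, hb, rfl⟩ := Submodule.mem_sup.1 hy
  rw [map_add]
  exact Submodule.add_mem_sup (h g hg a ha) (h' g hg b hb)

theorem rho_mul (ρ : Representation ℂ G X) (g h : G) (x : X) : ρ (g * h) x = ρ g (ρ h x) := by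
  rw [map_mul]; rfl

theorem rho_one (ρ : Representation ℂ G X) (x : X) : ρ 1 x = x := by
  rw [map_one]; rfl

theorem rho_inv_self (ρ : Representation ℂ G X) (g : G) (x : X) : ρ g⁻¹ (ρ g x) = x := by
  rw [← rho_mul, inv_mul_cancel, rho_one]

theorem rho_self_inv (ρ : Representation ℂ G X) (g : G) (x : X) : ρ g (ρ g⁻¹ x) = x := by
  rw [← rho_mul, mul_inv_cancel, rho_one]

theorem rho_inj (ρ : Representation ℂ G X) (g : G) {x y : X} (h : ρ g x = ρ g y) : x = y := by
  rw [← rho_inv_self ρ g x, h, rho_inv_self]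

theorem stab_bot (ρ : Representation ℂ G X) (H : Subgroup G) : Stab ρ H ⊥ := by
  intro g _ y hy
  rw [Submodule.mem_bot] at hy
  simp [hy]

/-- elements normalizing `H` preserve `fix H`. -/
theorem fix_normalizes {ρ : Representation ℂ G X} {H : Subgroup G} {g : G}
    (hg : ∀ h ∈ H, g⁻¹ * h * g ∈ H) {x : X} (hx : x ∈ fix ρ H) : ρ g x ∈ fix ρ H := by
  intro h hh
  have := hx _ (hg h hh)
  have h2 : h * g = g * (g⁻¹ * h * g) := by group
  rw [← rho_mul, h2, rho_mul, this]

/-- The submodule generated by translates. -/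
def gspan (ρ : Representation ℂ G X) (H : Subgroup G) (Y : Submodule ℂ X) : Submodule ℂ X :=
  Submodule.span ℂ {x | ∃ g ∈ H, ∃ y ∈ Y, x = ρ g y}

theorem gspan_stab (ρ : Representation ℂ G X) (H : Subgroup G) (Y : Submodule ℂ X) :
    Stab ρ H (gspan ρ H Y) := by
  intro g hg y hy
  refine Submodule.span_induction (p := fun y _ => ρ g y ∈ gspan ρ H Y) ?_ ?_ ?_ ?_ hy
  · rintro x ⟨h, hh, y, hy, rfl⟩
    refine Submodule.subset_span ⟨g * h, H.mul_mem hg hh, y, hy, ?_⟩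
    rw [rho_mul]
  · simp
  · intro a b _ _ ha hb
    rw [map_add]; exact Submodule.add_mem _ ha hb
  · intro c a _ ha
    rw [map_smul]; exact Submodule.smul_mem _ _ ha

theorem le_gspan (ρ : Representation ℂ G X) (H : Subgroup G) (Y : Submodule ℂ X) :
    Y ≤ gspan ρ H Y := fun y hy => Submodule.subset_span ⟨1, H.one_mem, y, hy, (rho_one ρ y).symm⟩

theorem gspan_le {ρ : Representation ℂ G X} {H : Subgroup G} {Y Z : Submodule ℂ X}
    (hZ : Stab ρ H Z) (h : Y ≤ Z) : gspan ρ H Y ≤ Z := by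
  refine Submodule.span_le.2 ?_
  rintro x ⟨g, hg, y, hy, rfl⟩
  exact hZ g hg y (h hy)

section Avg
variable [Fintype G]

open Classical in
/-- averaging operator over a subgroup. -/
noncomputable def avg (ρ : Representation ℂ G X) (H : Subgroup G) : X →ₗ[ℂ] X :=
  (Nat.card H : ℂ)⁻¹ • ∑ g ∈ Finset.univ.filter (fun g : G => g ∈ H), (ρ g : X →ₗ[ℂ] X)

open Classical in
theorem card_filter_sub (H : Subgroup G) :
    (Finset.univ.filter (fun g : G => g ∈ H)).card = Nat.card H := by
  rw [← Fintype.card_subtype, Nat.card_eq_fintype_card]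

theorem card_sub_ne (H : Subgroup G) : (Nat.card H : ℂ) ≠ 0 := by
  exact_mod_cast Nat.card_pos.ne'

open Classical in
theorem avg_apply (ρ : Representation ℂ G X) (H : Subgroup G) (x : X) :
    avg ρ H x = (Nat.card H : ℂ)⁻¹ • ∑ g ∈ Finset.univ.filter (fun g : G => g ∈ H), ρ g x := by
  simp [avg, LinearMap.sum_apply]

theorem avg_of_fix {ρ : Representation ℂ G X} {H : Subgroup G} {x : X} (hx : x ∈ fix ρ H) :
    avg ρ H x = x := by
  classical
  rw [avg_apply, Finset.sum_congr rfl (g := fun _ => x)]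
  · rw [Finset.sum_const, card_filter_sub, ← Nat.cast_smul_eq_nsmul ℂ, smul_smul,
      inv_mul_cancel₀ (card_sub_ne H), one_smul]
  · intro g hg
    exact hx g (Finset.mem_filter.1 hg).2

theorem avg_rho {ρ : Representation ℂ G X} {H : Subgroup G} {h : G} (hh : h ∈ H) (x : X) :
    avg ρ H (ρ h x) = avg ρ H x := by
  classical
  rw [avg_apply, avg_apply]
  congr 1
  refine Finset.sum_bij' (fun g _ => g * h) (fun g _ => g * h⁻¹) ?_ ?_ ?_ ?_ ?_
  · intro g hg
    simp only [Finset.mem_filter, Finset.mem_univ, true_and] at hg ⊢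
    exact H.mul_mem hg hh
  · intro g hg
    simp only [Finset.mem_filter, Finset.mem_univ, true_and] at hg ⊢
    exact H.mul_mem hg (H.inv_mem hh)
  · intros; simp
  · intros; simp
  · intros; rw [rho_mul]

/-- compatibility of averages with elements normalizing. -/
theorem rho_avg {ρ : Representation ℂ G X} {H : Subgroup G} {g : G}
    (hg : ∀ h ∈ H, g * h * g⁻¹ ∈ H) (hg' : ∀ h ∈ H, g⁻¹ * h * g ∈ H) (x : X) :
    ρ g (avg ρ H x) = avg ρ H (ρ g x) := by
  classical
  rw [avg_apply, avg_apply, map_smul, map_sum]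
  congr 1
  refine Finset.sum_bij' (fun h _ => g * h * g⁻¹) (fun h _ => g⁻¹ * h * g) ?_ ?_ ?_ ?_ ?_
  · intro h hh
    simp only [Finset.mem_filter, Finset.mem_univ, true_and] at hh ⊢
    exact hg h hh
  · intro h hh
    simp only [Finset.mem_filter, Finset.mem_univ, true_and] at hh ⊢
    exact hg' h hh
  · intros; group
  · intros; group
  · intro h hh
    rw [← rho_mul, ← rho_mul]; congr 2; group

theorem avg_mem_fix (ρ : Representation ℂ G X) (H : Subgroup G) (x : X) :
    avg ρ H x ∈ fix ρ H := by
  intro g hg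
  rw [rho_avg (fun h hh => H.mul_mem (H.mul_mem hg hh) (H.inv_mem hg))
    (fun h hh => H.mul_mem (H.mul_mem (H.inv_mem hg) hh) hg), avg_rho hg]

theorem avg_mem {ρ : Representation ℂ G X} {H : Subgroup G} {Y : Submodule ℂ X}
    (hY : Stab ρ H Y) {y : X} (hy : y ∈ Y) : avg ρ H y ∈ Y := by
  classical
  rw [avg_apply]
  refine Y.smul_mem _ (Y.sum_mem ?_)
  intro g hg
  exact hY g (Finset.mem_filter.1 hg).2 y hy

/-- An average over a bigger group absorbs the average over a smaller one, conjugated. -/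
theorem avg_avg_conj {ρ : Representation ℂ G X} {H K : Subgroup G} {s : G}
    (h : ∀ k ∈ K, s * k * s⁻¹ ∈ H) (x : X) :
    avg ρ H (ρ s (avg ρ K x)) = avg ρ H (ρ s x) := by
  classical
  rw [avg_apply ρ K, map_smul, map_smul, map_sum, map_sum,
    Finset.sum_congr rfl (g := fun _ => avg ρ H (ρ s x))]
  · rw [Finset.sum_const, card_filter_sub, ← Nat.cast_smul_eq_nsmul ℂ, smul_smul,
      inv_mul_cancel₀ (card_sub_ne K), one_smul]
  · intro k hk
    have hk' := h k (Finset.mem_filter.1 hk).2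
    have h2 : s * k = (s * k * s⁻¹) * s := by group
    rw [← rho_mul, h2, rho_mul, avg_rho hk']

/-- Maschke. -/
theorem maschke {ρ : Representation ℂ G X} {H : Subgroup G} {Y Z : Submodule ℂ X}
    (hY : Stab ρ H Y) (hZ : Stab ρ H Z) (hZY : Z ≤ Y) :
    ∃ Z', Z' ≤ Y ∧ Stab ρ H Z' ∧ Z ⊓ Z' = ⊥ ∧ Z ⊔ Z' = Y := by
  classical
  obtain ⟨C, hC⟩ := Submodule.exists_isCompl Z
  let p : X →ₗ[ℂ] X := Z.subtype ∘ₗ Submodule.projectionOnto Z C hC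
  have hp1 : ∀ x, p x ∈ Z := fun x => Submodule.coe_mem _
  have hp2 : ∀ z ∈ Z, p z = z := by
    intro z hz
    have := Submodule.projectionOnto_apply_left hC ⟨z, hz⟩
    exact congrArg Subtype.val this
  let P : X →ₗ[ℂ] X := (Nat.card H : ℂ)⁻¹ •
    ∑ g ∈ Finset.univ.filter (fun g : G => g ∈ H), (ρ g : X →ₗ[ℂ] X) ∘ₗ p ∘ₗ ρ g⁻¹
  have hP : ∀ x, P x = (Nat.card H : ℂ)⁻¹ •
      ∑ g ∈ Finset.univ.filter (fun g : G => g ∈ H), ρ g (p (ρ g⁻¹ x)) := by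
    intro x
    simp [P, LinearMap.sum_apply]
  have hP1 : ∀ x, P x ∈ Z := by
    intro x
    rw [hP]
    refine Z.smul_mem _ (Z.sum_mem ?_)
    intro g hg
    exact hZ g (Finset.mem_filter.1 hg).2 _ (hp1 _)
  have hP2 : ∀ z ∈ Z, P z = z := by
    intro z hz
    rw [hP, Finset.sum_congr rfl (g := fun _ => z)]
    · rw [Finset.sum_const, card_filter_sub, ← Nat.cast_smul_eq_nsmul ℂ, smul_smul,
        inv_mul_cancel₀ (card_sub_ne H), one_smul]
    · intro g hg
      rw [hp2 _ (hZ _ (H.inv_mem (Finset.mem_filter.1 hg).2) _ hz), rho_self_inv]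
  have hP3 : ∀ g ∈ H, ∀ x, P (ρ g x) = ρ g (P x) := by
    intro g hg x
    rw [hP, hP, map_smul, map_sum]
    congr 1
    refine Finset.sum_bij' (fun h _ => g⁻¹ * h) (fun h _ => g * h) ?_ ?_ ?_ ?_ ?_
    · intro h hh
      simp only [Finset.mem_filter, Finset.mem_univ, true_and] at hh ⊢
      exact H.mul_mem (H.inv_mem hg) hh
    · intro h hh
      simp only [Finset.mem_filter, Finset.mem_univ, true_and] at hh ⊢
      exact H.mul_mem hg hh
    · intros; simp
    · intros; simp
    · intro h hh
      rw [← rho_mul, ← rho_mul]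
      congr 2
      · group
      · congr 2; group
  refine ⟨LinearMap.ker P ⊓ Y, inf_le_right, ?_, ?_, ?_⟩
  · intro g hg y hy
    refine ⟨?_, hY g hg y hy.2⟩
    have : P y = 0 := hy.1
    change P (ρ g y) = 0
    rw [hP3 g hg, this, map_zero]
  · rw [eq_bot_iff]
    rintro x ⟨h1, h2, h3⟩
    have h4 : P x = 0 := h2
    rw [hP2 x h1] at h4
    simp [h4]
  · apply le_antisymm
    · exact sup_le hZY inf_le_right
    · intro y hy
      refine Submodule.mem_sup.2 ⟨P y, hP1 y, y - P y, ⟨?_, Y.sub_mem hy (hZY (hP1 y))⟩, by abel⟩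
      change P (y - P y) = 0
      rw [map_sub, hP2 _ (hP1 y), sub_self]

end Avg

section FD
variable [FiniteDimensional ℂ X]

/-- Schur lemma. -/
theorem schur {ρ : Representation ℂ G X} {H : Subgroup G} {Y : Submodule ℂ X}
    (hY : Irr ρ H Y) (A : X →ₗ[ℂ] X) (hA : ∀ y ∈ Y, A y ∈ Y)
    (hc : ∀ g ∈ H, ∀ y ∈ Y, A (ρ g y) = ρ g (A y)) : ∃ c : ℂ, ∀ y ∈ Y, A y = c • y := by
  obtain ⟨h1, h2, h3⟩ := hY
  have : Nontrivial Y := Submodule.nontrivial_iff_ne_bot.2 h2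
  obtain ⟨c, hc'⟩ := Module.End.exists_eigenvalue (A.restrict hA)
  obtain ⟨v, hv⟩ := hc'.exists_hasEigenvector
  refine ⟨c, ?_⟩
  let Z : Submodule ℂ X := Y ⊓ LinearMap.ker (A - c • LinearMap.id)
  have hmem : ∀ y, y ∈ Z ↔ y ∈ Y ∧ A y = c • y := by
    intro y
    simp [Z, LinearMap.mem_ker, sub_eq_zero]
  have hZ : Stab ρ H Z := by
    intro g hg y hy
    rw [hmem] at hy ⊢
    refine ⟨h1 g hg y hy.1, ?_⟩
    rw [hc g hg y hy.1, hy.2, map_smul]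
  rcases h3 Z inf_le_left hZ with h | h
  · exfalso
    have hv1 : (v : X) ∈ Z := by
      rw [hmem]
      refine ⟨v.2, ?_⟩
      have := hv.apply_eq_smul
      have := congrArg Subtype.val this
      simpa using this
    rw [h, Submodule.mem_bot] at hv1
    exact hv.2 (Subtype.ext hv1)
  · intro y hy
    rw [← h, hmem] at hy
    exact hy.2

theorem exists_irr {ρ : Representation ℂ G X} {H : Subgroup G} {Y : Submodule ℂ X}
    (hY : Stab ρ H Y) (h0 : Y ≠ ⊥) : ∃ Z ≤ Y, Irr ρ H Z := by
  induction h : Module.finrank ℂ Y using Nat.strong_induction_on generalizing Y with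
  | _ d ih =>
    by_cases hI : Irr ρ H Y
    · exact ⟨Y, le_rfl, hI⟩
    · simp only [Irr, hY, h0, ne_eq, not_false_eq_true, true_and, not_forall, not_or] at hI
      obtain ⟨Z, hZ, hZs, hZ0, hZY⟩ := hI
      have hlt : Module.finrank ℂ Z < d := by
        rw [← h]
        exact Submodule.finrank_lt_finrank_of_lt (lt_of_le_of_ne hZ hZY)
      obtain ⟨Z', hZ', hi⟩ := ih _ hlt hZs hZ0 rfl
      exact ⟨Z', hZ'.trans hZ, hi⟩

variable [Fintype G]

/-- induction principle: a stable submodule is spanned by irreducible ones. -/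
theorem le_of_irr {ρ : Representation ℂ G X} {H : Subgroup G} {Y R : Submodule ℂ X}
    (hY : Stab ρ H Y) (h : ∀ Z ≤ Y, Irr ρ H Z → Z ≤ R) : Y ≤ R := by
  induction hd : Module.finrank ℂ Y using Nat.strong_induction_on generalizing Y with
  | _ d ih =>
    by_cases h0 : Y = ⊥
    · rw [h0]; exact bot_le
    obtain ⟨Z, hZ, hi⟩ := exists_irr hY h0
    obtain ⟨Z', hZ', hs, hb, ht⟩ := maschke hY hi.1 hZ
    have hne : Z' ≠ Y := by
      rintro rfl
      rw [inf_eq_left.2 hZ] at hb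
      exact hi.2.1 hb
    have hlt : Module.finrank ℂ Z' < d := by
      rw [← hd]
      exact Submodule.finrank_lt_finrank_of_lt (lt_of_le_of_ne hZ' hne)
    have h2 := ih _ hlt hs (fun Z'' hZ'' hi'' => h Z'' (hZ''.trans hZ') hi'') rfl
    rw [← ht]
    exact sup_le (h Z hZ hi) h2

/-- parity: some irreducible submodule inherits an odd dimension of fixed points. -/
theorem exists_irr_odd {ρ : Representation ℂ G X} {H K : Subgroup G} (hKH : K ≤ H)
    {Y : Submodule ℂ X}
    (hY : Stab ρ H Y) (h : Odd (Module.finrank ℂ (Y ⊓ fix ρ K : Submodule ℂ X))) :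
    ∃ Z ≤ Y, Irr ρ H Z ∧ Odd (Module.finrank ℂ (Z ⊓ fix ρ K : Submodule ℂ X)) := by
  induction hd : Module.finrank ℂ Y using Nat.strong_induction_on generalizing Y with
  | _ d ih =>
    by_cases h0 : Y = ⊥
    · subst h0
      rw [bot_inf_eq, finrank_bot] at h
      exact absurd h (by decide)
    obtain ⟨Z, hZ, hi⟩ := exists_irr hY h0
    obtain ⟨Z', hZ', hs, hb, ht⟩ := maschke hY hi.1 hZ
    have hne : Z' ≠ Y := by
      rintro rfl
      rw [inf_eq_left.2 hZ] at hb
      exact hi.2.1 hb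
    have hlt : Module.finrank ℂ Z' < d := by
      rw [← hd]
      exact Submodule.finrank_lt_finrank_of_lt (lt_of_le_of_ne hZ' hne)
    have hsum : (Y ⊓ fix ρ K : Submodule ℂ X) = (Z ⊓ fix ρ K) ⊔ (Z' ⊓ fix ρ K) := by
      apply le_antisymm
      · rintro y ⟨hy, hyK⟩
        rw [← ht] at hy
        obtain ⟨a, ha, b, hb, rfl⟩ := Submodule.mem_sup.1 hy
        rw [← avg_of_fix hyK, map_add]
        exact Submodule.add_mem_sup ⟨avg_mem (hi.1.mono hKH) ha, avg_mem_fix _ _ _⟩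
          ⟨avg_mem (hs.mono hKH) hb, avg_mem_fix _ _ _⟩
      · exact sup_le (inf_le_inf_right _ hZ) (inf_le_inf_right _ hZ')
    have hdis : (Z ⊓ fix ρ K) ⊓ (Z' ⊓ fix ρ K) = ⊥ := by
      rw [eq_bot_iff, ← hb]
      exact inf_le_inf inf_le_left inf_le_left
    have hfr := Submodule.finrank_sup_add_finrank_inf_eq (Z ⊓ fix ρ K) (Z' ⊓ fix ρ K)
    rw [hdis, finrank_bot, add_zero, ← hsum] at hfr
    by_cases ho : Odd (Module.finrank ℂ (Z ⊓ fix ρ K : Submodule ℂ X))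
    · exact ⟨Z, hZ, hi, ho⟩
    · have ho' : Odd (Module.finrank ℂ (Z' ⊓ fix ρ K : Submodule ℂ X)) := by
        rw [hfr] at h
        rw [Nat.not_odd_iff_even] at ho
        exact (Nat.odd_add'.1 h).2 ho
      obtain ⟨Z'', h1, h2, h3⟩ := ih _ hlt hs ho' rfl
      exact ⟨Z'', h1.trans hZ', h2, h3⟩

/-- semisimplicity of central operators. -/
theorem semisimple {ρ : Representation ℂ G X} {H : Subgroup G} (A : X →ₗ[ℂ] X)
    (hA : ∀ Y : Submodule ℂ X, Stab ρ H Y → ∀ y ∈ Y, A y ∈ Y)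
    (hc : ∀ g ∈ H, ∀ y, A (ρ g y) = ρ g (A y)) (b : ℂ) {x : X}
    (hx : A (A x - b • x) = b • (A x - b • x)) : A x = b • x := by
  let N : X →ₗ[ℂ] X := A - b • LinearMap.id
  have hN : ∀ y, N y = A y - b • y := fun y => by simp [N]
  have hNc : ∀ g ∈ H, ∀ y, N (ρ g y) = ρ g (N y) := by
    intro g hg y
    rw [hN, hN, hc g hg, map_sub, map_smul]
  let Y := LinearMap.ker (N ∘ₗ N)
  let Z := LinearMap.ker N
  have hZ : Stab ρ H Z := by
    intro g hg y hy
    have : N y = 0 := hy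
    change N _ = 0
    rw [hNc g hg, this, map_zero]
  have hY : Stab ρ H Y := by
    intro g hg y hy
    have : N (N y) = 0 := hy
    change N (N _) = 0
    rw [hNc g hg, hNc g hg, this, map_zero]
  have hZY : Z ≤ Y := by
    intro y hy
    have : N y = 0 := hy
    change N (N _) = 0
    rw [this, map_zero]
  obtain ⟨Z', h1, h2, h3, h4⟩ := maschke hY hZ hZY
  have hxY : x ∈ Y := by
    change N (N x) = 0
    rw [hN, hN, hx, sub_self]
  rw [← h4] at hxY
  obtain ⟨a, ha, c, hc', rfl⟩ := Submodule.mem_sup.1 hxY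
  have hNc2 : N c ∈ Z ⊓ Z' := by
    refine ⟨h1 hc', ?_⟩
    rw [hN]
    exact Z'.sub_mem (hA Z' h2 c hc') (Z'.smul_mem _ hc')
  rw [h3, Submodule.mem_bot] at hNc2
  have ha' : N a = 0 := ha
  have : N (a + c) = 0 := by rw [map_add, ha', hNc2, add_zero]
  rw [hN, sub_eq_zero] at this
  exact this

end FD

/-- image of a stable submodule under an equivariant map. -/
theorem Stab.map {X₂ : Type} [AddCommGroup X₂] [Module ℂ X₂]
    {ρ : Representation ℂ G X} {ρ₂ : Representation ℂ G X₂} {H : Subgroup G} {Y : Submodule ℂ X}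
    (hY : Stab ρ H Y) (f : X →ₗ[ℂ] X₂) (hf : ∀ g ∈ H, ∀ y ∈ Y, f (ρ g y) = ρ₂ g (f y)) :
    Stab ρ₂ H (Y.map f) := by
  rintro g hg _ ⟨y, hy, rfl⟩
  exact ⟨ρ g y, hY g hg y hy, hf g hg y hy⟩

/-- irreducibility transfers along equivariant injections. -/
theorem irr_map_iff {X₂ : Type} [AddCommGroup X₂] [Module ℂ X₂]
    {ρ : Representation ℂ G X} {ρ₂ : Representation ℂ G X₂} {H : Subgroup G} {Y : Submodule ℂ X}
    (hY : Stab ρ H Y) (f : X →ₗ[ℂ] X₂) (hf : ∀ g ∈ H, ∀ y ∈ Y, f (ρ g y) = ρ₂ g (f y))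
    (hinj : ∀ y ∈ Y, f y = 0 → y = 0) :
    Irr ρ₂ H (Y.map f) ↔ Irr ρ H Y := by
  have hinj' : ∀ a ∈ Y, ∀ b ∈ Y, f a = f b → a = b := by
    intro a ha b hb hab
    have := hinj (a - b) (Y.sub_mem ha hb) (by rw [map_sub, hab, sub_self])
    exact sub_eq_zero.1 this
  have key : ∀ Z ≤ Y, Stab ρ₂ H (Z.map f) → Stab ρ H Z := by
    intro Z hZ hs g hg z hz
    obtain ⟨z', hz', h⟩ := hs g hg (f z) ⟨z, hz, rfl⟩
    rw [← hf g hg z (hZ hz)] at h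
    rw [← hinj' _ (hZ hz') _ (hY g hg z (hZ hz)) h]
    exact hz'
  have bot_iff : ∀ Z ≤ Y, Z.map f = ⊥ ↔ Z = ⊥ := by
    intro Z hZ
    constructor
    · intro h
      rw [eq_bot_iff]
      intro z hz
      have : f z ∈ Z.map f := ⟨z, hz, rfl⟩
      rw [h, Submodule.mem_bot] at this
      simp [hinj z (hZ hz) this]
    · rintro rfl; simp
  constructor
  · rintro ⟨h1, h2, h3⟩
    refine ⟨hY, fun h => h2 ((bot_iff Y le_rfl).2 h), ?_⟩
    intro Z hZ hs
    rcases h3 (Z.map f) (Submodule.map_mono hZ) (hs.map f (fun g hg y hy => hf g hg y (hZ hy)))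
      with h | h
    · exact Or.inl ((bot_iff Z hZ).1 h)
    · right
      apply le_antisymm hZ
      intro y hy
      have : f y ∈ Z.map f := by rw [h]; exact ⟨y, hy, rfl⟩
      obtain ⟨z, hz, hzy⟩ := this
      rw [← hinj' z (hZ hz) y hy hzy]
      exact hz
  · rintro ⟨h1, h2, h3⟩
    refine ⟨hY.map f hf, fun h => h2 ((bot_iff Y le_rfl).1 h), ?_⟩
    intro Z hZ hs
    have hZm : Z = (Y ⊓ Z.comap f).map f := by
      apply le_antisymm
      · intro z hz
        obtain ⟨y, hy, rfl⟩ := hZ hz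
        exact ⟨y, ⟨hy, hz⟩, rfl⟩
      · rintro _ ⟨y, hy, rfl⟩
        exact hy.2
    rw [hZm] at hs ⊢
    rcases h3 _ inf_le_left (key _ inf_le_left hs) with h | h
    · left; rw [h]; simp
    · right; rw [h]

end Generic

end SpP


namespace SpP

/-- the symplectic space -/
abbrev W (n : ℕ) (F : Type) : Type := Fin n → F × F

section Symp

variable {n : ℕ} {F : Type} [Field F]

/-- the symplectic form -/
def B : W n F →ₗ[F] W n F →ₗ[F] F :=
  LinearMap.mk₂ F (fun x y => ∑ l, ((x l).1 * (y l).2 - (x l).2 * (y l).1))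
    (by
      intro a b c
      rw [← Finset.sum_add_distrib]
      refine Finset.sum_congr rfl fun l _ => ?_
      simp only [Pi.add_apply, Prod.fst_add, Prod.snd_add]; ring)
    (by
      intro a b c
      rw [smul_eq_mul, Finset.mul_sum]
      refine Finset.sum_congr rfl fun l _ => ?_
      simp only [Pi.smul_apply, Prod.smul_fst, Prod.smul_snd, smul_eq_mul]; ring)
    (by
      intro a b c
      rw [← Finset.sum_add_distrib]
      refine Finset.sum_congr rfl fun l _ => ?_
      simp only [Pi.add_apply, Prod.fst_add, Prod.snd_add]; ring)
    (by
      intro a b c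
      rw [smul_eq_mul, Finset.mul_sum]
      refine Finset.sum_congr rfl fun l _ => ?_
      simp only [Pi.smul_apply, Prod.smul_fst, Prod.smul_snd, smul_eq_mul]; ring)

theorem B_apply (x y : W n F) : B x y = ∑ l, ((x l).1 * (y l).2 - (x l).2 * (y l).1) := rfl

/-- basis vectors -/
def e (k : ℕ) : W n F := fun l => if l.val = k then (1, 0) else 0
/-- basis vectors -/
def f (k : ℕ) : W n F := fun l => if l.val = k then (0, 1) else 0

theorem B_self (x : W n F) : B x x = 0 := by
  rw [B_apply]
  refine Finset.sum_eq_zero fun l _ => ?_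
  ring

theorem B_swap (x y : W n F) : B x y = - B y x := by
  rw [B_apply, B_apply, ← Finset.sum_neg_distrib]
  refine Finset.sum_congr rfl fun l _ => ?_
  ring

theorem B_f (x : W n F) (l : Fin n) : B x (f l.val) = (x l).1 := by
  rw [B_apply, Finset.sum_eq_single l]
  · simp [f]
  · intro m _ hm
    have : m.val ≠ l.val := fun h => hm (Fin.ext h)
    simp [f, this]
  · simp

theorem B_e (x : W n F) (l : Fin n) : B x (e l.val) = - (x l).2 := by
  rw [B_apply, Finset.sum_eq_single l]
  · simp [e]
  · intro m _ hm
    have : m.val ≠ l.val := fun h => hm (Fin.ext h)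
    simp [e, this]
  · simp

theorem e_big {k : ℕ} (h : n ≤ k) : (e k : W n F) = 0 := by
  funext l
  have : l.val ≠ k := by have := l.2; omega
  simp [e, this]

theorem f_big {k : ℕ} (h : n ≤ k) : (f k : W n F) = 0 := by
  funext l
  have : l.val ≠ k := by have := l.2; omega
  simp [f, this]

theorem B_ee (k l : ℕ) : B (e k : W n F) (e l) = 0 := by
  by_cases h : l < n
  · rw [show l = (⟨l, h⟩ : Fin n).val from rfl, B_e]
    by_cases h2 : l = k <;> simp [e, h2]
  · rw [e_big (k := l) (by omega)]; simp

theorem B_ff (k l : ℕ) : B (f k : W n F) (f l) = 0 := by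
  by_cases h : l < n
  · rw [show l = (⟨l, h⟩ : Fin n).val from rfl, B_f]
    by_cases h2 : l = k <;> simp [f, h2]
  · rw [f_big (k := l) (by omega)]; simp

theorem B_ef {k : ℕ} (h : k < n) : B (e k : W n F) (f k) = 1 := by
  rw [show k = (⟨k, h⟩ : Fin n).val from rfl, B_f]
  simp [e]

theorem B_fe {k : ℕ} (h : k < n) : B (f k : W n F) (e k) = -1 := by
  rw [B_swap, B_ef h]

theorem B_ef_ne {k l : ℕ} (hkl : k ≠ l) : B (e k : W n F) (f l) = 0 := by
  by_cases h : l < n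
  · rw [show l = (⟨l, h⟩ : Fin n).val from rfl, B_f]
    simp [e, hkl.symm]
  · rw [f_big (k := l) (by omega)]; simp

theorem B_fe_ne {k l : ℕ} (hkl : k ≠ l) : B (f k : W n F) (e l) = 0 := by
  rw [B_swap, B_ef_ne hkl.symm, neg_zero]

theorem B_nondeg {x : W n F} (h : ∀ y, B x y = 0) : x = 0 := by
  funext l
  have h1 := h (f l.val)
  have h2 := h (e l.val)
  rw [B_f] at h1
  rw [B_e, neg_eq_zero] at h2
  exact Prod.ext h1 h2

theorem W_ext {x y : W n F} (h : ∀ k < n, B x (e k) = B y (e k) ∧ B x (f k) = B y (f k)) :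
    x = y := by
  funext l
  obtain ⟨h1, h2⟩ := h l.val l.2
  rw [B_e, B_e, neg_inj] at h1
  rw [B_f, B_f] at h2
  exact Prod.ext h2 h1

variable (n F) in
/-- the isometry group -/
def GG : Subgroup (W n F ≃ₗ[F] W n F) where
  carrier := {g | ∀ x y, B (g x) (g y) = B x y}
  mul_mem' := by
    intro g h hg hh x y
    change B (g (h x)) (g (h y)) = _
    rw [hg, hh]
  one_mem' := fun x y => rfl
  inv_mem' := by
    intro g hg x y
    change B (g.symm x) (g.symm y) = B x y
    have := hg (g.symm x) (g.symm y)
    rw [g.apply_symm_apply, g.apply_symm_apply] at this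
    exact this.symm

/-- the isometry group, as a type -/
abbrev GT (n : ℕ) (F : Type) [Field F] : Type := ↥(GG n F)

theorem smul_def' (g : GT n F) (x : W n F) : g • x = g.1 x := rfl

theorem B_smul (g : GT n F) (x y : W n F) : B (g • x) (g • y) = B x y := g.2 x y

theorem smul_lin (g : GT n F) (c : F) (x : W n F) : g • (c • x) = c • (g • x) :=
  g.1.map_smul c x

theorem gt_ext {g h : GT n F} (H : ∀ x : W n F, g • x = h • x) : g = h :=
  Subtype.ext (LinearEquiv.ext H)

theorem B_smul_left (g : GT n F) (x y : W n F) : B (g • x) y = B x (g⁻¹ • y) := by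
  rw [← B_smul g x, smul_inv_smul]

open Classical in
/-- build an isometry from a linear map. -/
noncomputable def mkG (φ : W n F →ₗ[F] W n F) : GT n F :=
  if h : ∀ x y, B (φ x) (φ y) = B x y then
    ⟨LinearEquiv.ofInjectiveEndo φ (by
      rw [← LinearMap.ker_eq_bot, eq_bot_iff]
      intro x hx
      have hx' : φ x = 0 := hx
      have : x = 0 := B_nondeg (fun y => by rw [← h, hx']; simp)
      simp [this]), h⟩
  else 1

theorem mkG_smul {φ : W n F →ₗ[F] W n F} (h : ∀ x y, B (φ x) (φ y) = B x y) (x : W n F) :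
    mkG φ • x = φ x := by
  unfold mkG
  rw [dif_pos h]
  rfl

/-- rank one map -/
def rk (v w : W n F) : W n F →ₗ[F] W n F := (B.flip v).smulRight w

theorem rk_apply (v w x : W n F) : rk v w x = B x v • w := rfl

/-- transvection -/
noncomputable def tv (b : F) (v : W n F) : GT n F := mkG (LinearMap.id + b • rk v v)

theorem tv_smul (b : F) (v x : W n F) : tv b v • x = x + (b * B x v) • v := by
  unfold tv
  rw [mkG_smul]
  · simp [rk_apply, smul_smul]
  · intro x y
    simp only [LinearMap.add_apply, LinearMap.id_apply, LinearMap.smul_apply, rk_apply,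
      map_add, map_smul, smul_eq_mul, B_self]
    rw [B_swap v y]; ring

/-- elements of the unipotent radical -/
noncomputable def uu (i : ℕ) (w : W n F) (b : F) : GT n F :=
  mkG (LinearMap.id - rk (e i) (w + b • e i) - rk w (e i))

theorem uu_smul {i : ℕ} {w : W n F} (hw : B w (e i) = 0) (b : F) (x : W n F) :
    uu i w b • x = x - B x (e i) • (w + b • e i) - B x w • e i := by
  unfold uu
  rw [mkG_smul]
  · simp [rk_apply]
  · intro x y
    simp only [LinearMap.sub_apply, LinearMap.add_apply, LinearMap.id_apply, LinearMap.smul_apply,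
      rk_apply, map_add, map_smul, map_sub, smul_eq_mul, B_self]
    rw [B_swap (e i) w, hw, B_swap w y, B_swap (e i) y]; ring

/-- torus elements -/
noncomputable def hh (i : ℕ) (a : Fˣ) : GT n F :=
  mkG (LinearMap.id + ((a : F) - 1) • rk (f i) (e i) - ((a⁻¹ : Fˣ) - 1 : F) • rk (e i) (f i))

theorem hh_smul {i : ℕ} (hi : i < n) (a : Fˣ) (x : W n F) :
    (hh i a : GT n F) • x = x + (((a : F) - 1) * B x (f i)) • e i
      - ((((a⁻¹ : Fˣ) : F) - 1) * B x (e i)) • f i := by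
  unfold hh
  rw [mkG_smul]
  · simp [rk_apply, smul_smul]
  · intro x y
    simp only [LinearMap.sub_apply, LinearMap.add_apply, LinearMap.id_apply, LinearMap.smul_apply,
      rk_apply, map_add, map_smul, map_sub, smul_eq_mul, B_self]
    rw [B_fe hi, B_ef hi, B_swap (f i) y, B_swap (e i) y]
    have : (a : F) * ((a⁻¹ : Fˣ) : F) = 1 := by simp
    linear_combination (B x (e i) * B y (f i) - B x (f i) * B y (e i)) * this

/-- Weyl element -/
noncomputable def ww (i : ℕ) : GT n F :=
  mkG (LinearMap.id + rk (f i) (f i - e i) + rk (e i) (e i + f i))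

theorem ww_smul {i : ℕ} (hi : i < n) (x : W n F) :
    (ww i : GT n F) • x = x + B x (f i) • (f i - e i) + B x (e i) • (e i + f i) := by
  unfold ww
  rw [mkG_smul]
  · simp [rk_apply]
  · intro x y
    simp only [LinearMap.sub_apply, LinearMap.add_apply, LinearMap.id_apply, LinearMap.smul_apply,
      rk_apply, map_add, map_smul, map_sub, smul_eq_mul, B_self]
    rw [B_fe hi, B_ef hi, B_swap (f i) y, B_swap (e i) y]
    ring

/-- swap of the indices `j` and `j+1` -/
noncomputable def ss (j : ℕ) : GT n F :=
  mkG (LinearMap.id - rk (f (j+1) - f j) (e (j+1) - e j) + rk (e (j+1) - e j) (f (j+1) - f j))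

theorem ss_smul {j : ℕ} (hj : j + 1 < n) (x : W n F) :
    (ss j : GT n F) • x = x - (B x (f (j+1)) - B x (f j)) • (e (j+1) - e j)
      + (B x (e (j+1)) - B x (e j)) • (f (j+1) - f j) := by
  have h1 : j ≠ j + 1 := by omega
  have h2 : j < n := by omega
  unfold ss
  rw [mkG_smul]
  · simp [rk_apply]
  · intro x y
    simp only [LinearMap.sub_apply, LinearMap.add_apply, LinearMap.id_apply, LinearMap.smul_apply,
      rk_apply, map_add, map_smul, map_sub, smul_eq_mul, B_self, B_ee, B_ff, B_ef hj, B_fe hj,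
      B_ef h2, B_fe h2, B_ef_ne h1, B_ef_ne h1.symm, B_fe_ne h1, B_fe_ne h1.symm]
    rw [B_swap (f j) y, B_swap (e j) y, B_swap (f (j+1)) y, B_swap (e (j+1)) y]
    ring

/-- root element -/
noncomputable def xa (j : ℕ) (c : F) : GT n F := uu (j+1) (-(c • f j)) 0

theorem xa_smul {j : ℕ} (c : F) (x : W n F) :
    (xa j c : GT n F) • x = x + (c * B x (f j)) • e (j+1) + (c * B x (e (j+1))) • f j := by
  have h1 : j ≠ j + 1 := by omega
  unfold xa
  rw [uu_smul]
  · simp only [map_neg, map_smul, smul_eq_mul]; module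
  · simp [B_fe_ne h1]

/-- levels -/
def Gk (k : ℕ) : Subgroup (GT n F) where
  carrier := {g | ∀ l, k ≤ l → g • (e l : W n F) = e l ∧ g • (f l : W n F) = f l}
  mul_mem' := by
    intro g h hg hh l hl
    rw [mul_smul, mul_smul, (hh l hl).1, (hh l hl).2]
    exact hg l hl
  one_mem' := fun l _ => ⟨one_smul _ _, one_smul _ _⟩
  inv_mem' := by
    intro g hg l hl
    rw [inv_smul_eq_iff, inv_smul_eq_iff, (hg l hl).1, (hg l hl).2]
    exact ⟨rfl, rfl⟩

theorem mem_Gk {k : ℕ} {g : GT n F} :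
    g ∈ Gk k ↔ ∀ l, k ≤ l → g • (e l : W n F) = e l ∧ g • (f l : W n F) = f l := Iff.rfl

theorem Gk_mono {k l : ℕ} (h : k ≤ l) : (Gk k : Subgroup (GT n F)) ≤ Gk l :=
  fun _ hg m hm => hg m (h.trans hm)

theorem Gk_top {k : ℕ} (h : n ≤ k) : (Gk k : Subgroup (GT n F)) = ⊤ := by
  rw [eq_top_iff]
  intro g _ l hl
  rw [e_big (h.trans hl), f_big (h.trans hl), smul_zero]
  exact ⟨rfl, rfl⟩

/-- level subspaces -/
def Wk (k : ℕ) : Submodule F (W n F) where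
  carrier := {x | ∀ l, k ≤ l → B x (e l) = 0 ∧ B x (f l) = 0}
  add_mem' := by
    intro a b ha hb l hl
    simp [ha l hl, hb l hl]
  zero_mem' := by intro l _; simp
  smul_mem' := by
    intro c a ha l hl
    simp [ha l hl]

theorem mem_Wk {k : ℕ} {x : W n F} :
    x ∈ (Wk k : Submodule F (W n F)) ↔ ∀ l, k ≤ l → B x (e l) = 0 ∧ B x (f l) = 0 := Iff.rfl

theorem Wk_mono {k l : ℕ} (h : k ≤ l) : (Wk k : Submodule F (W n F)) ≤ Wk l :=
  fun _ hg m hm => hg m (h.trans hm)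

theorem Wk_zero {x : W n F} (hx : x ∈ (Wk 0 : Submodule F (W n F))) : x = 0 :=
  W_ext fun k _ => by
    have := hx k (Nat.zero_le k)
    simp [this]

theorem e_mem_Wk {k l : ℕ} (h : l < k) : (e l : W n F) ∈ (Wk k : Submodule F (W n F)) := by
  intro m hm
  exact ⟨B_ee _ _, B_ef_ne (by omega)⟩

theorem f_mem_Wk {k l : ℕ} (h : l < k) : (f l : W n F) ∈ (Wk k : Submodule F (W n F)) := by
  intro m hm
  exact ⟨B_fe_ne (by omega), B_ff _ _⟩

theorem smul_mem_Wk {k : ℕ} {g : GT n F} (hg : g ∈ Gk k) {x : W n F}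
    (hx : x ∈ (Wk k : Submodule F (W n F))) : g • x ∈ (Wk k : Submodule F (W n F)) := by
  intro l hl
  have h1 := (hg l hl).1
  have h2 := (hg l hl).2
  constructor
  · rw [← h1, B_smul]; exact (hx l hl).1
  · rw [← h2, B_smul]; exact (hx l hl).2

/-- decomposition `W_{i+1} = F e_i + F f_i + W_i`. -/
theorem Wk_decomp {i : ℕ} (hi : i < n) {x : W n F} (hx : x ∈ (Wk (i+1) : Submodule F (W n F))) :
    ∃ x' ∈ (Wk i : Submodule F (W n F)), x = B x (f i) • e i - B x (e i) • f i + x' := by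
  refine ⟨x - B x (f i) • e i + B x (e i) • f i, ?_, by abel⟩
  intro l hl
  rcases hl.eq_or_lt with rfl | hl
  · simp [B_ee, B_ff, B_ef hi, B_fe hi]
  · have h1 : i ≠ l := by omega
    have := hx l hl
    simp [B_ee, B_ff, B_ef_ne h1, B_fe_ne h1, this]

/-- orthogonal decomposition of the whole space along a level. -/
theorem Gk_fix_of_orth {k : ℕ} {g : GT n F} (hg : g ∈ Gk k) {x : W n F}
    (hx : ∀ y ∈ (Wk k : Submodule F (W n F)), B x y = 0) : g • x = x := by
  -- g x - x is orthogonal to everything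
  apply W_ext
  intro l hl
  by_cases hkl : k ≤ l
  · have h1 := (hg l hkl).1
    have h2 := (hg l hkl).2
    constructor
    · conv_lhs => rw [← h1, B_smul]
    · conv_lhs => rw [← h2, B_smul]
  · have hk : l < k := by omega
    rw [B_smul_left, B_smul_left, hx _ (smul_mem_Wk (inv_mem hg) (e_mem_Wk hk)),
      hx _ (smul_mem_Wk (inv_mem hg) (f_mem_Wk hk)), hx _ (e_mem_Wk hk), hx _ (f_mem_Wk hk)]
    exact ⟨rfl, rfl⟩

/-- Two elements of `Gk k` agreeing on `Wk k` agree. -/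
theorem Gk_ext {k : ℕ} {g h : GT n F} (hg : g ∈ Gk k) (hh : h ∈ Gk k)
    (H : ∀ x ∈ (Wk k : Submodule F (W n F)), g • x = h • x) : g = h := by
  have key : ∀ u : GT n F, u ∈ Gk k → (∀ x ∈ (Wk k : Submodule F (W n F)), u • x = x) → u = 1 := by
    intro u hu hx
    apply gt_ext
    intro x
    rw [one_smul]
    apply W_ext
    intro l hl
    by_cases hkl : k ≤ l
    · have h1 := (hu l hkl).1
      have h2 := (hu l hkl).2
      constructor
      · conv_lhs => rw [← h1, B_smul]
      · conv_lhs => rw [← h2, B_smul]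
    · have hk : l < k := by omega
      constructor
      · conv_lhs => rw [← hx _ (e_mem_Wk hk), B_smul]
      · conv_lhs => rw [← hx _ (f_mem_Wk hk), B_smul]
  have := key (h⁻¹ * g) (mul_mem (inv_mem hh) hg) (by
    intro x hx
    rw [mul_smul, H x hx, inv_smul_smul])
  rw [inv_mul_eq_one] at this
  exact this.symm

end Symp

end SpP


namespace SpP

section Symp2

variable {n : ℕ} {F : Type} [Field F]

theorem tv_mem_Gk {k : ℕ} (b : F) {v : W n F} (hv : v ∈ (Wk k : Submodule F (W n F))) :
    tv b v ∈ Gk k := by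
  intro l hl
  rw [tv_smul, tv_smul, B_swap (e l) v, B_swap (f l) v, (hv l hl).1, (hv l hl).2]
  simp

theorem tv_conj (g : GT n F) (b : F) (v : W n F) : g * tv b v = tv b (g • v) * g := by
  apply gt_ext
  intro x
  rw [mul_smul, mul_smul, tv_smul, tv_smul, B_smul, smul_add, smul_lin]

theorem tv_zero (v : W n F) : tv 0 v = 1 := by
  apply gt_ext
  intro x
  rw [tv_smul, one_smul]; simp

theorem tv_zero' (b : F) : tv b (0 : W n F) = 1 := by
  apply gt_ext
  intro x
  rw [tv_smul, one_smul]; simp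

theorem tv_add (b c : F) (v : W n F) : tv b v * tv c v = tv (b + c) v := by
  apply gt_ext
  intro x
  rw [mul_smul, tv_smul, tv_smul, tv_smul]
  simp only [map_add, map_smul, LinearMap.add_apply, LinearMap.smul_apply, B_self, smul_eq_mul]
  module

theorem tv_scale (b c : F) (v : W n F) : tv b (c • v) = tv (b * c ^ 2) v := by
  apply gt_ext
  intro x
  rw [tv_smul, tv_smul]
  simp only [map_smul, smul_eq_mul]
  module

/-- unipotent radical -/
def U (i : ℕ) : Subgroup (GT n F) where
  carrier := {g | g ∈ Gk (i+1) ∧ g • (e i : W n F) = e i ∧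
    ∀ x ∈ (Wk i : Submodule F (W n F)), ∃ c : F, g • x = x + c • e i}
  mul_mem' := by
    rintro g h ⟨hg1, hg2, hg3⟩ ⟨hh1, hh2, hh3⟩
    refine ⟨mul_mem hg1 hh1, by rw [mul_smul, hh2, hg2], ?_⟩
    intro x hx
    obtain ⟨c, hc⟩ := hh3 x hx
    obtain ⟨d, hd⟩ := hg3 x hx
    refine ⟨d + c, ?_⟩
    rw [mul_smul, hc, smul_add, smul_lin, hg2, hd]
    module
  one_mem' := ⟨one_mem _, one_smul _ _, fun x _ => ⟨0, by rw [one_smul]; simp⟩⟩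
  inv_mem' := by
    rintro g ⟨hg1, hg2, hg3⟩
    have h2 : g⁻¹ • (e i : W n F) = e i := by rw [inv_smul_eq_iff, hg2]
    refine ⟨inv_mem hg1, h2, ?_⟩
    intro x hx
    obtain ⟨d, hd⟩ := hg3 x hx
    refine ⟨-d, ?_⟩
    rw [inv_smul_eq_iff, smul_add, smul_lin, hg2, hd]
    module

theorem mem_U {i : ℕ} {g : GT n F} : g ∈ U i ↔ g ∈ Gk (i+1) ∧ g • (e i : W n F) = e i ∧
    ∀ x ∈ (Wk i : Submodule F (W n F)), ∃ c : F, g • x = x + c • e i := Iff.rfl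

theorem U_le (i : ℕ) : (U i : Subgroup (GT n F)) ≤ Gk (i+1) := fun _ h => h.1

theorem Wk_e {i : ℕ} {w : W n F} (hw : w ∈ (Wk i : Submodule F (W n F))) : B w (e i) = 0 :=
  (hw i le_rfl).1
theorem Wk_f {i : ℕ} {w : W n F} (hw : w ∈ (Wk i : Submodule F (W n F))) : B w (f i) = 0 :=
  (hw i le_rfl).2

theorem uu_mem {i : ℕ} {w : W n F} (hw : w ∈ (Wk i : Submodule F (W n F))) (b : F) :
    uu i w b ∈ U i := by
  refine ⟨?_, ?_, ?_⟩
  · intro l hl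
    have h := hw l (by omega)
    have h1 : l ≠ i := by omega
    rw [uu_smul (Wk_e hw), uu_smul (Wk_e hw), B_swap (e l) w, B_swap (f l) w, h.1, h.2,
      B_ee, B_fe_ne h1]
    simp
  · rw [uu_smul (Wk_e hw), B_ee, B_swap (e i) w, Wk_e hw]; simp
  · intro x hx
    refine ⟨- B x w, ?_⟩
    rw [uu_smul (Wk_e hw), Wk_e hx]; simp [sub_eq_add_neg]

theorem uu_f {i : ℕ} (hi : i < n) {w : W n F} (hw : w ∈ (Wk i : Submodule F (W n F))) (b : F) :
    uu i w b • (f i : W n F) = f i + w + b • e i := by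
  rw [uu_smul (Wk_e hw), B_fe hi, B_swap (f i) w, Wk_f hw]
  module

/-- extensionality on a level, in terms of the decomposition -/
theorem Gk_ext' {i : ℕ} (hi : i < n) {g h : GT n F} (hg : g ∈ Gk (i+1)) (hh : h ∈ Gk (i+1))
    (h1 : g • (e i : W n F) = h • e i) (h2 : g • (f i : W n F) = h • f i)
    (H : ∀ x ∈ (Wk i : Submodule F (W n F)), g • x = h • x) : g = h := by
  apply Gk_ext hg hh
  intro x hx
  obtain ⟨x', hx', hx2⟩ := Wk_decomp hi hx
  rw [hx2]
  simp only [smul_add, smul_sub, smul_lin, h1, h2, H x' hx']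

theorem U_exists {i : ℕ} (hi : i < n) {g : GT n F} (hg : g ∈ U i) :
    ∃ w ∈ (Wk i : Submodule F (W n F)), ∃ b : F, g = uu i w b := by
  obtain ⟨h1, h2, h3⟩ := hg
  have hf := smul_mem_Wk h1 (f_mem_Wk (n := n) (F := F) (Nat.lt_succ_self i))
  obtain ⟨w, hw, hw2⟩ := Wk_decomp hi hf
  have hfe : B (g • (f i : W n F)) (e i) = -1 := by
    conv_lhs => rw [← h2]
    rw [B_smul, B_fe hi]
  rw [hfe] at hw2
  set b := B (g • (f i : W n F)) (f i) with hb
  refine ⟨w, hw, b, Gk_ext' hi h1 (uu_mem hw b).1 ?_ ?_ ?_⟩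
  · rw [h2, (uu_mem hw b).2.1]
  · rw [uu_f hi hw, hw2]; module
  · intro x hx
    obtain ⟨c, hc⟩ := h3 x hx
    rw [hc, uu_smul (Wk_e hw), Wk_e hx]
    have h4 : B (g • x) (g • (f i : W n F)) = 0 := by rw [B_smul, Wk_f hx]
    rw [hc, hw2] at h4
    simp only [map_add, map_smul, map_sub, LinearMap.add_apply, LinearMap.smul_apply, smul_eq_mul,
      B_ee, B_ef hi, Wk_e hx, Wk_f hx, B_swap (e i) w, Wk_e hw] at h4
    have h5 : c = - B x w := by linear_combination h4
    rw [h5]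
    module

theorem hh_e {i : ℕ} (hi : i < n) (a : Fˣ) : (hh i a : GT n F) • (e i : W n F) = (a : F) • e i := by
  rw [hh_smul hi, B_ef hi, B_ee]; module

theorem hh_f {i : ℕ} (hi : i < n) (a : Fˣ) :
    (hh i a : GT n F) • (f i : W n F) = ((a⁻¹ : Fˣ) : F) • f i := by
  rw [hh_smul hi, B_ff, B_fe hi]; module

theorem hh_Wk {i : ℕ} (hi : i < n) (a : Fˣ) {x : W n F}
    (hx : x ∈ (Wk i : Submodule F (W n F))) : (hh i a : GT n F) • x = x := by
  rw [hh_smul hi, Wk_e hx, Wk_f hx]; simp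

theorem ww_e {i : ℕ} (hi : i < n) : (ww i : GT n F) • (e i : W n F) = f i := by
  rw [ww_smul hi, B_ef hi, B_ee]; module

theorem ww_f {i : ℕ} (hi : i < n) : (ww i : GT n F) • (f i : W n F) = - e i := by
  rw [ww_smul hi, B_fe hi, B_ff]; module

theorem ww_Wk {i : ℕ} (hi : i < n) {x : W n F}
    (hx : x ∈ (Wk i : Submodule F (W n F))) : (ww i : GT n F) • x = x := by
  rw [ww_smul hi, Wk_e hx, Wk_f hx]; simp

theorem hh_mem {i : ℕ} (hi : i < n) (a : Fˣ) : (hh i a : GT n F) ∈ Gk (i+1) := by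
  intro l hl
  have h1 : l ≠ i := by omega
  rw [hh_smul hi, hh_smul hi]
  simp [B_ee, B_ff, B_ef_ne h1, B_fe_ne h1]

theorem ww_mem {i : ℕ} (hi : i < n) : (ww i : GT n F) ∈ Gk (i+1) := by
  intro l hl
  have h1 : l ≠ i := by omega
  rw [ww_smul hi, ww_smul hi]
  simp [B_ee, B_ff, B_ef_ne h1, B_fe_ne h1]

theorem ss_mem {j : ℕ} (hj : j + 1 < n) : (ss j : GT n F) ∈ Gk (j+2) := by
  intro l hl
  have h1 : l ≠ j := by omega
  have h2 : l ≠ j + 1 := by omega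
  rw [ss_smul hj, ss_smul hj]
  simp [B_ee, B_ff, B_ef_ne h1, B_fe_ne h1, B_ef_ne h2, B_fe_ne h2]

theorem xa_mem {j : ℕ} (c : F) : (xa j c : GT n F) ∈ U (j+1) :=
  uu_mem (Submodule.neg_mem _ (Submodule.smul_mem _ _ (f_mem_Wk (Nat.lt_succ_self j)))) 0

theorem hh_mul {i : ℕ} (hi : i < n) (a b : Fˣ) : (hh i (a * b) : GT n F) = hh i a * hh i b := by
  apply Gk_ext' hi (hh_mem hi _) (mul_mem (hh_mem hi _) (hh_mem hi _))
  · rw [mul_smul, hh_e hi, hh_e hi, smul_lin, hh_e hi, smul_smul, Units.val_mul, mul_comm]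
  · rw [mul_smul, hh_f hi, hh_f hi, smul_lin, hh_f hi, smul_smul, mul_inv, Units.val_mul, mul_comm]
  · intro x hx
    rw [mul_smul, hh_Wk hi _ hx, hh_Wk hi _ hx, hh_Wk hi _ hx]

theorem hh_one {i : ℕ} (hi : i < n) : (hh i 1 : GT n F) = 1 := by
  have := hh_mul (n := n) (F := F) hi 1 1
  rw [mul_one] at this
  exact left_eq_mul.1 this

theorem hh_inv {i : ℕ} (hi : i < n) (a : Fˣ) : (hh i a : GT n F)⁻¹ = hh i a⁻¹ := by
  rw [inv_eq_iff_mul_eq_one, ← hh_mul hi, mul_inv_cancel, hh_one hi]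

theorem hh_pow {i : ℕ} (hi : i < n) (a : Fˣ) (m : ℕ) : (hh i (a ^ m) : GT n F) = hh i a ^ m := by
  induction m with
  | zero => simp [hh_one hi]
  | succ m ih => rw [pow_succ, pow_succ, hh_mul hi, ih]

theorem Gk_e {i : ℕ} {g : GT n F} (hg : g ∈ Gk i) : g • (e i : W n F) = e i := (hg i le_rfl).1
theorem Gk_f {i : ℕ} {g : GT n F} (hg : g ∈ Gk i) : g • (f i : W n F) = f i := (hg i le_rfl).2

theorem hh_comm {i : ℕ} (hi : i < n) (a : Fˣ) {g : GT n F} (hg : g ∈ Gk i) :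
    g * hh i a = hh i a * g := by
  apply Gk_ext' hi (mul_mem (Gk_mono (Nat.le_succ i) hg) (hh_mem hi a))
    (mul_mem (hh_mem hi a) (Gk_mono (Nat.le_succ i) hg))
  · rw [mul_smul, mul_smul, Gk_e hg, hh_e hi, smul_lin, Gk_e hg]
  · rw [mul_smul, mul_smul, Gk_f hg, hh_f hi, smul_lin, Gk_f hg]
  · intro x hx
    rw [mul_smul, mul_smul, hh_Wk hi _ hx, hh_Wk hi _ (smul_mem_Wk hg hx)]

theorem ww_comm {i : ℕ} (hi : i < n) {g : GT n F} (hg : g ∈ Gk i) :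
    g * ww i = ww i * g := by
  apply Gk_ext' hi (mul_mem (Gk_mono (Nat.le_succ i) hg) (ww_mem hi))
    (mul_mem (ww_mem hi) (Gk_mono (Nat.le_succ i) hg))
  · rw [mul_smul, mul_smul, Gk_e hg, ww_e hi, Gk_f hg]
  · rw [mul_smul, mul_smul, Gk_f hg, ww_f hi, smul_neg, Gk_e hg]
  · intro x hx
    rw [mul_smul, mul_smul, ww_Wk hi hx, ww_Wk hi (smul_mem_Wk hg hx)]

theorem ww_hh {i : ℕ} (hi : i < n) (a : Fˣ) :
    (ww i : GT n F) * hh i a = hh i a⁻¹ * ww i := by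
  apply Gk_ext' hi (mul_mem (ww_mem hi) (hh_mem hi a)) (mul_mem (hh_mem hi _) (ww_mem hi))
  · rw [mul_smul, mul_smul, hh_e hi, ww_e hi, hh_f hi, smul_lin, ww_e hi, inv_inv]
  · rw [mul_smul, mul_smul, hh_f hi, ww_f hi, smul_lin, ww_f hi, smul_neg, smul_neg, hh_e hi]
  · intro x hx
    rw [mul_smul, mul_smul, hh_Wk hi _ hx, ww_Wk hi hx, hh_Wk hi _ hx]

theorem ww_ww {i : ℕ} (hi : i < n) : (ww i : GT n F) * ww i = hh i (-1) := by
  apply Gk_ext' hi (mul_mem (ww_mem hi) (ww_mem hi)) (hh_mem hi _)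
  · rw [mul_smul, ww_e hi, ww_f hi, hh_e hi]; simp
  · rw [mul_smul, ww_f hi, smul_neg, ww_e hi, hh_f hi]; simp
  · intro x hx
    rw [mul_smul, ww_Wk hi hx, ww_Wk hi hx, hh_Wk hi _ hx]

/-- general criterion for normalizing `U i` -/
theorem U_conj {i : ℕ} {g : GT n F} (hg : g ∈ Gk (i+1)) {a : F} (ha : a ≠ 0)
    (hge : g • (e i : W n F) = a • e i)
    (hgW : ∀ x ∈ (Wk i : Submodule F (W n F)), g⁻¹ • x ∈ (Wk i : Submodule F (W n F)))
    {u : GT n F} (hu : u ∈ U i) : g * u * g⁻¹ ∈ U i := by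
  obtain ⟨h1, h2, h3⟩ := hu
  have hge' : g⁻¹ • (e i : W n F) = a⁻¹ • e i := by
    rw [inv_smul_eq_iff, smul_lin, hge, smul_smul, inv_mul_cancel₀ ha, one_smul]
  refine ⟨mul_mem (mul_mem hg h1) (inv_mem hg), ?_, ?_⟩
  · rw [mul_smul, mul_smul, hge', smul_lin, h2, smul_lin, hge, smul_smul, inv_mul_cancel₀ ha,
      one_smul]
  · intro x hx
    obtain ⟨c, hc⟩ := h3 _ (hgW x hx)
    refine ⟨c * a, ?_⟩
    rw [mul_smul, mul_smul, hc, smul_add, smul_inv_smul, smul_lin, hge, smul_smul]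

theorem U_conj_Gk {i : ℕ} {g : GT n F} (hg : g ∈ Gk i) {u : GT n F} (hu : u ∈ U i) :
    g * u * g⁻¹ ∈ U i :=
  U_conj (Gk_mono (Nat.le_succ i) hg) one_ne_zero (by rw [Gk_e hg, one_smul])
    (fun _ hx => smul_mem_Wk (inv_mem hg) hx) hu

theorem U_conj_Gk' {i : ℕ} {g : GT n F} (hg : g ∈ Gk i) {u : GT n F} (hu : u ∈ U i) :
    g⁻¹ * u * g ∈ U i := by
  have := U_conj_Gk (inv_mem hg) hu
  rwa [inv_inv] at this

theorem U_conj_hh {i : ℕ} (hi : i < n) (a : Fˣ) {u : GT n F} (hu : u ∈ U i) :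
    hh i a * u * (hh i a)⁻¹ ∈ U i :=
  U_conj (hh_mem hi a) a.ne_zero (hh_e hi a)
    (fun x hx => by rw [hh_inv hi, hh_Wk hi _ hx]; exact hx) hu

theorem U_conj_hh' {i : ℕ} (hi : i < n) (a : Fˣ) {u : GT n F} (hu : u ∈ U i) :
    (hh i a)⁻¹ * u * hh i a ∈ U i := by
  have := U_conj_hh hi a⁻¹ hu
  rwa [← hh_inv hi, inv_inv] at this

/-- the stabilizer of `e i`. -/
theorem stab_e {i : ℕ} (hi : i < n) {g : GT n F} (hg : g ∈ Gk (i+1))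
    (hge : g • (e i : W n F) = e i) : ∃ u ∈ U i, ∃ g' ∈ Gk i, g = u * g' := by
  have hf := smul_mem_Wk hg (f_mem_Wk (n := n) (F := F) (Nat.lt_succ_self i))
  obtain ⟨w, hw, hw2⟩ := Wk_decomp hi hf
  have hfe : B (g • (f i : W n F)) (e i) = -1 := by
    conv_lhs => rw [← hge]
    rw [B_smul, B_fe hi]
  rw [hfe] at hw2
  set b := B (g • (f i : W n F)) (f i) with hb
  refine ⟨uu i w b, uu_mem hw b, (uu i w b)⁻¹ * g, ?_, by group⟩
  intro l hl
  rw [mul_smul, mul_smul, inv_smul_eq_iff, inv_smul_eq_iff]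
  rcases hl.eq_or_lt with rfl | hl
  · rw [hge, (uu_mem hw b).2.1, uu_f hi hw, hw2]
    exact ⟨rfl, by module⟩
  · rw [(hg l hl).1, (hg l hl).2, ((uu_mem hw b).1 l hl).1, ((uu_mem hw b).1 l hl).2]
    exact ⟨rfl, rfl⟩

theorem U_trans {i : ℕ} (hi : i < n) {x : W n F} (hx : x ∈ (Wk (i+1) : Submodule F (W n F)))
    {a : F} (ha : a ≠ 0) (hxa : B x (e i) = -a) : ∃ u ∈ (U i : Subgroup (GT n F)), u • (a • f i : W n F) = x := by
  obtain ⟨w, hw, hw2⟩ := Wk_decomp hi hx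
  refine ⟨uu i (a⁻¹ • w) (a⁻¹ * B x (f i)), uu_mem (Submodule.smul_mem _ _ hw) _, ?_⟩
  rw [smul_lin, uu_f hi (Submodule.smul_mem _ _ hw)]
  conv_rhs => rw [hw2, hxa]
  rw [smul_add, smul_add, smul_smul, smul_smul, mul_inv_cancel₀ ha, ← mul_assoc,
    mul_inv_cancel₀ ha]
  module

theorem Wk_nondeg {k : ℕ} {x : W n F} (hx : x ∈ (Wk k : Submodule F (W n F))) (h0 : x ≠ 0) :
    ∃ y ∈ (Wk k : Submodule F (W n F)), B x y ≠ 0 := by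
  by_contra! h
  apply h0
  apply W_ext
  intro l _
  rw [map_zero]
  by_cases hl : k ≤ l
  · exact hx l hl
  · exact ⟨h _ (e_mem_Wk (by omega)), h _ (f_mem_Wk (by omega))⟩

theorem Gk_trans {k : ℕ} {x y : W n F} (hx : x ∈ (Wk k : Submodule F (W n F))) (hx0 : x ≠ 0)
    (hy : y ∈ (Wk k : Submodule F (W n F))) (hy0 : y ≠ 0) : ∃ g ∈ (Gk k : Subgroup (GT n F)), g • x = y := by
  have key : ∀ x ∈ (Wk k : Submodule F (W n F)), ∀ y ∈ (Wk k : Submodule F (W n F)), B x y ≠ 0 →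
      ∃ g ∈ (Gk k : Subgroup (GT n F)), g • x = y := by
    intro x hx y hy hxy
    refine ⟨tv (B x y)⁻¹ (x - y), tv_mem_Gk _ (Submodule.sub_mem _ hx hy), ?_⟩
    rw [tv_smul, map_sub, B_self, zero_sub, mul_neg, inv_mul_cancel₀ hxy]
    module
  have : ∃ z ∈ (Wk k : Submodule F (W n F)), B x z ≠ 0 ∧ B z y ≠ 0 := by
    obtain ⟨z1, hz1, h1⟩ := Wk_nondeg hx hx0
    obtain ⟨z2, hz2, h2⟩ := Wk_nondeg hy hy0
    rw [B_swap, neg_ne_zero] at h2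
    by_cases h3 : B z1 y = 0
    · by_cases h4 : B x z2 = 0
      · refine ⟨z1 + z2, Submodule.add_mem _ hz1 hz2, ?_, ?_⟩
        · rw [map_add, h4, add_zero]; exact h1
        · rw [map_add, LinearMap.add_apply, h3, zero_add]; exact h2
      · exact ⟨z2, hz2, h4, h2⟩
    · exact ⟨z1, hz1, h1, h3⟩
  obtain ⟨z, hz, h1, h2⟩ := this
  obtain ⟨g, hg, hg2⟩ := key x hx z hz h1
  obtain ⟨g', hg', hg2'⟩ := key z hz y hy h2
  exact ⟨g' * g, mul_mem hg' hg, by rw [mul_smul, hg2, hg2']⟩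

theorem tve_mem {i : ℕ} (b : F) : (tv b (e i) : GT n F) ∈ U i := by
  refine ⟨tv_mem_Gk b (e_mem_Wk (Nat.lt_succ_self i)), ?_, ?_⟩
  · rw [tv_smul, B_ee]; simp
  · intro x hx
    refine ⟨0, ?_⟩
    rw [tv_smul, Wk_e hx]; simp

theorem tv_f {i : ℕ} (hi : i < n) :
    (tv 1 (f i) : GT n F) = tv (-1) (e i) * ww i * tv (-1) (e i) := by
  apply gt_ext
  intro x
  simp only [mul_smul, tv_smul, ww_smul hi, map_add, map_sub, map_smul, LinearMap.add_apply,
    LinearMap.sub_apply, LinearMap.smul_apply, B_ee, B_ff, B_ef hi, B_fe hi, smul_eq_mul]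
  module

end Symp2

end SpP


namespace SpP

section Symp3

variable {n : ℕ} {F : Type} [Field F]

theorem ss_e {j : ℕ} (hj : j + 1 < n) : (ss j : GT n F) • (e j : W n F) = e (j+1) := by
  rw [ss_smul hj, B_ee, B_ee, B_ef (by omega), B_ef_ne (by omega)]; module

theorem ss_e' {j : ℕ} (hj : j + 1 < n) : (ss j : GT n F) • (e (j+1) : W n F) = e j := by
  rw [ss_smul hj, B_ee, B_ee, B_ef hj, B_ef_ne (by omega)]; module

theorem ss_f {j : ℕ} (hj : j + 1 < n) : (ss j : GT n F) • (f j : W n F) = f (j+1) := by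
  rw [ss_smul hj, B_ff, B_ff, B_fe (by omega), B_fe_ne (by omega)]; module

theorem ss_f' {j : ℕ} (hj : j + 1 < n) : (ss j : GT n F) • (f (j+1) : W n F) = f j := by
  rw [ss_smul hj, B_ff, B_ff, B_fe hj, B_fe_ne (by omega)]; module

theorem ss_Wk {j : ℕ} (hj : j + 1 < n) {x : W n F} (hx : x ∈ (Wk j : Submodule F (W n F))) :
    (ss j : GT n F) • x = x := by
  have h := Wk_mono (Nat.le_succ j) hx
  rw [ss_smul hj, Wk_e hx, Wk_f hx, Wk_e h, Wk_f h]; simp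

theorem Gk_ext2 {j : ℕ} (hj : j + 1 < n) {g h : GT n F} (hg : g ∈ Gk (j+2)) (hh : h ∈ Gk (j+2))
    (h1 : g • (e (j+1) : W n F) = h • e (j+1)) (h2 : g • (f (j+1) : W n F) = h • f (j+1))
    (h3 : g • (e j : W n F) = h • e j) (h4 : g • (f j : W n F) = h • f j)
    (H : ∀ x ∈ (Wk j : Submodule F (W n F)), g • x = h • x) : g = h := by
  apply Gk_ext' hj hg hh h1 h2
  intro x hx
  obtain ⟨x', hx', hx2⟩ := Wk_decomp (by omega) hx
  rw [hx2]
  simp only [smul_add, smul_sub, smul_lin, h3, h4, H x' hx']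

theorem ss_ss {j : ℕ} (hj : j + 1 < n) : (ss j : GT n F) * ss j = 1 := by
  apply Gk_ext2 hj (mul_mem (ss_mem hj) (ss_mem hj)) (one_mem _)
  · rw [mul_smul, ss_e' hj, ss_e hj, one_smul]
  · rw [mul_smul, ss_f' hj, ss_f hj, one_smul]
  · rw [mul_smul, ss_e hj, ss_e' hj, one_smul]
  · rw [mul_smul, ss_f hj, ss_f' hj, one_smul]
  · intro x hx
    rw [mul_smul, ss_Wk hj hx, ss_Wk hj hx, one_smul]

theorem ss_inv {j : ℕ} (hj : j + 1 < n) : (ss j : GT n F)⁻¹ = ss j :=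
  inv_eq_of_mul_eq_one_left (ss_ss hj)

theorem Gk_e1 {j : ℕ} {g : GT n F} (hg : g ∈ Gk j) : g • (e (j+1) : W n F) = e (j+1) :=
  (hg _ (Nat.le_succ j)).1
theorem Gk_f1 {j : ℕ} {g : GT n F} (hg : g ∈ Gk j) : g • (f (j+1) : W n F) = f (j+1) :=
  (hg _ (Nat.le_succ j)).2

theorem ss_comm {j : ℕ} (hj : j + 1 < n) {g : GT n F} (hg : g ∈ Gk j) :
    g * ss j = ss j * g := by
  have hg2 := Gk_mono (show j ≤ j + 2 by omega) hg
  apply Gk_ext2 hj (mul_mem hg2 (ss_mem hj)) (mul_mem (ss_mem hj) hg2)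
  · rw [mul_smul, mul_smul, ss_e' hj, Gk_e hg, Gk_e1 hg, ss_e' hj]
  · rw [mul_smul, mul_smul, ss_f' hj, Gk_f hg, Gk_f1 hg, ss_f' hj]
  · rw [mul_smul, mul_smul, ss_e hj, Gk_e hg, Gk_e1 hg, ss_e hj]
  · rw [mul_smul, mul_smul, ss_f hj, Gk_f hg, Gk_f1 hg, ss_f hj]
  · intro x hx
    rw [mul_smul, mul_smul, ss_Wk hj hx, ss_Wk hj (smul_mem_Wk hg hx)]

theorem hh_ss {j : ℕ} (hj : j + 1 < n) (a : Fˣ) :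
    (hh (j+1) a : GT n F) * ss j = ss j * hh j a := by
  have hj' : j < n := by omega
  have hm : (hh j a : GT n F) ∈ Gk (j+1) := hh_mem hj' a
  apply Gk_ext2 hj (mul_mem (hh_mem hj _) (ss_mem hj))
    (mul_mem (ss_mem hj) (Gk_mono (Nat.le_succ _) hm))
  · rw [mul_smul, mul_smul, ss_e' hj, Gk_e hm, ss_e' hj, hh_Wk hj _ (e_mem_Wk (Nat.lt_succ_self j))]
  · rw [mul_smul, mul_smul, ss_f' hj, Gk_f hm, ss_f' hj, hh_Wk hj _ (f_mem_Wk (Nat.lt_succ_self j))]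
  · rw [mul_smul, mul_smul, ss_e hj, hh_e hj, hh_e hj', smul_lin, ss_e hj]
  · rw [mul_smul, mul_smul, ss_f hj, hh_f hj, hh_f hj', smul_lin, ss_f hj]
  · intro x hx
    rw [mul_smul, mul_smul, ss_Wk hj hx, hh_Wk hj' _ hx, ss_Wk hj hx,
      hh_Wk hj _ (Wk_mono (Nat.le_succ j) hx)]

theorem hh_ss' {j : ℕ} (hj : j + 1 < n) (a : Fˣ) :
    (hh j a : GT n F) * ss j = ss j * hh (j+1) a := by
  have := hh_ss (n := n) hj a
  calc (hh j a : GT n F) * ss j = ss j * (ss j * hh j a) * ss j := by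
        rw [← mul_assoc (ss j) (ss j), ss_ss hj, one_mul]
    _ = ss j * hh (j+1) a * (ss j * ss j) := by rw [← this]; group
    _ = _ := by rw [ss_ss hj, mul_one]

theorem ww_ss {j : ℕ} (hj : j + 1 < n) : (ww (j+1) : GT n F) = ss j * ww j * ss j := by
  have hj' : j < n := by omega
  have hm : (ww j : GT n F) ∈ Gk (j+1) := ww_mem hj'
  apply Gk_ext2 hj (ww_mem hj)
    (mul_mem (mul_mem (ss_mem hj) (Gk_mono (Nat.le_succ _) hm)) (ss_mem hj))
  · rw [mul_smul, mul_smul, ss_e' hj, ww_e hj', ss_f hj, ww_e hj]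
  · rw [mul_smul, mul_smul, ss_f' hj, ww_f hj', smul_neg, ss_e hj, ww_f hj]
  · rw [mul_smul, mul_smul, ss_e hj, Gk_e hm, ss_e' hj, ww_Wk hj (e_mem_Wk (Nat.lt_succ_self j))]
  · rw [mul_smul, mul_smul, ss_f hj, Gk_f hm, ss_f' hj, ww_Wk hj (f_mem_Wk (Nat.lt_succ_self j))]
  · intro x hx
    rw [mul_smul, mul_smul, ss_Wk hj hx, ww_Wk hj' hx, ss_Wk hj hx,
      ww_Wk hj (Wk_mono (Nat.le_succ j) hx)]

theorem ss_U {j : ℕ} (hj : j + 1 < n) {u : GT n F} (hu : u ∈ U j) :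
    ss j * u * (ss j)⁻¹ ∈ U (j+1) := by
  obtain ⟨h1, h2, h3⟩ := hu
  rw [ss_inv hj]
  refine ⟨mul_mem (mul_mem (ss_mem hj) (Gk_mono (Nat.le_succ _) h1)) (ss_mem hj), ?_, ?_⟩
  · rw [mul_smul, mul_smul, ss_e' hj, h2, ss_e hj]
  · intro x hx
    obtain ⟨x', hx', hx2⟩ := Wk_decomp (by omega) hx
    obtain ⟨c, hc⟩ := h3 x' hx'
    refine ⟨c, ?_⟩
    generalize B x (f j) = p at hx2
    generalize B x (e j) = r at hx2
    rw [hx2]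
    simp only [mul_smul, smul_add, smul_sub, smul_lin, ss_e hj, ss_f hj, Gk_e h1, Gk_f h1,
      ss_e' hj, ss_f' hj, ss_Wk hj hx', hc]
    module

theorem xa_e {j : ℕ} (hj : j < n) (c : F) : (xa j c : GT n F) • (e j : W n F) = e j + c • e (j+1) := by
  rw [xa_smul, B_ef hj, B_ee]; module

theorem xa_add {j : ℕ} (c d : F) : (xa j c : GT n F) * xa j d = xa j (c + d) := by
  apply gt_ext
  intro x
  have h : j ≠ j + 1 := by omega
  simp only [mul_smul, xa_smul, map_add, map_sub, map_smul, LinearMap.add_apply,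
    LinearMap.sub_apply, LinearMap.smul_apply, B_ee, B_ff, B_ef_ne h, B_fe_ne h, B_ef_ne h.symm,
    B_fe_ne h.symm, smul_eq_mul]
  module

theorem xa_zero {j : ℕ} : (xa j 0 : GT n F) = 1 := by
  apply gt_ext
  intro x
  rw [xa_smul, one_smul]; simp

theorem xneg {j : ℕ} (hj : j + 1 < n) (c : Fˣ) :
    (ss j : GT n F) * xa j (c : F) * ss j =
      xa j ((c⁻¹ : Fˣ) : F) * (ss j * hh (j+1) c * hh j (-c⁻¹)) * xa j ((c⁻¹ : Fˣ) : F) := by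
  have h : j ≠ j + 1 := by omega
  have hj' : j < n := by omega
  have hc : (c : F) * ((c⁻¹ : Fˣ) : F) = 1 := by simp
  have hc' : ((c⁻¹ : Fˣ) : F) * (c : F) = 1 := by simp
  have hxm : ∀ d : F, (xa j d : GT n F) ∈ Gk (j+2) := fun d => (xa_mem d).1
  have xe1 : ∀ d : F, (xa j d : GT n F) • (e (j+1) : W n F) = e (j+1) := fun d => (xa_mem d).2.1
  have xf0 : ∀ d : F, (xa j d : GT n F) • (f j : W n F) = f j := fun d => by
    rw [xa_smul, B_ff, B_fe_ne h]; simp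
  have xf1 : ∀ d : F, (xa j d : GT n F) • (f (j+1) : W n F) = f (j+1) - d • f j := fun d => by
    rw [xa_smul, B_ff, B_fe hj]; module
  have xW : ∀ d : F, ∀ x ∈ (Wk j : Submodule F (W n F)), (xa j d : GT n F) • x = x := by
    intro d x hx
    rw [xa_smul, Wk_f hx, Wk_e (Wk_mono (Nat.le_succ j) hx)]; simp
  have hm : (hh j (-c⁻¹) : GT n F) ∈ Gk (j+1) := hh_mem hj' _
  have he0 : (hh (j+1) c : GT n F) • (e j : W n F) = e j := hh_Wk hj _ (e_mem_Wk (Nat.lt_succ_self j))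
  have hf0 : (hh (j+1) c : GT n F) • (f j : W n F) = f j := hh_Wk hj _ (f_mem_Wk (Nat.lt_succ_self j))
  have hinv : ((-c⁻¹ : Fˣ)⁻¹ : Fˣ) = -c := by simp
  apply Gk_ext2 hj
  · exact mul_mem (mul_mem (ss_mem hj) (hxm _)) (ss_mem hj)
  · exact mul_mem (mul_mem (hxm _) (mul_mem (mul_mem (ss_mem hj) (hh_mem hj _))
      (Gk_mono (Nat.le_succ _) hm))) (hxm _)
  · simp only [mul_smul, ss_e' hj, xa_e hj', smul_add, smul_lin, ss_e hj, xe1, Gk_e hm, hh_e hj]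
    rw [smul_smul, hc]; module
  · simp only [mul_smul, ss_f' hj, xf0, ss_f hj, xf1, smul_sub, smul_lin, Gk_f hm, hh_f hj, hh_f hj',
      hf0, hinv, Units.val_neg]
    simp only [smul_smul]
    generalize (c : F) = a at *
    generalize ((c⁻¹ : Fˣ) : F) = a' at *
    match_scalars <;> first | linear_combination hc | linear_combination -hc | linear_combination a' * hc | linear_combination -a' * hc
  · simp only [mul_smul, ss_e hj, xe1, ss_e' hj, xa_e hj', smul_add, smul_lin, hh_e hj', Gk_e hm,
      hh_e hj, he0, Units.val_neg]
    simp only [smul_smul]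
    generalize (c : F) = a at *
    generalize ((c⁻¹ : Fˣ) : F) = a' at *
    match_scalars <;> first | linear_combination hc | linear_combination -hc | linear_combination a' * hc | linear_combination -a' * hc
  · simp only [mul_smul, ss_f hj, xf1, ss_f' hj, xf0, smul_sub, smul_lin, hh_f hj', hf0, hinv,
      Units.val_neg]
    simp only [smul_smul]
    rw [show (-(c : F)) * ((c⁻¹ : Fˣ) : F) = -1 by rw [neg_mul, hc]]
    module
  · intro x hx
    simp only [mul_smul, ss_Wk hj hx, xW _ x hx, hh_Wk hj' _ hx,
      hh_Wk hj _ (Wk_mono (Nat.le_succ j) hx)]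

theorem xww {j : ℕ} (hj : j + 1 < n) (c : F) : ∃ u ∈ (U (j+1) : Subgroup (GT n F)),
    ss j * ww j * xa j c = u * (ss j * ww j) := by
  have hj' : j < n := by omega
  have h : j ≠ j + 1 := by omega
  have hw : (c • e j : W n F) ∈ (Wk (j+1) : Submodule F (W n F)) :=
    Submodule.smul_mem _ _ (e_mem_Wk (Nat.lt_succ_self j))
  refine ⟨uu (j+1) (c • e j) 0, uu_mem hw 0, ?_⟩
  apply gt_ext
  intro x
  simp only [mul_smul, xa_smul, ww_smul hj', ss_smul hj, uu_smul (Wk_e hw), map_add, map_sub,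
    map_smul, LinearMap.add_apply, LinearMap.sub_apply, LinearMap.smul_apply, B_ee, B_ff,
    B_ef_ne h, B_fe_ne h, B_ef_ne h.symm, B_fe_ne h.symm, B_ef hj, B_fe hj, B_ef hj', B_fe hj',
    smul_eq_mul]
  module

/-- the radical of the second maximal parabolic type -/
def QQ (j : ℕ) : Subgroup (GT n F) where
  carrier := {g | g ∈ Gk (j+2) ∧ g • (e (j+1) : W n F) = e (j+1) ∧ g • (e j : W n F) = e j ∧
    ∀ x ∈ (Wk j : Submodule F (W n F)), ∃ a b : F, g • x = x + a • e (j+1) + b • e j}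
  mul_mem' := by
    rintro g h ⟨hg1, hg2, hg3, hg4⟩ ⟨hh1, hh2, hh3, hh4⟩
    refine ⟨mul_mem hg1 hh1, by rw [mul_smul, hh2, hg2], by rw [mul_smul, hh3, hg3], ?_⟩
    intro x hx
    obtain ⟨a, b, hc⟩ := hh4 x hx
    obtain ⟨a', b', hd⟩ := hg4 x hx
    refine ⟨a + a', b + b', ?_⟩
    rw [mul_smul, hc, smul_add, smul_add, smul_lin, smul_lin, hg2, hg3, hd]
    module
  one_mem' := ⟨one_mem _, one_smul _ _, one_smul _ _, fun x _ => ⟨0, 0, by rw [one_smul]; simp⟩⟩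
  inv_mem' := by
    rintro g ⟨hg1, hg2, hg3, hg4⟩
    refine ⟨inv_mem hg1, by rw [inv_smul_eq_iff, hg2], by rw [inv_smul_eq_iff, hg3], ?_⟩
    intro x hx
    obtain ⟨a, b, hc⟩ := hg4 x hx
    refine ⟨-a, -b, ?_⟩
    rw [inv_smul_eq_iff, smul_add, smul_add, smul_lin, smul_lin, hg2, hg3, hc]
    module

theorem mem_QQ {j : ℕ} {g : GT n F} : g ∈ QQ j ↔ g ∈ Gk (j+2) ∧ g • (e (j+1) : W n F) = e (j+1) ∧
    g • (e j : W n F) = e j ∧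
    ∀ x ∈ (Wk j : Submodule F (W n F)), ∃ a b : F, g • x = x + a • e (j+1) + b • e j := Iff.rfl

theorem U_le_QQ {j : ℕ} : (U j : Subgroup (GT n F)) ≤ QQ j := by
  rintro g ⟨h1, h2, h3⟩
  refine ⟨Gk_mono (Nat.le_succ _) h1, Gk_e h1, h2, ?_⟩
  intro x hx
  obtain ⟨c, hc⟩ := h3 x hx
  exact ⟨0, c, by rw [hc]; module⟩

theorem U1_QQ {j : ℕ} {g : GT n F} (hg : g ∈ U (j+1)) (hge : g • (e j : W n F) = e j) : g ∈ QQ j := by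
  obtain ⟨h1, h2, h3⟩ := hg
  refine ⟨h1, h2, hge, ?_⟩
  intro x hx
  obtain ⟨c, hc⟩ := h3 x (Wk_mono (Nat.le_succ j) hx)
  exact ⟨c, 0, by rw [hc]; module⟩

theorem QQ_ss {j : ℕ} (hj : j + 1 < n) {g : GT n F} (hg : g ∈ QQ j) : ss j * g * ss j ∈ QQ j := by
  obtain ⟨hg1, hg2, hg3, hg4⟩ := hg
  refine ⟨mul_mem (mul_mem (ss_mem hj) hg1) (ss_mem hj), ?_, ?_, ?_⟩
  · rw [mul_smul, mul_smul, ss_e' hj, hg3, ss_e hj]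
  · rw [mul_smul, mul_smul, ss_e hj, hg2, ss_e' hj]
  · intro x hx
    obtain ⟨a, b, hc⟩ := hg4 x hx
    refine ⟨b, a, ?_⟩
    rw [mul_smul, mul_smul, ss_Wk hj hx, hc]
    simp only [smul_add, smul_lin, ss_e hj, ss_e' hj, ss_Wk hj hx]
    module

theorem QQ_split {j : ℕ} (hj : j + 1 < n) {g : GT n F} (hg : g ∈ QQ j) :
    ∃ u ∈ (U j : Subgroup (GT n F)), ∃ v ∈ (U (j+1) : Subgroup (GT n F)),
      v • (e j : W n F) = e j ∧ g = u * v := by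
  have hj' : j < n := by omega
  have h : j ≠ j + 1 := by omega
  obtain ⟨hg1, hg2, hg3, hg4⟩ := hg
  have hf := smul_mem_Wk hg1 (f_mem_Wk (n := n) (F := F) (show j < j + 2 by omega))
  obtain ⟨x1, hx1, hx2⟩ := Wk_decomp hj hf
  obtain ⟨w, hw, hw2⟩ := Wk_decomp hj' hx1
  have e1 : B (g • (f j : W n F)) (e (j+1)) = 0 := by
    conv_lhs => rw [← hg2]
    rw [B_smul, B_fe_ne h]
  have e2 : B (g • (f j : W n F)) (e j) = -1 := by
    conv_lhs => rw [← hg3]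
    rw [B_smul, B_fe hj']
  have e3 : B x1 (e j) = -1 := by
    have := congrArg (fun z => B z (e j)) hx2
    simp only [map_add, map_sub, map_smul, LinearMap.add_apply, LinearMap.sub_apply,
      LinearMap.smul_apply, B_ee, e1, e2] at this
    rw [this]; simp
  rw [e1] at hx2
  rw [e3] at hw2
  generalize B (g • (f j : W n F)) (f (j+1)) = c at hx2
  generalize B x1 (f j) = b at hw2
  have hgf : g • (f j : W n F) = f j + w + b • e j + c • e (j+1) := by
    rw [hx2, hw2]; module
  have hu := uu_mem hw b
  refine ⟨uu j w b, hu, (uu j w b)⁻¹ * g, ?_, ?_, by group⟩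
  · refine ⟨mul_mem (inv_mem (Gk_mono (Nat.le_succ _) hu.1)) hg1, ?_, ?_⟩
    · rw [mul_smul, hg2, inv_smul_eq_iff, Gk_e hu.1]
    · intro x hx
      obtain ⟨x', hx', hxd⟩ := Wk_decomp hj' hx
      obtain ⟨a, d, had⟩ := hg4 x' hx'
      have hd : d = - B x' w := by
        have h4 : B (g • x') (g • (f j : W n F)) = 0 := by rw [B_smul, Wk_f hx']
        rw [had, hgf] at h4
        have hw' := Wk_mono (Nat.le_succ j) hw
        have hx'' := Wk_mono (Nat.le_succ j) hx'
        simp only [map_add, map_smul, LinearMap.add_apply, LinearMap.smul_apply,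
          smul_eq_mul, B_ee, B_ef hj', B_ef_ne h.symm, Wk_e hx', Wk_f hx', Wk_e hx'', 
          B_swap (e j) w, Wk_e hw, B_swap (e (j+1)) w, Wk_e hw'] at h4
        linear_combination h4
      generalize B x (f j) = p at hxd
      generalize B x (e j) = r at hxd
      refine ⟨a - r * c, ?_⟩
      rw [mul_smul, inv_smul_eq_iff, hxd]
      simp only [smul_add, smul_sub, smul_lin, hg3, hgf, had, hu.2.1, Gk_e hu.1, uu_f hj' hw]
      rw [uu_smul (Wk_e hw) b x', Wk_e hx', hd]
      module
  · rw [mul_smul, hg3, inv_smul_eq_iff, hu.2.1]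

theorem U_shift {j : ℕ} (hj : j + 1 < n) {u : GT n F} (hu : u ∈ U (j+1)) : ∃ c : F, ∀ d : F,
    ∃ v ∈ (QQ j : Subgroup (GT n F)), u * xa j d = xa j (c + d) * v := by
  obtain ⟨c, hc⟩ := hu.2.2 _ (e_mem_Wk (n := n) (F := F) (Nat.lt_succ_self j))
  refine ⟨c, fun d => ⟨(xa j (c+d))⁻¹ * (u * xa j d), ?_, by group⟩⟩
  apply U1_QQ
  · exact mul_mem (inv_mem (xa_mem _)) (mul_mem hu (xa_mem _))
  · rw [mul_smul, mul_smul, inv_smul_eq_iff, xa_e (by omega), xa_e (by omega), smul_add, smul_lin,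
      hc, hu.2.1]
    module

end Symp3

end SpP


namespace SpP

set_option linter.unusedSectionVars false
set_option linter.unusedVariables false
set_option linter.unusedSimpArgs false

section Ops

variable {n : ℕ} {F : Type} [Field F] [Fintype F]

noncomputable instance instFintypeGT : Fintype (GT n F) := by
  haveI : Finite (W n F ≃ₗ[F] W n F) :=
    Finite.of_injective (fun g : W n F ≃ₗ[F] W n F => (g : W n F → W n F)) DFunLike.coe_injective
  exact Fintype.ofFinite _

variable {X : Type} [AddCommGroup X] [Module ℂ X] [FiniteDimensional ℂ X]
variable (ρ : Representation ℂ (GT n F) X)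

open Classical in
/-- sum of transvections in `Gk k` -/
noncomputable def zz (k : ℕ) : X →ₗ[ℂ] X :=
  ∑ v ∈ Finset.univ.filter (fun v : W n F => v ∈ (Wk k : Submodule F (W n F))), (ρ (tv 1 v) : X →ₗ[ℂ] X)

/-- projection to fixed points of `U i` -/
noncomputable def E (i : ℕ) : X →ₗ[ℂ] X := avg ρ (U i : Subgroup (GT n F))

variable {ρ}

open Classical in
theorem zz_apply (k : ℕ) (y : X) : zz ρ k y =
    ∑ v ∈ Finset.univ.filter (fun v : W n F => v ∈ (Wk k : Submodule F (W n F))), ρ (tv 1 v) y := by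
  simp [zz, LinearMap.sum_apply]

theorem zz_comm {k : ℕ} {g : GT n F} (hg : g ∈ Gk k) (y : X) : zz ρ k (ρ g y) = ρ g (zz ρ k y) := by
  classical
  rw [zz_apply, zz_apply, map_sum]
  refine Finset.sum_bij' (fun v _ => g⁻¹ • v) (fun v _ => g • v) ?_ ?_ ?_ ?_ ?_
  · intro v hv
    simp only [Finset.mem_filter, Finset.mem_univ, true_and] at hv ⊢
    exact smul_mem_Wk (inv_mem hg) hv
  · intro v hv
    simp only [Finset.mem_filter, Finset.mem_univ, true_and] at hv ⊢
    exact smul_mem_Wk hg hv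
  · intro v _; simp
  · intro v _; simp
  · intro v _
    rw [← rho_mul, ← rho_mul, tv_conj, smul_inv_smul]

theorem zz_stab {k : ℕ} {Y : Submodule ℂ X} (hY : Stab ρ (Gk k) Y) {y : X} (hy : y ∈ Y) :
    zz ρ k y ∈ Y := by
  classical
  rw [zz_apply]
  refine Y.sum_mem fun v hv => hY _ (tv_mem_Gk 1 (Finset.mem_filter.1 hv).2) y hy

theorem zz_zero (y : X) : zz ρ 0 y = y := by
  classical
  rw [zz_apply, Finset.sum_eq_single 0]
  · rw [tv_zero', rho_one]
  · intro v hv h0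
    exact absurd (Wk_zero (Finset.mem_filter.1 hv).2) h0
  · intro h
    exact absurd (Finset.mem_filter.2 ⟨Finset.mem_univ _, Submodule.zero_mem _⟩) h

theorem E_fix {i : ℕ} {y : X} (hy : y ∈ fix ρ (U i)) : E ρ i y = y := avg_of_fix hy
theorem E_mem {i : ℕ} (y : X) : E ρ i y ∈ fix ρ (U i) := avg_mem_fix _ _ _
theorem E_U {i : ℕ} {u : GT n F} (hu : u ∈ U i) (y : X) : E ρ i (ρ u y) = E ρ i y := avg_rho hu y
theorem E_Gk {i : ℕ} {g : GT n F} (hg : g ∈ Gk i) (y : X) : ρ g (E ρ i y) = E ρ i (ρ g y) :=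
  rho_avg (fun _ h => U_conj_Gk hg h) (fun _ h => U_conj_Gk' hg h) y
theorem E_hh {i : ℕ} (hi : i < n) (a : Fˣ) (y : X) : ρ (hh i a) (E ρ i y) = E ρ i (ρ (hh i a) y) :=
  rho_avg (fun _ h => U_conj_hh hi a h) (fun _ h => U_conj_hh' hi a h) y
theorem fix_Gk {i : ℕ} {g : GT n F} (hg : g ∈ Gk i) {y : X} (hy : y ∈ fix ρ (U i)) :
    ρ g y ∈ fix ρ (U i) := fix_normalizes (fun _ h => U_conj_Gk' hg h) hy
theorem fix_hh {i : ℕ} (hi : i < n) (a : Fˣ) {y : X} (hy : y ∈ fix ρ (U i)) :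
    ρ (hh i a) y ∈ fix ρ (U i) := fix_normalizes (fun _ h => U_conj_hh' hi a h) hy

theorem E_w_comm {i : ℕ} (hi : i < n) {g : GT n F} (hg : g ∈ Gk i) (y : X) :
    E ρ i (ρ (ww i) (ρ g y)) = ρ g (E ρ i (ρ (ww i) y)) := by
  rw [E_Gk hg, ← rho_mul, ← rho_mul, ww_comm hi hg]

theorem sq_triv {i : ℕ} (hi : i < n) {ν : Fˣ} (hν : ∀ a : Fˣ, ∃ m : ℕ, a = ν ^ m) {y : X}
    (hy : ρ (hh i ν) (ρ (hh i ν) y) = y) (a : Fˣ) : ρ (hh i (a * a)) y = y := by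
  obtain ⟨m, rfl⟩ := hν a
  rw [← mul_pow]
  induction m with
  | zero => rw [pow_zero, hh_one hi, rho_one]
  | succ m ih => rw [pow_succ, hh_mul hi, rho_mul, hh_mul hi, rho_mul, hy, ih]

theorem E_tv {i : ℕ} (hi : i < n) {y : X} (hy : y ∈ fix ρ (U i))
    (hsq : ∀ a : Fˣ, ρ (hh i (a * a)) y = y) {v : W n F}
    (hv : v ∈ (Wk (i+1) : Submodule F (W n F))) (hve : B v (e i) ≠ 0) :
    E ρ i (ρ (tv 1 v) y) = E ρ i (ρ (ww i) y) := by
  obtain ⟨a, ha⟩ : ∃ a : Fˣ, (a : F) = - B v (e i) := ⟨Units.mk0 _ (neg_ne_zero.2 hve), rfl⟩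
  obtain ⟨u, hu, huv⟩ := U_trans hi hv a.ne_zero (by rw [ha, neg_neg])
  have h1 : E ρ i (ρ (tv 1 v) y) = E ρ i (ρ (tv 1 ((a : F) • f i)) y) := by
    conv_lhs => rw [← hy u hu, ← rho_mul, ← huv, ← tv_conj, rho_mul, E_U hu]
  have h2 : (tv 1 ((a : F) • f i) : GT n F) =
      (hh i a⁻¹ * tv (-1) (e i) * (hh i a⁻¹)⁻¹) * ww i * hh i (a * a) * 
        ((hh i a)⁻¹ * tv (-1) (e i) * hh i a) := by
    have h3 : (hh i a⁻¹ : GT n F) * tv 1 (f i) = tv 1 ((a : F) • f i) * hh i a⁻¹ := by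
      rw [tv_conj, hh_f hi, inv_inv]
    have h4 := ww_hh (n := n) hi a
    have h5 : (ww i : GT n F) = hh i a * ww i * hh i a := by
      rw [mul_assoc, h4, ← mul_assoc, ← hh_mul hi]; simp [hh_one hi]
    rw [tv_f hi] at h3
    rw [hh_mul hi]
    rw [← hh_inv hi] at h3 ⊢
    generalize (hh i a : GT n F) = H at *
    generalize (ww i : GT n F) = w at *
    generalize (tv (-1) (e i) : GT n F) = t at *
    rw [← mul_inv_eq_iff_eq_mul.2 h3]
    conv_lhs => rw [h5]
    group
  rw [h1, h2, rho_mul, hy _ (U_conj_hh' hi a (tve_mem _)), rho_mul, hsq, rho_mul,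
    E_U (U_conj_hh hi _ (tve_mem _))]

theorem tv_split {i : ℕ} (hi : i < n) {v : W n F} (hv : v ∈ (Wk i : Submodule F (W n F))) (c : F) :
    ∃ u ∈ (U i : Subgroup (GT n F)), tv 1 (v + c • e i) = tv 1 v * u := by
  have h1 : (tv 1 v : GT n F) ∈ Gk i := tv_mem_Gk 1 hv
  refine ⟨(tv 1 v)⁻¹ * tv 1 (v + c • e i), ⟨?_, ?_, ?_⟩, by group⟩
  · refine mul_mem (inv_mem (Gk_mono (Nat.le_succ i) h1)) (tv_mem_Gk 1 ?_)
    exact add_mem (Wk_mono (Nat.le_succ i) hv) (Submodule.smul_mem _ _ (e_mem_Wk (Nat.lt_succ_self i)))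
  · rw [mul_smul, inv_smul_eq_iff, Gk_e h1, tv_smul]
    simp [B_swap (e i) v, Wk_e hv, B_ee]
  · intro x hx
    refine ⟨B x v * c, ?_⟩
    rw [mul_smul, inv_smul_eq_iff, smul_add, smul_lin, Gk_e h1, tv_smul, tv_smul]
    simp only [map_add, map_smul, Wk_e hx]
    simp only [smul_zero, add_zero]
    module

open Classical in
/-- the constant in the formula for `E zz` -/
noncomputable def CC (n : ℕ) (F : Type) [Field F] [Fintype F] (i : ℕ) : ℂ :=
  ((Finset.univ.filter (fun v : W n F => v ∈ (Wk (i+1) : Submodule F (W n F)) ∧ B v (e i) ≠ 0)).card : ℂ)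

theorem CC_ne {i : ℕ} (hi : i < n) : CC n F i ≠ 0 := by
  classical
  unfold CC
  rw [Nat.cast_ne_zero]
  refine (Finset.card_pos.2 ⟨f i, ?_⟩).ne'
  simp only [Finset.mem_filter, Finset.mem_univ, true_and]
  refine ⟨f_mem_Wk (Nat.lt_succ_self i), ?_⟩
  rw [B_fe hi]; simp

theorem E_zz {i : ℕ} (hi : i < n) {y : X} (hy : y ∈ fix ρ (U i))
    (hsq : ∀ a : Fˣ, ρ (hh i (a * a)) y = y) :
    E ρ i (zz ρ (i+1) y) = (Fintype.card F : ℂ) • zz ρ i y + CC n F i • E ρ i (ρ (ww i) y) := by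
  classical
  rw [zz_apply, map_sum, ← Finset.sum_filter_add_sum_filter_not _ (fun v : W n F => B v (e i) = 0)]
  congr 1
  · rw [zz_apply, Finset.smul_sum]
    have : ∀ v ∈ Finset.univ.filter (fun v : W n F => v ∈ (Wk i : Submodule F (W n F))),
        (Fintype.card F : ℂ) • ρ (tv 1 v) y = ∑ c : F, E ρ i (ρ (tv 1 (v + c • e i)) y) := by
      intro v hv
      have hv' := (Finset.mem_filter.1 hv).2
      rw [Finset.sum_congr rfl (g := fun _ => ρ (tv 1 v) y)]
      · rw [Finset.sum_const, Finset.card_univ, ← Nat.cast_smul_eq_nsmul ℂ]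
      · intro c _
        obtain ⟨u, hu, h⟩ := tv_split hi hv' c
        rw [h, rho_mul, hy u hu, E_fix (fix_Gk (tv_mem_Gk 1 hv') hy)]
    rw [Finset.sum_congr rfl this, ← Finset.sum_product']
    refine Finset.sum_bij' (fun v _ => (v - B v (f i) • e i, B v (f i))) (fun p _ => p.1 + p.2 • e i)
      ?_ ?_ ?_ ?_ ?_
    · intro v hv
      simp only [Finset.mem_filter, Finset.mem_univ, true_and] at hv
      simp only [Finset.mem_product, Finset.mem_filter, Finset.mem_univ, true_and, and_true]
      obtain ⟨x', hx', h⟩ := Wk_decomp hi hv.1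
      rw [hv.2] at h
      have h2 : v - B v (f i) • e i = x' := by
        generalize B v (f i) = c at *
        rw [h]; module
      rw [h2]; exact hx'
    · rintro ⟨v, c⟩ hv
      simp only [Finset.mem_product, Finset.mem_filter, Finset.mem_univ, true_and, and_true] at hv
      simp only [Finset.mem_filter, Finset.mem_univ, true_and]
      refine ⟨add_mem (Wk_mono (Nat.le_succ i) hv)
        (Submodule.smul_mem _ _ (e_mem_Wk (Nat.lt_succ_self i))), ?_⟩
      simp [Wk_e hv, B_ee]
    · intro v _; simp
    · rintro ⟨v, c⟩ hv
      simp only [Finset.mem_product, Finset.mem_filter, Finset.mem_univ, true_and, and_true] at hv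
      simp [Wk_f hv, B_ef hi]
    · intro v _; simp
  · rw [Finset.sum_congr rfl (g := fun _ => E ρ i (ρ (ww i) y))]
    · rw [Finset.sum_const, ← Nat.cast_smul_eq_nsmul ℂ, Finset.filter_filter]
      rfl
    · intro v hv
      simp only [Finset.mem_filter, Finset.mem_univ, true_and] at hv
      exact E_tv hi hy hsq hv.1 hv.2

theorem dcos {i : ℕ} (hi : i < n) {Y : Submodule ℂ X} (hY : Y ≤ fix ρ (U i))
    (hS : Stab ρ (Gk i) Y) (hh' : ∀ a : Fˣ, ∀ y ∈ Y, ρ (hh i a) y ∈ Y)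
    {g : GT n F} (hg : g ∈ Gk (i+1)) {y : X} (hy : y ∈ Y) :
    ((∃ c : F, g • (e i : W n F) = c • e i) ∧ E ρ i (ρ g y) ∈ Y) ∨ (∃ y' ∈ Y, E ρ i (ρ g y) = E ρ i (ρ (ww i) y')) ∨
    ∃ j, i = j + 1 ∧ ∃ g' ∈ (Gk i : Subgroup (GT n F)), ∃ y' ∈ Y, 
      E ρ i (ρ g y) = ρ g' (E ρ i (ρ (ss j) y')) := by
  have hx := smul_mem_Wk hg (e_mem_Wk (n := n) (F := F) (Nat.lt_succ_self i))
  have hne : g • (e i : W n F) ≠ 0 := by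
    intro h0
    have : B (g • (e i : W n F)) (g • f i) = 1 := by rw [B_smul, B_ef hi]
    rw [h0] at this
    simp at this
  by_cases hb : B (g • (e i : W n F)) (e i) = 0
  · obtain ⟨x', hx', hd⟩ := Wk_decomp hi hx
    rw [hb] at hd
    generalize B (g • (e i : W n F)) (f i) = c at hd
    by_cases h0 : x' = 0
    · left
      have hd' : g • (e i : W n F) = c • e i := by rw [hd, h0]; module
      have hc : c ≠ 0 := by
        rintro rfl
        rw [zero_smul] at hd'
        exact hne hd'
      lift c to Fˣ using hc.isUnit
      obtain ⟨u, hu, g', hg', h⟩ := stab_e hi (mul_mem (inv_mem (hh_mem hi c)) hg)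
        (by rw [mul_smul, inv_smul_eq_iff, hd', hh_e hi])
      have hgy := hS g' hg' y hy
      refine ⟨⟨_, hd'⟩, ?_⟩
      rw [inv_mul_eq_iff_eq_mul.1 h, rho_mul, rho_mul, hY hgy u hu, E_fix (fix_hh hi c (hY hgy))]
      exact hh' c _ hgy
    · right; right
      obtain ⟨j, rfl⟩ : ∃ j, i = j + 1 := by
        cases i with
        | zero => exact absurd (Wk_zero hx') h0
        | succ j => exact ⟨j, rfl⟩
      have hj' : j < n := by omega
      have hej : (e j : W n F) ≠ 0 := by
        intro h0
        have := B_ef (F := F) hj'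
        rw [h0] at this
        simp at this
      obtain ⟨g', hg', hgx⟩ := Gk_trans (e_mem_Wk (Nat.lt_succ_self j)) hej hx' h0
      have hgm := Gk_mono (Nat.le_succ _) hg'
      have hsm : (ss j : GT n F) ∈ Gk (j+1+1) := ss_mem hi
      obtain ⟨u, hu, g'', hg'', h⟩ := stab_e hi
        (mul_mem (inv_mem (mul_mem (mul_mem hgm (xa_mem c).1) hsm)) hg) (by
          rw [mul_smul, inv_smul_eq_iff, hd, mul_smul, mul_smul, ss_e' hi, xa_e hj', smul_add, hgx,
            smul_lin, Gk_e hg']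
          module)
      refine ⟨j, rfl, g', hg', ρ g'' y, hS g'' hg'' y hy, ?_⟩
      have hgy := hS g'' hg'' y hy
      rw [inv_mul_eq_iff_eq_mul.1 h, rho_mul, rho_mul, rho_mul, rho_mul, hY hgy u hu, ← E_Gk hg',
        E_U (xa_mem c)]
  · right; left
    obtain ⟨a, ha⟩ : ∃ a : Fˣ, (a : F) = - B (g • (e i : W n F)) (e i) :=
      ⟨Units.mk0 _ (neg_ne_zero.2 hb), rfl⟩
    obtain ⟨u, hu, huv⟩ := U_trans hi hx a.ne_zero (by rw [ha, neg_neg])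
    obtain ⟨u', hu', g', hg', h⟩ := stab_e hi
      (mul_mem (inv_mem (mul_mem (mul_mem hu.1 (ww_mem hi)) (hh_mem hi a))) hg) (by
        rw [mul_smul, inv_smul_eq_iff, mul_smul, mul_smul, hh_e hi, smul_lin, ww_e hi, huv])
    have hgy := hS g' hg' y hy
    refine ⟨_, hh' a _ hgy, ?_⟩
    rw [inv_mul_eq_iff_eq_mul.1 h, rho_mul, rho_mul, rho_mul, rho_mul, hY hgy u' hu', E_U hu]

end Ops

end SpP


namespace SpP

set_option linter.unusedSectionVars false
set_option linter.unusedVariables false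
set_option linter.unusedSimpArgs false

section OpT

variable {n : ℕ} {F : Type} [Field F] [Fintype F]
noncomputable instance instFintypeUn : Fintype Fˣ := Fintype.ofFinite _

variable {X : Type} [AddCommGroup X] [Module ℂ X] [FiniteDimensional ℂ X]
variable (ρ : Representation ℂ (GT n F) X)

/-- the intertwining operator -/
noncomputable def T (j : ℕ) : X →ₗ[ℂ] X := E ρ (j+1) ∘ₗ ρ (ss j)

/-- vectors fixed by both radicals -/
def MM (j : ℕ) : Submodule ℂ X := fix ρ (U (j+1)) ⊓ fix ρ (U j)

variable {ρ}

theorem T_apply (j : ℕ) (y : X) : T ρ j y = E ρ (j+1) (ρ (ss j) y) := rfl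

theorem MM_QQ {j : ℕ} (hj : j + 1 < n) {y : X} (hy : y ∈ MM ρ j) {g : GT n F} (hg : g ∈ QQ j) :
    ρ g y = y := by
  obtain ⟨u, hu, v, hv, _, rfl⟩ := QQ_split hj hg
  rw [rho_mul, hy.1 v hv, hy.2 u hu]

theorem xa_inv {j : ℕ} (c : F) : (xa j c : GT n F)⁻¹ = xa j (-c) := by
  rw [inv_eq_iff_mul_eq_one, xa_add, add_neg_cancel, xa_zero]

theorem QQ_xa {j : ℕ} (hj : j + 1 < n) {g : GT n F} (hg : g ∈ QQ j) (c : F) :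
    (xa j c)⁻¹ * g * xa j c ∈ QQ j := by
  have h : j ≠ j + 1 := by omega
  have hj' : j < n := by omega
  obtain ⟨hg1, hg2, hg3, hg4⟩ := hg
  have hx := xa_mem (n := n) (F := F) (j := j)
  have xW : ∀ d : F, ∀ x ∈ (Wk j : Submodule F (W n F)), (xa j d : GT n F) • x = x := by
    intro d x hx
    rw [xa_smul, Wk_f hx, Wk_e (Wk_mono (Nat.le_succ j) hx)]; simp
  refine ⟨mul_mem (mul_mem (inv_mem (hx c).1) hg1) (hx c).1, ?_, ?_, ?_⟩
  · rw [mul_smul, mul_smul, (hx c).2.1, hg2, inv_smul_eq_iff, (hx c).2.1]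
  · rw [mul_smul, mul_smul, xa_e hj', smul_add, smul_lin, hg2, hg3, inv_smul_eq_iff, xa_e hj']
  · intro x hxW
    obtain ⟨a, b, hab⟩ := hg4 x hxW
    refine ⟨a - c * b, b, ?_⟩
    rw [mul_smul, mul_smul, xW c x hxW, hab, xa_inv]
    simp only [smul_add, smul_lin, xW _ x hxW, (hx _).2.1, xa_e hj']
    module

theorem xss_shift {j : ℕ} (hj : j + 1 < n) {y : X} (hy : y ∈ MM ρ j) {v : GT n F} (hv : v ∈ QQ j) :
    ρ v (ρ (ss j) y) = ρ (ss j) y := by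
  have h1 : v * ss j = ss j * (ss j * v * ss j) := by
    rw [← mul_assoc, ← mul_assoc, ss_ss hj, one_mul]
  rw [← rho_mul, h1, rho_mul, MM_QQ hj hy (QQ_ss hj hv)]

theorem T_formula {j : ℕ} (hj : j + 1 < n) {y : X} (hy : y ∈ MM ρ j) :
    (Fintype.card F : ℂ) • T ρ j y = ∑ c : F, ρ (xa j c) (ρ (ss j) y) := by
  have hS : (∑ c : F, ρ (xa j c) (ρ (ss j) y)) ∈ fix ρ (U (j+1)) := by
    intro u hu
    obtain ⟨c0, hc0⟩ := U_shift hj hu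
    rw [map_sum]
    refine Fintype.sum_equiv (Equiv.addLeft c0) _ _ ?_
    intro c
    obtain ⟨v, hv, h⟩ := hc0 c
    rw [← rho_mul, h, rho_mul, xss_shift hj hy hv]
    rfl
  rw [← E_fix hS, map_sum, Finset.sum_congr rfl (g := fun _ => T ρ j y)]
  · rw [Finset.sum_const, Finset.card_univ, ← Nat.cast_smul_eq_nsmul ℂ]
  · intro c _
    rw [E_U (xa_mem c), T_apply]

theorem qne : (Fintype.card F : ℂ) ≠ 0 := by
  rw [Nat.cast_ne_zero]; exact Fintype.card_ne_zero

theorem T_formula' {j : ℕ} (hj : j + 1 < n) {y : X} (hy : y ∈ MM ρ j) :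
    T ρ j y = (Fintype.card F : ℂ)⁻¹ • ∑ c : F, ρ (xa j c) (ρ (ss j) y) := by
  rw [← T_formula hj hy, smul_smul, inv_mul_cancel₀ qne, one_smul]

theorem T_mem {j : ℕ} (hj : j + 1 < n) {y : X} (hy : y ∈ MM ρ j) : T ρ j y ∈ MM ρ j := by
  refine ⟨E_mem _, ?_⟩
  intro u hu
  rw [T_formula' hj hy, map_smul, map_sum]
  congr 1
  refine Finset.sum_congr rfl fun c _ => ?_
  have h1 : u * xa j c = xa j c * ((xa j c)⁻¹ * u * xa j c) := by group
  rw [← rho_mul, h1, rho_mul, xss_shift hj hy (QQ_xa hj (U_le_QQ hu) c)]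

theorem T_Gk {j : ℕ} (hj : j + 1 < n) {g : GT n F} (hg : g ∈ Gk j) (y : X) :
    T ρ j (ρ g y) = ρ g (T ρ j y) := by
  rw [T_apply, T_apply, E_Gk (Gk_mono (Nat.le_succ j) hg), ← rho_mul, ← rho_mul, ss_comm hj hg]

theorem T_h {j : ℕ} (hj : j + 1 < n) (a : Fˣ) (y : X) :
    ρ (hh (j+1) a) (T ρ j y) = T ρ j (ρ (hh j a) y) := by
  rw [T_apply, T_apply, E_hh hj, ← rho_mul, hh_ss hj, rho_mul]

theorem T_h' {j : ℕ} (hj : j + 1 < n) (a : Fˣ) (y : X) :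
    ρ (hh j a) (T ρ j y) = T ρ j (ρ (hh (j+1) a) y) := by
  rw [T_apply, T_apply, E_Gk (hh_mem (by omega) a), ← rho_mul, hh_ss' hj, rho_mul]

theorem sum_units {A : Type} [AddCommMonoid A] (g : F → A) :
    ∑ c : F, g c = g 0 + ∑ c : Fˣ, g c := by
  classical
  rw [← Finset.add_sum_erase _ _ (Finset.mem_univ (0 : F))]
  congr 1
  symm
  refine Finset.sum_bij (fun c _ => (c : F)) ?_ ?_ ?_ ?_
  · intro c _; simp
  · intro a _ b _ h; exact Units.ext h
  · intro b hb
    have hb' : b ≠ 0 := Finset.ne_of_mem_erase hb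
    exact ⟨Units.mk0 b hb', Finset.mem_univ _, rfl⟩
  · intro a _; rfl

theorem T_sq {j : ℕ} (hj : j + 1 < n) {y : X} (hy : y ∈ MM ρ j) :
    (Fintype.card F : ℂ) • T ρ j (T ρ j y) =
      y + ∑ c : Fˣ, T ρ j (ρ (hh (j+1) c) (ρ (hh j (-c⁻¹)) y)) := by
  rw [← map_smul, T_formula hj hy, map_sum, sum_units]
  congr 1
  · rw [xa_zero, rho_one, T_apply, ← rho_mul, ss_ss hj, rho_one, E_fix hy.1]
  · refine Finset.sum_congr rfl fun c _ => ?_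
    rw [T_apply, ← rho_mul, ← rho_mul, xneg hj, rho_mul, rho_mul, hy.1 _ (xa_mem _), E_U (xa_mem _),
      rho_mul, rho_mul, T_apply]

theorem T_inj {j : ℕ} (hj : j + 1 < n) {y : X} (hy : y ∈ MM ρ j) (h0 : T ρ j y = 0) : y = 0 := by
  have := T_sq hj hy
  rw [Finset.sum_eq_zero] at this
  · rw [h0] at this; simpa using this.symm
  · intro c _
    rw [← T_h' hj, ← T_h hj, h0]; simp

theorem T_tau_T {j : ℕ} (hj : j + 1 < n) {y : X} (hy : y ∈ MM ρ j) :
    T ρ j (E ρ j (ρ (ww j) (T ρ j y))) = E ρ (j+1) (ρ (ww (j+1)) y) := by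
  have h1 : ∀ x, T ρ j (E ρ j x) = T ρ j x := fun x =>
    avg_avg_conj (fun k hk => ss_U hj hk) x
  rw [h1, T_formula' hj hy, map_smul, map_smul, map_sum, map_sum,
    Finset.sum_congr rfl (g := fun _ => E ρ (j+1) (ρ (ww (j+1)) y))]
  · rw [Finset.sum_const, Finset.card_univ, ← Nat.cast_smul_eq_nsmul ℂ, smul_smul,
      inv_mul_cancel₀ qne, one_smul]
  · intro c _
    obtain ⟨u, hu, h⟩ := xww hj c
    rw [T_apply, ← rho_mul, ← rho_mul, ← rho_mul, h, mul_assoc, rho_mul, E_U hu, ww_ss hj]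

theorem hh_pow_eig {i : ℕ} (hi : i < n) {ν : Fˣ} {l : ℂ} {y : X} (hy : ρ (hh i ν) y = l • y) (m : ℕ) :
    ρ (hh i (ν ^ m)) y = l ^ m • y := by
  induction m with
  | zero => rw [pow_zero, hh_one hi, rho_one, pow_zero, one_smul]
  | succ m ih => rw [pow_succ, hh_mul hi, rho_mul, hy, map_smul, ih, smul_smul, pow_succ, mul_comm]

/-- quadratic relation for `T` on label spaces -/
theorem T_kappa {j : ℕ} (hj : j + 1 < n) {ν : Fˣ} (hν : ∀ a : Fˣ, ∃ m : ℕ, a = ν ^ m) {l m : ℂ}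
    (hl : l ^ 2 = 1) (hm : m ^ 2 = 1) : ∃ κ : ℂ, (l = m → κ ≠ 0) ∧ (l ≠ m → κ = 0) ∧
      ∀ y ∈ MM ρ j, ρ (hh (j+1) ν) y = l • y → ρ (hh j ν) y = m • y →
        (Fintype.card F : ℂ) • T ρ j (T ρ j y) = y + κ • T ρ j y := by
  have hj' : j < n := by omega
  have hl0 : l ≠ 0 := by rintro rfl; simp at hl
  have hm0 : m ≠ 0 := by rintro rfl; simp at hm
  by_cases hlm : l = m
  · obtain ⟨s, hs⟩ := hν (-1)
    refine ⟨(Fintype.card Fˣ : ℂ) * l ^ s, ?_, fun h => absurd hlm h, ?_⟩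
    · intro _
      refine mul_ne_zero ?_ (pow_ne_zero _ hl0)
      rw [Nat.cast_ne_zero]; exact Fintype.card_ne_zero
    · intro y hy h1 h2
      have key : ∀ c : Fˣ, ρ (hh j c) y = ρ (hh (j+1) c) y := by
        intro c
        obtain ⟨k, rfl⟩ := hν c
        rw [hh_pow_eig hj' h2, hh_pow_eig hj h1, hlm]
      rw [T_sq hj hy, Finset.sum_congr rfl (g := fun _ => l ^ s • T ρ j y)]
      · rw [Finset.sum_const, Finset.card_univ, ← Nat.cast_smul_eq_nsmul ℂ, smul_smul]
      · intro c _
        rw [key, ← rho_mul, ← hh_mul hj]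
        have : c * -c⁻¹ = ν ^ s := by rw [← hs]; simp
        rw [this, hh_pow_eig hj h1, map_smul]
  · refine ⟨0, fun h => absurd h hlm, fun _ => rfl, ?_⟩
    intro y hy h1 h2
    rw [T_sq hj hy, ← map_sum, zero_smul]
    have hlm2 : l = -m := by
      have : (l - m) * (l + m) = 0 := by linear_combination hl - hm
      rcases mul_eq_zero.1 this with h | h
      · exact absurd (sub_eq_zero.1 h) hlm
      · exact eq_neg_of_add_eq_zero_left h
    have hc1 : ∀ a b : Fˣ, ∀ x : X, ρ (hh j a) (ρ (hh (j+1) b) x) = ρ (hh (j+1) b) (ρ (hh j a) x) := by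
      intro a b x
      have : (hh j a : GT n F) * hh (j+1) b = hh (j+1) b * hh j a := hh_comm hj b (hh_mem hj' a)
      rw [← rho_mul, this, rho_mul]
    set S := ∑ c : Fˣ, ρ (hh (j+1) c) (ρ (hh j (-c⁻¹)) y) with hS
    have e1 : ρ (hh (j+1) ν) (ρ (hh j ν⁻¹) S) = S := by
      rw [hS, map_sum, map_sum]
      refine Fintype.sum_equiv (Equiv.mulLeft ν) _ _ ?_
      intro c
      simp only [Equiv.coe_mulLeft]
      rw [hc1, ← rho_mul, ← hh_mul hj, ← rho_mul ρ (hh j ν⁻¹), ← hh_mul hj']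
      congr 4
      simp [mul_comm]
    have h3 : ρ (hh j ν⁻¹) y = m • y := by
      apply rho_inj ρ (hh j ν)
      rw [← rho_mul, ← hh_mul hj', mul_inv_cancel, hh_one hj', rho_one, map_smul, h2, smul_smul]
      rw [← pow_two, hm, one_smul]
    have e2 : ρ (hh (j+1) ν) (ρ (hh j ν⁻¹) S) = (l * m) • S := by
      rw [hS, map_sum, map_sum, Finset.smul_sum]
      refine Finset.sum_congr rfl fun c _ => ?_
      have c2 : ∀ a b : Fˣ, ∀ x : X, ρ (hh j a) (ρ (hh j b) x) = ρ (hh j b) (ρ (hh j a) x) := by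
        intro a b x
        rw [← rho_mul, ← rho_mul, ← hh_mul hj', ← hh_mul hj', mul_comm]
      have c3 : ∀ a b : Fˣ, ∀ x : X,
          ρ (hh (j+1) a) (ρ (hh (j+1) b) x) = ρ (hh (j+1) b) (ρ (hh (j+1) a) x) := by
        intro a b x
        rw [← rho_mul, ← rho_mul, ← hh_mul hj, ← hh_mul hj, mul_comm]
      rw [hc1, c3, c2, h3, ← hc1, map_smul, h1, map_smul, map_smul, map_smul, map_smul, smul_smul,
        mul_comm]
    have h4 : l * m = -1 := by rw [hlm2]; linear_combination -hm
    rw [e1, h4, neg_one_smul] at e2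
    have : S = 0 := by
      have h5 : (2 : ℂ) • S = 0 := by rw [two_smul]; nth_rewrite 1 [e2]; simp
      exact (smul_eq_zero.1 h5).resolve_left two_ne_zero
    rw [this]; simp

end OpT

end SpP


namespace SpP

set_option linter.unusedSectionVars false
set_option linter.unusedVariables false
set_option linter.unusedSimpArgs false

section DistSec

variable {n : ℕ} {F : Type} [Field F] [Fintype F]
variable {X : Type} [AddCommGroup X] [Module ℂ X] [FiniteDimensional ℂ X]
variable (ρ : Representation ℂ (GT n F) X) (ν : Fˣ)

/-- label spaces -/
noncomputable def Lab (i : ℕ) (l d : ℂ) : Submodule ℂ X :=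
  fix ρ (U i) ⊓ (Module.End.eigenspace (ρ (hh i ν)) l ⊓ Module.End.eigenspace (zz ρ i) d)

/-- distinguished modules -/
def Dist : ℕ → Submodule ℂ X → Prop
  | 0, Y => Irr ρ (Gk 0) Y
  | k + 1, Y => Irr ρ (Gk (k+1)) Y ∧
      (∀ y ∈ Y, y ∈ fix ρ (U k) → ρ (hh k ν) (ρ (hh k ν) y) = y) ∧
      ∀ l d : ℂ, Y ⊓ Lab ρ ν k l d = ⊥ ∨ Dist k (Y ⊓ Lab ρ ν k l d)

variable {ρ} {ν}

theorem mem_Lab {i : ℕ} {l d : ℂ} {y : X} : y ∈ Lab ρ ν i l d ↔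
    y ∈ fix ρ (U i) ∧ ρ (hh i ν) y = l • y ∧ zz ρ i y = d • y := by
  unfold Lab
  rw [Submodule.mem_inf, Submodule.mem_inf, Module.End.mem_eigenspace_iff,
    Module.End.mem_eigenspace_iff]

theorem Dist.irr {k : ℕ} {Y : Submodule ℂ X} (h : Dist ρ ν k Y) : Irr ρ (Gk k) Y := by
  cases k with
  | zero => exact h
  | succ k => exact h.1

theorem hh_rho_comm {i : ℕ} (hi : i < n) (a : Fˣ) {g : GT n F} (hg : g ∈ Gk i) (y : X) :
    ρ (hh i a) (ρ g y) = ρ g (ρ (hh i a) y) := by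
  rw [← rho_mul, ← hh_comm hi a hg, rho_mul]

theorem zz_hh {i : ℕ} (hi : i < n) (a : Fˣ) (y : X) :
    zz ρ i (ρ (hh i a) y) = ρ (hh i a) (zz ρ i y) := by
  classical
  rw [zz_apply, zz_apply, map_sum]
  refine Finset.sum_congr rfl fun v hv => ?_
  rw [hh_rho_comm hi a (tv_mem_Gk 1 (Finset.mem_filter.1 hv).2)]

theorem Lab_stab {i : ℕ} (hi : i < n) (l d : ℂ) : Stab ρ (Gk i) (Lab ρ ν i l d) := by
  intro g hg y hy
  rw [mem_Lab] at hy ⊢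
  refine ⟨fix_Gk hg hy.1, ?_, ?_⟩
  · rw [hh_rho_comm hi ν hg, hy.2.1, map_smul]
  · rw [zz_comm hg, hy.2.2, map_smul]

/-- transport -/
theorem Dist_map {X₂ : Type} [AddCommGroup X₂] [Module ℂ X₂] [FiniteDimensional ℂ X₂]
    {ρ₂ : Representation ℂ (GT n F) X₂} (f : X →ₗ[ℂ] X₂) (k : ℕ) (hk : k ≤ n) {Y : Submodule ℂ X}
    (hY : Stab ρ (Gk k) Y) (hf : ∀ g ∈ (Gk k : Subgroup (GT n F)), ∀ y ∈ Y, f (ρ g y) = ρ₂ g (f y))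
    (hinj : ∀ y ∈ Y, f y = 0 → y = 0) :
    Dist ρ₂ ν k (Y.map f) ↔ Dist ρ ν k Y := by
  have hinj' : ∀ a ∈ Y, ∀ b ∈ Y, f a = f b → a = b := by
    intro a ha b hb hab
    have := hinj (a - b) (Y.sub_mem ha hb) (by rw [map_sub, hab, sub_self])
    exact sub_eq_zero.1 this
  induction k generalizing Y with
  | zero => exact irr_map_iff hY f hf hinj
  | succ k ih =>
    have hk' : k < n := hk
    have hzz : ∀ y ∈ Y, f (zz ρ k y) = zz ρ₂ k (f y) := by
      classical
      intro y hy
      rw [zz_apply, zz_apply, map_sum]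
      refine Finset.sum_congr rfl fun v hv => hf _ ?_ y hy
      exact Gk_mono (Nat.le_succ k) (tv_mem_Gk 1 (Finset.mem_filter.1 hv).2)
    have hfix : ∀ y ∈ Y, f y ∈ fix ρ₂ (U k) ↔ y ∈ fix ρ (U k) := by
      intro y hy
      refine ⟨fun h g hg => ?_, fun h g hg => ?_⟩
      · apply hinj' _ (hY g (U_le k hg) y hy) _ hy
        rw [hf g (U_le k hg) y hy, h g hg]
      · rw [← hf g (U_le k hg) y hy, h g hg]
    have hLab : ∀ l d, (Y.map f) ⊓ Lab ρ₂ ν k l d = (Y ⊓ Lab ρ ν k l d).map f := by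
      intro l d
      ext x
      constructor
      · rintro ⟨⟨y, hy, rfl⟩, hx⟩
        rw [SetLike.mem_coe, mem_Lab, hfix y hy] at hx
        refine ⟨y, ⟨hy, mem_Lab.2 ⟨hx.1, ?_, ?_⟩⟩, rfl⟩
        · apply hinj' _ (hY _ (hh_mem hk' ν) y hy) _ (Y.smul_mem _ hy)
          rw [hf _ (hh_mem hk' ν) y hy, hx.2.1, map_smul]
        · apply hinj' _ (zz_stab (hY.mono (Gk_mono (Nat.le_succ k))) hy) _ (Y.smul_mem _ hy)
          rw [hzz y hy, hx.2.2, map_smul]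
      · rintro ⟨y, ⟨hy, hyL⟩, rfl⟩
        rw [SetLike.mem_coe, mem_Lab] at hyL
        refine ⟨⟨y, hy, rfl⟩, mem_Lab.2 ⟨(hfix y hy).2 hyL.1, ?_, ?_⟩⟩
        · rw [← hf _ (hh_mem hk' ν) y hy, hyL.2.1, map_smul]
        · rw [← hzz y hy, hyL.2.2, map_smul]
    unfold Dist
    rw [irr_map_iff hY f hf hinj]
    have hb : ∀ l d, (Y ⊓ Lab ρ ν k l d).map f = ⊥ ↔ Y ⊓ Lab ρ ν k l d = ⊥ := by
      intro l d
      constructor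
      · intro h
        rw [eq_bot_iff]
        intro y hy
        have : f y ∈ (Y ⊓ Lab ρ ν k l d).map f := ⟨y, hy, rfl⟩
        rw [h, Submodule.mem_bot] at this
        exact hinj y hy.1 this
      · intro h; rw [h, Submodule.map_bot]
    have hdist : ∀ l d, Dist ρ₂ ν k ((Y ⊓ Lab ρ ν k l d).map f) ↔ Dist ρ ν k (Y ⊓ Lab ρ ν k l d) := by
      intro l d
      apply ih hk'.le
      · exact (hY.mono (Gk_mono (Nat.le_succ k))).inf (Lab_stab hk' l d)
      · intro g hg y hy
        exact hf g (Gk_mono (Nat.le_succ k) hg) y hy.1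
      · intro y hy; exact hinj y hy.1
      · intro a ha b hb; exact hinj' a ha.1 b hb.1
    simp only [hLab, hb, hdist]
    have hsq : (∀ y ∈ Y.map f, y ∈ fix ρ₂ (U k) → ρ₂ (hh k ν) (ρ₂ (hh k ν) y) = y) ↔
        (∀ y ∈ Y, y ∈ fix ρ (U k) → ρ (hh k ν) (ρ (hh k ν) y) = y) := by
      constructor
      · intro h y hy hyf
        have hm := hh_mem (F := F) hk' ν
        apply hinj' _ (hY _ hm _ (hY _ hm y hy)) _ hy
        rw [hf _ hm _ (hY _ hm y hy), hf _ hm y hy]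
        exact h _ ⟨y, hy, rfl⟩ ((hfix y hy).2 hyf)
      · rintro h _ ⟨y, hy, rfl⟩ hyf
        have hm := hh_mem (F := F) hk' ν
        rw [← hf _ hm y hy, ← hf _ hm _ (hY _ hm y hy), h y hy ((hfix y hy).1 hyf)]
    rw [hsq]

/-- decomposition into label pieces -/
theorem lab_le {i : ℕ} (hi : i < n) {V R : Submodule ℂ X} (hV : V ≤ fix ρ (U i))
    (hS : Stab ρ (Gk i) V) (hh1 : ∀ y ∈ V, ρ (hh i ν) y ∈ V)
    (hsq : ∀ y ∈ V, ρ (hh i ν) (ρ (hh i ν) y) = y)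
    (hR : ∀ l d : ℂ, l ^ 2 = 1 → V ⊓ Lab ρ ν i l d ≤ R) : V ≤ R := by
  have key : ∀ l : ℂ, l ^ 2 = 1 → V ⊓ Module.End.eigenspace (ρ (hh i ν)) l ≤ R := by
    intro l hl
    apply le_of_irr (ρ := ρ) (H := Gk i)
    · intro g hg y hy
      refine ⟨hS g hg y hy.1, ?_⟩
      have := Module.End.mem_eigenspace_iff.1 hy.2
      rw [SetLike.mem_coe, Module.End.mem_eigenspace_iff, hh_rho_comm hi ν hg, this, map_smul]
    · intro Z hZ hI
      obtain ⟨d, hd⟩ := schur hI (zz ρ i) (fun y hy => zz_stab hI.1 hy) (fun g hg y _ => zz_comm hg y)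
      refine le_trans ?_ (hR l d hl)
      intro y hy
      refine ⟨(hZ hy).1, mem_Lab.2 ⟨hV (hZ hy).1, Module.End.mem_eigenspace_iff.1 (hZ hy).2, hd y hy⟩⟩
  intro y hy
  have h1 : y + ρ (hh i ν) y ∈ R := by
    apply key 1 (by norm_num)
    refine ⟨V.add_mem hy (hh1 y hy), ?_⟩
    rw [SetLike.mem_coe, Module.End.mem_eigenspace_iff, map_add, hsq y hy, one_smul, add_comm]
  have h2 : y - ρ (hh i ν) y ∈ R := by
    apply key (-1) (by norm_num)
    refine ⟨V.sub_mem hy (hh1 y hy), ?_⟩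
    rw [SetLike.mem_coe, Module.End.mem_eigenspace_iff, map_sub, hsq y hy]; simp
  have h3 : y = (2⁻¹ : ℂ) • ((y + ρ (hh i ν) y) + (y - ρ (hh i ν) y)) := by
    rw [add_add_sub_cancel, ← two_smul ℂ y, smul_smul]; norm_num
  rw [h3]
  exact R.smul_mem _ (R.add_mem h1 h2)

theorem Lab_indep {i : ℕ} (hi : i < n) : iSupIndep (fun p : ℂ × ℂ => Lab ρ ν i p.1 p.2) := by
  let fam : Bool → Module.End ℂ X := fun b => if b then ρ (hh i ν) else zz ρ i
  have hcomm : ∀ b c, Commute (fam b) (fam c) := by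
    have h1 : Commute (ρ (hh i ν)) (zz ρ i) := by
      ext y
      exact (zz_hh hi ν y).symm
    intro b c
    cases b <;> cases c
    · exact Commute.refl _
    · exact h1.symm
    · exact h1
    · exact Commute.refl _
  have h := Module.End.independent_iInf_maxGenEigenspace_of_forall_mapsTo fam
    (fun b c φ => Module.End.mapsTo_maxGenEigenspace_of_comm (hcomm c b) φ)
  have h2 := h.comp (f := fun p : ℂ × ℂ => (fun b : Bool => if b then p.1 else p.2)) (by
    intro p q hpq
    have h1 := congrFun hpq true
    have h2 := congrFun hpq false
    exact Prod.ext (by simpa using h1) (by simpa using h2))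
  have hle : ∀ (f : Module.End ℂ X) (μ : ℂ), Module.End.eigenspace f μ ≤ Module.End.maxGenEigenspace f μ := by
    intro f μ
    exact (f.genEigenspace μ).mono le_top
  refine h2.mono ?_
  intro p
  refine le_iInf fun b => ?_
  cases b with
  | false =>
    change Lab ρ ν i p.1 p.2 ≤ Module.End.maxGenEigenspace (zz ρ i) p.2
    refine le_trans ?_ (hle _ _)
    intro y hy
    exact hy.2.2
  | true =>
    change Lab ρ ν i p.1 p.2 ≤ Module.End.maxGenEigenspace (ρ (hh i ν)) p.1
    refine le_trans ?_ (hle _ _)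
    intro y hy
    exact hy.2.1

theorem Lab_sup {i : ℕ} (hi : i < n) {K : ℂ × ℂ → Submodule ℂ X}
    (hK : ∀ p, K p ≤ Lab ρ ν i p.1 p.2) (p : ℂ × ℂ) : (⨆ q, K q) ⊓ Lab ρ ν i p.1 p.2 ≤ K p := by
  rintro x ⟨hx, hxp⟩
  have h1 : (⨆ q, K q) ≤ K p ⊔ ⨆ q, ⨆ (_ : q ≠ p), Lab ρ ν i q.1 q.2 := by
    refine iSup_le fun q => ?_
    by_cases hq : q = p
    · rw [hq]; exact le_sup_left
    · exact le_trans ((hK q).trans (le_iSup₂_of_le q hq le_rfl)) le_sup_right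
  obtain ⟨a, ha, b, hb, rfl⟩ := Submodule.mem_sup.1 (h1 hx)
  have hb' : b ∈ Lab ρ ν i p.1 p.2 := by
    have := (Lab ρ ν i p.1 p.2).sub_mem hxp (hK p ha)
    simpa using this
  have := (Submodule.disjoint_def.1 (Lab_indep (ρ := ρ) (ν := ν) hi p)) b hb' hb
  rw [this, add_zero]; exact ha

end DistSec

end SpP


namespace SpP

set_option linter.unusedSectionVars false
set_option linter.unusedVariables false
set_option linter.unusedSimpArgs false

section InjSec

variable {n : ℕ} {F : Type} [Field F] [Fintype F]
variable {X : Type} [AddCommGroup X] [Module ℂ X] [FiniteDimensional ℂ X]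
variable {ρ : Representation ℂ (GT n F) X} {ν : Fˣ}

theorem wuw_e {i : ℕ} (hi : i < n) {u : GT n F} (hu : u ∈ U i) (h1 : u ≠ 1) {c : F}
    (h : (ww i * u * ww i : GT n F) • (e i : W n F) = c • e i) : False := by
  obtain ⟨w, hw, b, rfl⟩ := U_exists hi hu
  have hk : (ww i * uu i w b * ww i : GT n F) • (e i : W n F) = w + b • f i - e i := by
    rw [mul_smul, mul_smul, ww_e hi, uu_f hi hw, smul_add, smul_add, ww_f hi, ww_Wk hi hw, smul_lin,
      ww_e hi]
    abel
  rw [hk] at h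
  have hb : b = 0 := by
    have := congrArg (fun z => B z (e i : W n F)) h
    simpa [Wk_e hw, B_fe hi, B_ee] using this
  have hc := congrArg (fun z => B z (f i : W n F)) h
  simp [Wk_f hw, B_ef hi, B_ff] at hc
  have hw0 : w = 0 := by
    rw [hb, zero_smul, add_zero, ← hc] at h
    have := congrArg (fun z => z + (e i : W n F)) h
    simpa using this
  apply h1
  apply gt_ext
  intro x
  rw [uu_smul (Wk_e hw), hb, hw0]; simp

theorem hh_scalar {i : ℕ} (hi : i < n) (hν : ∀ a : Fˣ, ∃ m : ℕ, a = ν ^ m) {Y : Submodule ℂ X} {l : ℂ}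
    (hl : ∀ y ∈ Y, ρ (hh i ν) y = l • y) (a : Fˣ) (y : X) (hy : y ∈ Y) : ρ (hh i a) y ∈ Y := by
  obtain ⟨m, rfl⟩ := hν a
  rw [hh_pow_eig hi (hl y hy)]
  exact Y.smul_mem _ hy

theorem sq_of_lab {i : ℕ} (hi : i < n) (hν : ∀ a : Fˣ, ∃ m : ℕ, a = ν ^ m) {l : ℂ} (hl2 : l ^ 2 = 1)
    {y : X} (hl : ρ (hh i ν) y = l • y) : ρ (hh i ν) (ρ (hh i ν) y) = y := by
  rw [hl, map_smul, hl, smul_smul, ← sq, hl2, one_smul]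

theorem Inj_base {k : ℕ} (hk : k < n) (hν : ∀ a : Fˣ, ∃ m : ℕ, a = ν ^ m) {Y : Submodule ℂ X}
    (hY : Y ≤ fix ρ (U k)) (hS : Stab ρ (Gk k) Y) (h0 : Y ≠ ⊥) {l : ℂ}
    (hl : ∀ y ∈ Y, ρ (hh k ν) y = l • y)
    (hc : ∀ j, k = j + 1 → Y ⊓ fix ρ (U j) = ⊥)
    (ht : ∀ y ∈ Y, E ρ k (ρ (ww k) y) = 0) : False := by
  classical
  apply h0
  rw [eq_bot_iff]
  intro y hy
  have hterm : ∀ u ∈ (U k : Subgroup (GT n F)), u ≠ 1 → E ρ k (ρ (ww k) (ρ u (ρ (ww k) y))) = 0 := by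
    intro u hu h1
    rw [← rho_mul, ← rho_mul]
    have hg : ww k * u * ww k ∈ (Gk (k+1) : Subgroup (GT n F)) :=
      Subgroup.mul_mem _ (Subgroup.mul_mem _ (ww_mem hk) (U_le k hu)) (ww_mem hk)
    rcases dcos hk hY hS (hh_scalar hk hν hl) hg hy with ⟨⟨c, hcc⟩, _⟩ | ⟨y', hy', h⟩ | ⟨j, rfl, g', hg', y', hy', h⟩
    · exact (wuw_e hk hu h1 hcc).elim
    · rw [h, ht y' hy']
    · rw [h]
      have h2 : avg ρ (U j) y' = 0 := by
        have : avg ρ (U j) y' ∈ Y ⊓ fix ρ (U j) :=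
          ⟨avg_mem (hS.mono (U_le j)) hy', avg_mem_fix _ _ _⟩
        rw [hc j rfl] at this
        exact this
      have h3 : E ρ (j+1) (ρ (ss j) y') = 0 := by
        unfold E
        rw [← avg_avg_conj (K := U j) (fun k hk' => ss_U hk hk'), h2, map_zero, map_zero]
      rw [h3, map_zero]
  have hz : E ρ k (ρ (ww k) (E ρ k (ρ (ww k) y))) = 0 := by
    rw [ht y hy, map_zero, map_zero]
  have hz2 : E ρ k (ρ (ww k) (E ρ k (ρ (ww k) y))) = (Nat.card (U k : Subgroup (GT n F)) : ℂ)⁻¹ •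
      ρ (hh k (-1)) y := by
    have h1 : E ρ k (ρ (ww k) y) = _ := avg_apply ρ (U k) (ρ (ww k) y)
    rw [h1, map_smul, map_smul, map_sum, map_sum]
    congr 1
    rw [Finset.sum_eq_single 1]
    · rw [rho_one, ← rho_mul, ww_ww hk]
      exact E_fix (hY (hh_scalar hk hν hl _ y hy))
    · intro u hu h1
      exact hterm u (Finset.mem_filter.1 hu).2 h1
    · intro h; exact (h (by simp [Subgroup.one_mem])).elim
  rw [hz] at hz2
  have h4 := (smul_eq_zero.1 hz2.symm).resolve_left (inv_ne_zero (card_sub_ne _))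
  exact rho_inj ρ (hh k (-1)) (by rw [h4, map_zero])

theorem fix_stab (i : ℕ) : Stab ρ (Gk i) (fix ρ (U i)) := fun g hg y hy => fix_Gk hg hy

theorem tau_mem {j : ℕ} (hj : j + 1 < n) {y : X} (hy : y ∈ MM ρ j) : E ρ j (ρ (ww j) y) ∈ MM ρ j := by
  refine ⟨avg_mem ((fix_stab (j+1)).mono (U_le j)) ?_, E_mem _⟩
  exact fix_Gk (ww_mem (by omega)) hy.1

/-- existence of a nonzero label piece -/
theorem exists_piece {j : ℕ} (hj : j < n) {Y : Submodule ℂ X} (hS : Stab ρ (Gk (j+1)) Y)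
    (hsq : ∀ y ∈ Y, y ∈ fix ρ (U j) → ρ (hh j ν) (ρ (hh j ν) y) = y)
    (hne : Y ⊓ fix ρ (U j) ≠ ⊥) : ∃ l d : ℂ, l ^ 2 = 1 ∧ Y ⊓ Lab ρ ν j l d ≠ ⊥ := by
  by_contra hcon
  push Not at hcon
  apply hne
  rw [eq_bot_iff]
  apply lab_le (ρ := ρ) (ν := ν) hj inf_le_right
  · exact (hS.mono (Gk_mono (Nat.le_succ j))).inf (fix_stab j)
  · intro y hy
    exact ⟨hS _ (hh_mem hj ν) y hy.1, fix_hh hj ν hy.2⟩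
  · intro y hy; exact hsq y hy.1 hy.2
  · intro l d hl
    rw [← hcon l d hl]
    exact inf_le_inf_right _ inf_le_left

theorem T_Dist {j : ℕ} (hj : j + 1 < n) {Z : Submodule ℂ X} (hZ : Z ≤ MM ρ j) (hD : Dist ρ ν j Z) :
    Dist ρ ν j (Z.map (T ρ j)) := by
  rw [Dist_map (ρ := ρ) (T ρ j) j (by omega) hD.irr.1]
  · exact hD
  · intro g hg y hy; exact T_Gk hj hg y
  · intro y hy h; exact T_inj hj (hZ hy) h

theorem Inj (hν : ∀ a : Fˣ, ∃ m : ℕ, a = ν ^ m) (k : ℕ) : k < n → ∀ Y : Submodule ℂ X,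
    Y ≤ fix ρ (U k) → Dist ρ ν k Y → ∀ l : ℂ, l ^ 2 = 1 → (∀ y ∈ Y, ρ (hh k ν) y = l • y) →
    ¬ ∀ y ∈ Y, E ρ k (ρ (ww k) y) = 0 := by
  induction k with
  | zero =>
    intro hk Y hY hD l hl2 hl ht
    exact Inj_base hk hν hY hD.irr.1 hD.irr.2.1 hl (by intro j hj; omega) ht
  | succ j ih =>
    intro hk Y hY hD l hl2 hl ht
    by_cases hne : Y ⊓ fix ρ (U j) = ⊥
    · refine Inj_base hk hν hY hD.irr.1 hD.irr.2.1 hl ?_ ht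
      intro j' hj'
      obtain rfl : j = j' := by omega
      exact hne
    · obtain ⟨m, d, hm2, hz⟩ := exists_piece (by omega) hD.irr.1 hD.2.1 hne
      have hzM : Y ⊓ Lab ρ ν j m d ≤ MM ρ j := fun y hy => ⟨hY hy.1, hy.2.1⟩
      have hzD := (hD.2.2 m d).resolve_left hz
      refine ih (by omega) _ ?_ (T_Dist hk hzM hzD) l hl2 ?_ ?_
      · rintro _ ⟨y, hy, rfl⟩
        exact (T_mem hk (hzM hy)).2
      · rintro _ ⟨y, hy, rfl⟩
        rw [T_h' hk, hl y hy.1, map_smul]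
      · rintro _ ⟨y, hy, rfl⟩
        apply T_inj hk (tau_mem hk (T_mem hk (hzM hy)))
        rw [T_tau_T hk (hzM hy)]
        exact ht y hy.1

end InjSec

end SpP


namespace SpP

set_option linter.unusedSectionVars false
set_option linter.unusedVariables false
set_option linter.unusedSimpArgs false

section SSec

variable {n : ℕ} {F : Type} [Field F] [Fintype F]
variable {X : Type} [AddCommGroup X] [Module ℂ X] [FiniteDimensional ℂ X]
variable {ρ : Representation ℂ (GT n F) X} {ν : Fˣ}

theorem iSup_stab {ι : Type} {H : Subgroup (GT n F)} {K : ι → Submodule ℂ X}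
    (h : ∀ p, Stab ρ H (K p)) : Stab ρ H (⨆ p, K p) := by
  intro g hg y hy
  have : (⨆ p, K p) ≤ (⨆ p, K p).comap (ρ g) := by
    refine iSup_le fun p x hx => ?_
    exact Submodule.mem_iSup_of_mem p (h p g hg x hx)
  exact this hy

theorem zz_succ {j : ℕ} (hj : j < n) (hν : ∀ a : Fˣ, ∃ m : ℕ, a = ν ^ m) {x : X} (hx : x ∈ fix ρ (U j))
    (hsq : ρ (hh j ν) (ρ (hh j ν) x) = x) :
    zz ρ (j+1) x = (Fintype.card F : ℂ) • zz ρ j x + CC n F j • E ρ j (ρ (ww j) x) := by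
  rw [← E_zz hj hx (sq_triv hj hν hsq), E_fix]
  intro u hu
  rw [← zz_comm (U_le j hu), hx u hu]

theorem zz_T {j : ℕ} (hj : j + 1 < n) (y : X) : zz ρ j (T ρ j y) = T ρ j (zz ρ j y) := by
  classical
  rw [zz_apply, zz_apply, map_sum]
  refine Finset.sum_congr rfl fun v hv => ?_
  rw [T_Gk hj (tv_mem_Gk 1 (Finset.mem_filter.1 hv).2)]

theorem S_core {k : ℕ} (hk : k < n) (hν : ∀ a : Fˣ, ∃ m : ℕ, a = ν ^ m) {Y : Submodule ℂ X}
    (hY : Y ≤ fix ρ (U k)) (hI : Irr ρ (Gk k) Y) {l b t : ℂ} (hl2 : l ^ 2 = 1)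
    (hl : ∀ y ∈ Y, ρ (hh k ν) y = l • y) (ht : ∀ y ∈ Y, E ρ k (ρ (ww k) y) = t • y)
    (Kf : ℂ × ℂ → Submodule ℂ X) (hKL : ∀ p, Kf p ≤ Lab ρ ν k p.1 p.2)
    (hKN : ∀ p, Kf p ≤ gspan ρ (Gk (k+1)) Y)
    (hKD : ∀ p, Kf p = ⊥ ∨ (Dist ρ ν k (Kf p) ∧ p.1 ^ 2 = 1)) (hKY : Kf (l, b) = Y)
    (hsqY : ∀ j, k = j + 1 → ∀ y ∈ Y, y ∈ fix ρ (U j) → ρ (hh j ν) (ρ (hh j ν) y) = y)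
    (hT : ∀ j, k = j + 1 → ∀ m d : ℂ, m ^ 2 = 1 → ∀ y ∈ Y ⊓ Lab ρ ν j m d, T ρ j y ∈ ⨆ p, Kf p) :
    Dist ρ ν (k+1) (gspan ρ (Gk (k+1)) Y) := by
  have hKS : ∀ p, Stab ρ (Gk k) (Kf p) := by
    intro p
    rcases hKD p with h | h
    · rw [h]; exact stab_bot _ _
    · exact h.1.irr.1
  have hRS : Stab ρ (Gk k) (⨆ p, Kf p) := iSup_stab hKS
  have hYR : Y ≤ ⨆ p, Kf p := by rw [← hKY]; exact le_iSup Kf (l, b)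
  have hNS := gspan_stab ρ (Gk (k+1)) Y
  have hYN := le_gspan ρ (Gk (k+1)) Y
  have hgen : ∀ g ∈ (Gk (k+1) : Subgroup (GT n F)), ∀ y ∈ Y, E ρ k (ρ g y) ∈ ⨆ p, Kf p := by
    intro g hg y hy
    rcases dcos hk hY hI.1 (hh_scalar hk hν hl) hg hy with h | ⟨y', hy', h⟩ | ⟨j, rfl, g', hg', y', hy', h⟩
    · exact hYR h.2
    · rw [h, ht y' hy']
      exact hYR (Y.smul_mem _ hy')
    · rw [h]
      apply hRS g' hg'
      have h3 : E ρ (j+1) (ρ (ss j) y') = T ρ j (avg ρ (U j) y') := by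
        rw [T_apply]
        unfold E
        rw [avg_avg_conj (K := U j) (fun k hk' => ss_U hk hk')]
      rw [h3]
      have h4 : Y ⊓ fix ρ (U j) ≤ (⨆ p, Kf p).comap (T ρ j) := by
        have hj : j < n := by omega
        apply lab_le (ρ := ρ) (ν := ν) hj inf_le_right
        · exact (hI.1.mono (Gk_mono (Nat.le_succ j))).inf (fix_stab j)
        · intro y hy
          exact ⟨hI.1 _ (hh_mem hj ν) y hy.1, fix_hh hj ν hy.2⟩
        · intro y hy; exact hsqY j rfl y hy.1 hy.2
        · intro m d hm y hy
          exact hT j rfl m d hm y ⟨hy.1.1, hy.2⟩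
      exact h4 ⟨avg_mem (hI.1.mono (U_le j)) hy', avg_mem_fix _ _ _⟩
  have hfix : gspan ρ (Gk (k+1)) Y ⊓ fix ρ (U k) ≤ ⨆ p, Kf p := by
    have h1 : gspan ρ (Gk (k+1)) Y ≤ (⨆ p, Kf p).comap (E ρ k) := by
      refine Submodule.span_le.2 ?_
      rintro x ⟨g, hg, y, hy, rfl⟩
      exact hgen g hg y hy
    rintro x ⟨hx, hxf⟩
    have := h1 hx
    rw [Submodule.mem_comap, E_fix hxf] at this
    exact this
  have hNL : ∀ m d : ℂ, gspan ρ (Gk (k+1)) Y ⊓ Lab ρ ν k m d = Kf (m, d) := by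
    intro m d
    apply le_antisymm
    · refine le_trans ?_ (Lab_sup (ρ := ρ) (ν := ν) hk hKL (m, d))
      rintro x ⟨hx, hxL⟩
      exact ⟨hfix ⟨hx, hxL.1⟩, hxL⟩
    · exact le_inf (hKN _) (hKL (m, d))
  have hNY : gspan ρ (Gk (k+1)) Y ⊓ Lab ρ ν k l b = Y := by rw [hNL, hKY]
  refine ⟨⟨hNS, ?_, ?_⟩, ?_, ?_⟩
  · intro h
    apply hI.2.1
    rw [eq_bot_iff, ← h]; exact hYN
  · intro Z hZN hZ
    obtain ⟨Z', hZ'N, hZ', hdis, hsup⟩ := maschke hNS hZ hZN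
    have hcase : ∀ V ≤ gspan ρ (Gk (k+1)) Y, Stab ρ (Gk (k+1)) V →
        V ⊓ Y = ⊥ ∨ gspan ρ (Gk (k+1)) Y ≤ V := by
      intro V hVN hV
      rcases hI.2.2 (V ⊓ Y) inf_le_right ((hV.mono (Gk_mono (Nat.le_succ k))).inf hI.1) with h | h
      · exact Or.inl h
      · right
        exact gspan_le hV (by rw [← h]; exact inf_le_left)
    rcases hcase Z hZN hZ with h1 | h1
    · rcases hcase Z' hZ'N hZ' with h2 | h2
      · exfalso
        apply hI.2.1
        rw [eq_bot_iff]
        intro y hy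
        have hyN := hYN hy
        rw [← hsup] at hyN
        obtain ⟨z, hz, z', hz', rfl⟩ := Submodule.mem_sup.1 hyN
        have hyL : z + z' ∈ Lab ρ ν k l b := by
          have : z + z' ∈ gspan ρ (Gk (k+1)) Y ⊓ Lab ρ ν k l b := by rw [hNY]; exact hy
          exact this.2
        rw [mem_Lab] at hyL
        have hsplit : ∀ (A : X →ₗ[ℂ] X) (c : ℂ), (∀ x ∈ Z, A x ∈ Z) → (∀ x ∈ Z', A x ∈ Z') →
            A (z + z') = c • (z + z') → A z = c • z ∧ A z' = c • z' := by
          intro A c hA hA' h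
          have h5 : A z - c • z = -(A z' - c • z') := by
            rw [map_add, smul_add] at h
            rw [neg_sub, sub_eq_sub_iff_add_eq_add, h]; abel
          have h6 : A z - c • z ∈ Z ⊓ Z' := by
            refine ⟨Z.sub_mem (hA z hz) (Z.smul_mem _ hz), ?_⟩
            rw [h5]
            exact Z'.neg_mem (Z'.sub_mem (hA' z' hz') (Z'.smul_mem _ hz'))
          rw [hdis, Submodule.mem_bot] at h6
          rw [h6] at h5
          exact ⟨sub_eq_zero.1 h6, sub_eq_zero.1 (neg_eq_zero.1 h5.symm)⟩
        have hu : ∀ u ∈ (U k : Subgroup (GT n F)), ρ u z = z ∧ ρ u z' = z' := by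
          intro u hu
          have := hsplit (ρ u) 1 (hZ u (U_le k hu)) (hZ' u (U_le k hu)) (by rw [hyL.1 u hu, one_smul])
          simpa using this
        have hhh := hsplit (ρ (hh k ν)) l (hZ _ (hh_mem hk ν)) (hZ' _ (hh_mem hk ν)) hyL.2.1
        have hzz := hsplit (zz ρ k) b
          (fun x hx => zz_stab (hZ.mono (Gk_mono (Nat.le_succ k))) hx)
          (fun x hx => zz_stab (hZ'.mono (Gk_mono (Nat.le_succ k))) hx) hyL.2.2
        have hzY : z ∈ Y := by
          rw [← hNY]
          exact ⟨hZN hz, mem_Lab.2 ⟨fun u hu' => (hu u hu').1, hhh.1, hzz.1⟩⟩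
        have hzY' : z' ∈ Y := by
          rw [← hNY]
          exact ⟨hZ'N hz', mem_Lab.2 ⟨fun u hu' => (hu u hu').2, hhh.2, hzz.2⟩⟩
        have e1 : z ∈ Z ⊓ Y := ⟨hz, hzY⟩
        have e2 : z' ∈ Z' ⊓ Y := ⟨hz', hzY'⟩
        rw [h1, Submodule.mem_bot] at e1
        rw [h2, Submodule.mem_bot] at e2
        rw [e1, e2, add_zero]; exact Submodule.zero_mem _
      · left
        rw [eq_bot_iff, ← hdis]
        exact le_inf le_rfl (hZN.trans h2)
    · right
      exact le_antisymm hZN h1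
  · intro y hy hyf
    have : (⨆ p, Kf p) ≤ LinearMap.ker (ρ (hh k ν) ∘ₗ ρ (hh k ν) - LinearMap.id) := by
      refine iSup_le fun p x hx => ?_
      rcases hKD p with h | h
      · rw [h, Submodule.mem_bot] at hx
        rw [hx]; exact Submodule.zero_mem _
      · rw [LinearMap.mem_ker, LinearMap.sub_apply, LinearMap.comp_apply, LinearMap.id_apply,
          sq_of_lab hk hν h.2 (mem_Lab.1 (hKL p hx)).2.1, sub_self]
    have h2 := this (hfix ⟨hy, hyf⟩)
    rw [LinearMap.mem_ker, LinearMap.sub_apply, LinearMap.comp_apply, LinearMap.id_apply] at h2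
    exact sub_eq_zero.1 h2
  · intro m d
    rw [hNL]
    rcases hKD (m, d) with h | h
    · exact Or.inl h
    · exact Or.inr h.1

/-- the induction statement -/
def SS (ρ : Representation ℂ (GT n F) X) (ν : Fˣ) (k : ℕ) : Prop :=
  ∀ Y : Submodule ℂ X, Y ≤ fix ρ (U k) → Dist ρ ν k Y → ∀ l : ℂ, l ^ 2 = 1 →
    (∀ y ∈ Y, ρ (hh k ν) y = l • y) → ∀ c : ℂ, (∀ y ∈ Y, zz ρ (k+1) y = c • y) →
    Dist ρ ν (k+1) (gspan ρ (Gk (k+1)) Y)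

theorem S_piece {j : ℕ} (hj : j + 1 < n) (hν : ∀ a : Fˣ, ∃ m : ℕ, a = ν ^ m) {Y : Submodule ℂ X}
    (hY : Y ≤ fix ρ (U (j+1))) (hD : Dist ρ ν (j+1) Y) {l b t : ℂ} (hl2 : l ^ 2 = 1)
    (hl : ∀ y ∈ Y, ρ (hh (j+1) ν) y = l • y) (ht0 : t ≠ 0)
    (ht : ∀ y ∈ Y, E ρ (j+1) (ρ (ww (j+1)) y) = t • y)
    (hb : ∀ y ∈ Y, zz ρ (j+1) y = b • y) (IH : SS ρ ν j) (m d : ℂ) (hm2 : m ^ 2 = 1)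
    (hne : Y ⊓ Lab ρ ν j m d ≠ ⊥) :
    ∃ K : Submodule ℂ X, (K = ⊥ ∨ Dist ρ ν (j+1) K) ∧ K ≤ gspan ρ (Gk (j+2)) Y ∧
      K ≤ Lab ρ ν (j+1) m ((Fintype.card F : ℂ) * d + CC n F j * t * Fintype.card F) ∧
      (∀ y ∈ Y ⊓ Lab ρ ν j m d, T ρ j y ∈ K ⊔ Y) ∧
      (m, (Fintype.card F : ℂ) * d + CC n F j * t * Fintype.card F) ≠ (l, b) := by
  set q : ℂ := (Fintype.card F : ℂ) with hq
  set C : ℂ := CC n F j with hC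
  have hC0 : C ≠ 0 := CC_ne (F := F) (by omega)
  have hjn : j < n := by omega
  set Z := Y ⊓ Lab ρ ν j m d with hZ
  have hZM : Z ≤ MM ρ j := fun y hy => ⟨hY hy.1, hy.2.1⟩
  have hZD : Dist ρ ν j Z := (hD.2.2 m d).resolve_left hne
  obtain ⟨κ, hκ1, hκ2, hκ⟩ := T_kappa (ρ := ρ) hj hν hl2 hm2
  have hZh : ∀ y ∈ Z, ρ (hh j ν) y = m • y := fun y hy => (mem_Lab.1 hy.2).2.1
  have hZz : ∀ y ∈ Z, zz ρ j y = d • y := fun y hy => (mem_Lab.1 hy.2).2.2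
  have hTT : ∀ y ∈ Z, q • T ρ j (T ρ j y) = y + κ • T ρ j y :=
    fun y hy => hκ y (hZM hy) (hl y hy.1) (hZh y hy)
  have hTh : ∀ y ∈ Z, ρ (hh j ν) (T ρ j y) = l • T ρ j y := by
    intro y hy; rw [T_h' hj, hl y hy.1, map_smul]
  have hTtau : ∀ y ∈ Z, E ρ j (ρ (ww j) (T ρ j y)) = t • (q • T ρ j y - κ • y) := by
    intro y hy
    rw [← sub_eq_zero]
    have hTm := T_mem hj (hZM hy)
    apply T_inj (ρ := ρ) hj
    · refine (MM ρ j).sub_mem (tau_mem hj hTm) ((MM ρ j).smul_mem _ ((MM ρ j).sub_mem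
        ((MM ρ j).smul_mem _ hTm) ((MM ρ j).smul_mem _ (hZM hy))))
    · rw [map_sub, T_tau_T hj (hZM hy), ht y hy.1, map_smul, map_sub, map_smul, map_smul, hTT y hy,
        add_sub_cancel_right, sub_self]
  have hzT : ∀ y ∈ Z, zz ρ (j+1) (T ρ j y) = (q * d + C * t * q) • T ρ j y - (C * t * κ) • y := by
    intro y hy
    rw [zz_succ hjn hν (T_mem hj (hZM hy)).2 (sq_of_lab hjn hν hl2 (hTh y hy)), zz_T hj, hZz y hy,
      hTtau y hy, map_smul]
    module
  obtain ⟨y0, hy0, hy0n⟩ := Submodule.exists_mem_ne_zero_of_ne_bot hne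
  -- the constant
  have hsb : κ ≠ 0 → b ≠ q * d + C * t * q := by
    intro hk0 hbs
    have h1 := semisimple (ρ := ρ) (H := Gk (j+1)) (zz ρ (j+1)) (fun V hV y hy => zz_stab hV hy)
      (fun g hg y => zz_comm hg y) b (x := T ρ j y0) (by
        rw [hzT y0 hy0, ← hbs, sub_sub_cancel_left, map_neg, map_smul, hb y0 hy0.1]
        module)
    rw [hzT y0 hy0, ← hbs] at h1
    have h2 : (C * t * κ) • y0 = 0 := by
      have := sub_eq_self.1 h1
      exact this
    rcases smul_eq_zero.1 h2 with h | h
    · exact mul_ne_zero (mul_ne_zero hC0 ht0) hk0 h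
    · exact hy0n h
  obtain ⟨r, hr, hr0⟩ : ∃ r : ℂ, r * (q * d + C * t * q - b) = C * t * κ ∧ (κ = 0 → r = 0) := by
    by_cases hk0 : κ = 0
    · exact ⟨0, by rw [hk0]; ring, fun _ => rfl⟩
    · refine ⟨C * t * κ / (q * d + C * t * q - b), ?_, fun h => (hk0 h).elim⟩
      rw [div_mul_cancel₀]
      exact sub_ne_zero.2 (hsb hk0).symm
  have hrml : r ≠ 0 → l = m := by
    intro h
    by_contra hlm
    exact h (hr0 (hκ2 hlm))
  set φ : X →ₗ[ℂ] X := T ρ j - r • LinearMap.id with hφ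
  have hφa : ∀ y, φ y = T ρ j y - r • y := fun y => rfl
  have hφM : ∀ y ∈ Z, φ y ∈ MM ρ j := by
    intro y hy
    exact (MM ρ j).sub_mem (T_mem hj (hZM hy)) ((MM ρ j).smul_mem _ (hZM hy))
  have hφ1 : ∀ y ∈ Z, ρ (hh (j+1) ν) (φ y) = m • φ y := by
    intro y hy
    rw [hφa, map_sub, T_h hj, hZh y hy, map_smul, map_smul, hl y hy.1]
    by_cases h : r = 0
    · rw [h]; simp
    · rw [hrml h]; module
  have hφ2 : ∀ y ∈ Z, ρ (hh j ν) (φ y) = l • φ y := by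
    intro y hy
    rw [hφa, map_sub, hTh y hy, map_smul, hZh y hy]
    by_cases h : r = 0
    · rw [h]; simp
    · rw [hrml h]; module
  have hφ3 : ∀ y ∈ Z, zz ρ (j+1) (φ y) = (q * d + C * t * q) • φ y := by
    intro y hy
    rw [hφa, map_sub, hzT y hy, map_smul, hb y hy.1, ← hr]
    module
  have hφG : ∀ g ∈ (Gk j : Subgroup (GT n F)), ∀ y ∈ Z, φ (ρ g y) = ρ g (φ y) := by
    intro g hg y hy
    rw [hφa, hφa, T_Gk hj hg, map_sub, map_smul]
  have hlab : (m, q * d + C * t * q) ≠ (l, b) := by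
    intro h
    have h1 := congrArg Prod.fst h
    have h2 := congrArg Prod.snd h
    exact hsb (hκ1 h1.symm) h2.symm
  have hker := hZD.irr.2.2 (Z ⊓ LinearMap.ker φ) inf_le_left (by
    intro g hg y hy
    refine ⟨hZD.irr.1 g hg y hy.1, ?_⟩
    have hy2 : φ y = 0 := hy.2
    change φ (ρ g y) = 0
    rw [hφG g hg y hy.1, hy2, map_zero])
  rcases hker with h | h
  · have hinj : ∀ y ∈ Z, φ y = 0 → y = 0 := by
      intro y hy h0
      have : y ∈ Z ⊓ LinearMap.ker φ := ⟨hy, h0⟩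
      rw [h] at this; exact this
    have hDφ : Dist ρ ν j (Z.map φ) := (Dist_map (ρ := ρ) φ j (by omega) hZD.irr.1 hφG hinj).2 hZD
    have hS := IH (Z.map φ) (by rintro _ ⟨y, hy, rfl⟩; exact (hφM y hy).2) hDφ l hl2
      (by rintro _ ⟨y, hy, rfl⟩; exact hφ2 y hy) _ (by rintro _ ⟨y, hy, rfl⟩; exact hφ3 y hy)
    refine ⟨gspan ρ (Gk (j+1)) (Z.map φ), Or.inr hS, ?_, ?_, ?_, hlab⟩
    · have hNS := gspan_stab ρ (Gk (j+2)) Y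
      apply gspan_le (hNS.mono (Gk_mono (Nat.le_succ _)))
      rintro _ ⟨y, hy, rfl⟩
      have hyN := le_gspan ρ (Gk (j+2)) Y hy.1
      refine Submodule.sub_mem _ ?_ (Submodule.smul_mem _ _ hyN)
      exact avg_mem (hNS.mono (U_le (j+1))) (hNS _ (ss_mem hj) y hyN)
    · apply gspan_le (Lab_stab hj _ _)
      rintro _ ⟨y, hy, rfl⟩
      exact mem_Lab.2 ⟨(hφM y hy).1, hφ1 y hy, hφ3 y hy⟩
    · intro y hy
      have : T ρ j y = φ y + r • y := by rw [hφa]; abel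
      rw [this]
      exact Submodule.add_mem_sup (le_gspan _ _ _ ⟨y, hy, rfl⟩) (Y.smul_mem _ hy.1)
  · refine ⟨⊥, Or.inl rfl, bot_le, bot_le, ?_, hlab⟩
    intro y hy
    have hy' : y ∈ Z ⊓ LinearMap.ker φ := by rw [h]; exact hy
    have h0 : φ y = 0 := hy'.2
    rw [hφa, sub_eq_zero] at h0
    rw [h0]
    exact Submodule.mem_sup_right (Y.smul_mem _ hy.1)

theorem S_all (hν : ∀ a : Fˣ, ∃ m : ℕ, a = ν ^ m) (k : ℕ) : k < n → SS ρ ν k := by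
  classical
  induction k with
  | zero =>
    intro hk Y hY hD l hl2 hl c hc
    have ht : ∀ y ∈ Y, E ρ 0 (ρ (ww 0) y) = ((c - Fintype.card F) / CC n F 0) • y := by
      intro y hy
      have h := zz_succ hk hν (hY hy) (sq_of_lab hk hν hl2 (hl y hy))
      rw [hc y hy, zz_zero] at h
      have h2 : CC n F 0 • E ρ 0 (ρ (ww 0) y) = (c - Fintype.card F) • y := by
        rw [sub_smul, h]; abel
      rw [div_eq_inv_mul, mul_smul, ← h2, smul_smul, inv_mul_cancel₀ (CC_ne hk), one_smul]
    have hYL : Y ≤ Lab ρ ν 0 l 1 := fun y hy => mem_Lab.2 ⟨hY hy, hl y hy, by rw [zz_zero, one_smul]⟩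
    refine S_core (b := 1) hk hν hY hD.irr hl2 hl ht (fun p => if p = (l, 1) then Y else ⊥) ?_ ?_ ?_ ?_ ?_ ?_
    · intro p
      split_ifs with h
      · rw [h]; exact hYL
      · exact bot_le
    · intro p
      split_ifs with h
      · exact le_gspan _ _ _
      · exact bot_le
    · intro p
      split_ifs with h
      · right; rw [h]; exact ⟨hD, hl2⟩
      · exact Or.inl rfl
    · simp
    · intro j hj; omega
    · intro j hj; omega
  | succ j ih =>
    intro hk Y hY hD l hl2 hl c hc
    have IH := ih (by omega)
    obtain ⟨b, hb⟩ := schur hD.irr (zz ρ (j+1)) (fun y hy => zz_stab hD.irr.1 hy)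
      (fun g hg y _ => zz_comm hg y)
    set q : ℂ := (Fintype.card F : ℂ) with hq
    have hq0 : q ≠ 0 := qne
    set C : ℂ := CC n F j with hC
    obtain ⟨t, ht⟩ : ∃ t : ℂ, ∀ y ∈ Y, E ρ (j+1) (ρ (ww (j+1)) y) = t • y := by
      refine ⟨(c - q * b) / CC n F (j+1), ?_⟩
      intro y hy
      have h := zz_succ hk hν (hY hy) (sq_of_lab hk hν hl2 (hl y hy))
      rw [hc y hy, hb y hy] at h
      have h2 : CC n F (j+1) • E ρ (j+1) (ρ (ww (j+1)) y) = (c - q * b) • y := by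
        rw [sub_smul, h]; module
      rw [div_eq_inv_mul, mul_smul, ← h2, smul_smul, inv_mul_cancel₀ (CC_ne hk), one_smul]
    have ht0 : t ≠ 0 := by
      intro h0
      apply Inj hν (j+1) hk Y hY hD l hl2 hl
      intro y hy
      rw [ht y hy, h0, zero_smul]
    have hK : ∀ m d : ℂ, ∃ K : Submodule ℂ X, (K = ⊥ ∨ (Dist ρ ν (j+1) K ∧ m ^ 2 = 1)) ∧
        K ≤ gspan ρ (Gk (j+2)) Y ∧
        K ≤ Lab ρ ν (j+1) m (q * d + C * t * q) ∧
        (m ^ 2 = 1 → ∀ y ∈ Y ⊓ Lab ρ ν j m d, T ρ j y ∈ K ⊔ Y) ∧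
        ((m, q * d + C * t * q) = (l, b) → K = ⊥) := by
      intro m d
      by_cases hm : m ^ 2 = 1
      · by_cases hne : Y ⊓ Lab ρ ν j m d = ⊥
        · refine ⟨⊥, Or.inl rfl, bot_le, bot_le, ?_, fun _ => rfl⟩
          intro _ y hy
          rw [hne, Submodule.mem_bot] at hy
          rw [hy, map_zero]; exact Submodule.zero_mem _
        · obtain ⟨K, h1, h2, h3, h4, h5⟩ := S_piece hk hν hY hD hl2 hl ht0 ht hb IH m d hm hne
          exact ⟨K, h1.imp id (fun h => ⟨h, hm⟩), h2, h3, fun _ => h4, fun h => (h5 h).elim⟩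
      · exact ⟨⊥, Or.inl rfl, bot_le, bot_le, fun h => (hm h).elim, fun _ => rfl⟩
    choose K hK1 hK2 hK3 hK4 hK5 using hK
    have hinv : ∀ d : ℂ, q * ((d - C * t * q) / q) + C * t * q = d := by
      intro d; field_simp; ring
    have hinv' : ∀ d : ℂ, ((q * d + C * t * q) - C * t * q) / q = d := by
      intro d; field_simp; ring
    refine S_core (b := b) hk hν hY hD.irr hl2 hl ht
      (fun p => if p = (l, b) then Y else K p.1 ((p.2 - C * t * q) / q)) ?_ ?_ ?_ ?_ ?_ ?_
    · intro p
      split_ifs with h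
      · rw [h]
        exact fun y hy => mem_Lab.2 ⟨hY hy, hl y hy, hb y hy⟩
      · have := hK3 p.1 ((p.2 - C * t * q) / q)
        rwa [hinv] at this
    · intro p
      split_ifs with h
      · exact le_gspan _ _ _
      · exact hK2 _ _
    · intro p
      split_ifs with h
      · right; rw [h]; exact ⟨hD, hl2⟩
      · exact hK1 _ _
    · simp
    · intro j' hj'
      obtain rfl : j = j' := by omega
      exact hD.2.1
    · intro j' hj' m d hm y hy
      obtain rfl : j = j' := by omega
      have h1 := hK4 m d hm y hy
      have hle : K m d ⊔ Y ≤ ⨆ p : ℂ × ℂ, (if p = (l, b) then Y else K p.1 ((p.2 - C * t * q) / q)) := by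
        refine sup_le ?_ ?_
        · by_cases h : (m, q * d + C * t * q) = (l, b)
          · rw [hK5 m d h]; exact bot_le
          · refine le_iSup_of_le (m, q * d + C * t * q) ?_
            rw [if_neg h]
            dsimp only
            rw [hinv']
        · refine le_iSup_of_le (l, b) ?_
          rw [if_pos rfl]
      exact hle h1

end SSec

end SpP


namespace SpP

set_option linter.unusedSectionVars false
set_option linter.unusedVariables false
set_option linter.unusedSimpArgs false

section LinAlg

variable {X : Type} [AddCommGroup X] [Module ℂ X] [FiniteDimensional ℂ X]

/-- trace of the compression of an endomorphism to a subspace -/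
noncomputable def trOn (Y : Submodule ℂ X) : (X →ₗ[ℂ] X) →ₗ[ℂ] ℂ where
  toFun A := LinearMap.trace ℂ Y ((Classical.choose (Y.subtype.exists_leftInverse_of_injective Y.ker_subtype)) ∘ₗ A ∘ₗ Y.subtype)
  map_add' A A' := by
    rw [LinearMap.add_comp, LinearMap.comp_add, map_add]
  map_smul' c A := by
    rw [LinearMap.smul_comp, LinearMap.comp_smul, map_smul]; rfl

theorem trOn_eq {Y : Submodule ℂ X} {A : X →ₗ[ℂ] X} (hA : ∀ y ∈ Y, A y ∈ Y) :
    trOn Y A = LinearMap.trace ℂ Y (A.restrict hA) := by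
  have h := Classical.choose_spec (Y.subtype.exists_leftInverse_of_injective Y.ker_subtype)
  change LinearMap.trace ℂ Y _ = _
  congr 1
  ext y
  have := LinearMap.congr_fun h (A.restrict hA y)
  simp only [LinearMap.comp_apply, LinearMap.id_apply] at this ⊢
  exact congrArg Subtype.val this

theorem trOn_congr {Y : Submodule ℂ X} {A A' : X →ₗ[ℂ] X} (h : ∀ y ∈ Y, A y = A' y) :
    trOn Y A = trOn Y A' := by
  change LinearMap.trace ℂ Y _ = LinearMap.trace ℂ Y _
  congr 2
  ext y
  exact h y y.2

theorem trOn_comm {Y : Submodule ℂ X} {A A' : X →ₗ[ℂ] X} (hA : ∀ y ∈ Y, A y ∈ Y)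
    (hA' : ∀ y ∈ Y, A' y ∈ Y) : trOn Y (A ∘ₗ A') = trOn Y (A' ∘ₗ A) := by
  rw [trOn_eq (A := A ∘ₗ A') (fun y hy => hA _ (hA' y hy)), trOn_eq (A := A' ∘ₗ A) (fun y hy => hA' _ (hA y hy))]
  exact LinearMap.trace_mul_comm ℂ (A.restrict hA) (A'.restrict hA')

theorem trOn_sub {Y Z : Submodule ℂ X} (hZY : Z ≤ Y) {A : X →ₗ[ℂ] X} (hA : ∀ y ∈ Y, A y ∈ Z) :
    trOn Y A = trOn Z A := by
  rw [trOn_eq (fun y hy => hZY (hA y hy)), trOn_eq (fun y hy => hA y (hZY hy))]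
  let A' : Y →ₗ[ℂ] Z := A.restrict hA
  let i : Z →ₗ[ℂ] Y := Submodule.inclusion hZY
  have h1 : A.restrict (fun y hy => hZY (hA y hy)) = i ∘ₗ A' := by ext; rfl
  have h2 : A.restrict (fun y hy => hA y (hZY hy)) = A' ∘ₗ i := by ext; rfl
  rw [h1, h2, LinearMap.trace_comp_comm']

theorem trOn_id (Y : Submodule ℂ X) : trOn Y LinearMap.id = Module.finrank ℂ Y := by
  rw [trOn_eq (fun y hy => hy)]
  have : (LinearMap.id : X →ₗ[ℂ] X).restrict (fun y hy => hy) = (LinearMap.id : Y →ₗ[ℂ] Y) := by ext; rfl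
  rw [this, LinearMap.trace_id]

theorem trOn_scalar {Y : Submodule ℂ X} {A : X →ₗ[ℂ] X} {c : ℂ} (h : ∀ y ∈ Y, A y = c • y) :
    trOn Y A = c * Module.finrank ℂ Y := by
  rw [trOn_congr (A' := c • LinearMap.id) (fun y hy => by rw [h y hy]; rfl), map_smul, trOn_id]; rfl

/-- multiplicities -/
theorem root_sum {N : ℕ} (hN : 0 < N) {ζ : ℂ} (hζ : IsPrimitiveRoot ζ N) {i j : ℕ} (hi : i < N) (hj : j < N) :
    ∑ a ∈ Finset.range N, (ζ ^ a) ^ j * ((ζ ^ a)⁻¹) ^ i = if i = j then (N : ℂ) else 0 := by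
  have hz0 : ζ ≠ 0 := hζ.ne_zero hN.ne'
  split_ifs with h
  · subst h
    rw [Finset.sum_congr rfl (g := fun _ => (1:ℂ))]
    · simp
    · intro a _
      rw [← mul_pow, mul_inv_cancel₀ (pow_ne_zero _ hz0), one_pow]
  · set x : ℂ := ζ ^ j * (ζ⁻¹) ^ i with hx
    have hx1 : x ≠ 1 := by
      intro hx1
      apply h
      have : ζ ^ j = ζ ^ i := by
        rw [hx, inv_pow, ← div_eq_mul_inv, div_eq_one_iff_eq (pow_ne_zero _ hz0)] at hx1
        exact hx1
      exact (hζ.pow_inj hj hi this).symm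
    have hxN : x ^ N = 1 := by
      rw [hx, mul_pow, ← pow_mul, ← pow_mul, mul_comm j, mul_comm i, pow_mul, pow_mul, inv_pow, hζ.pow_eq_one]
      simp
    have : ∀ a ∈ Finset.range N, (ζ ^ a) ^ j * ((ζ ^ a)⁻¹) ^ i = x ^ a := by
      intro a _
      rw [hx, mul_pow, ← pow_mul, ← pow_mul, ← inv_pow, ← pow_mul, ← pow_mul, mul_comm a, mul_comm a]
    rw [Finset.sum_congr rfl this, geom_sum_eq hx1, hxN, sub_self, zero_div]

theorem eig_dim {V : Type} [AddCommGroup V] [Module ℂ V] [FiniteDimensional ℂ V] (A : V →ₗ[ℂ] V)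
    {N : ℕ} (hN : 0 < N) (hA : A ^ N = 1) {x : ℂ} (hx : x ^ N = 1) :
    (Module.finrank ℂ (Module.End.eigenspace A x) : ℂ) =
      (N : ℂ)⁻¹ * ∑ i ∈ Finset.range N, (x⁻¹) ^ i * LinearMap.trace ℂ V (A ^ i) := by
  have hx0 : x ≠ 0 := by rintro rfl; rw [zero_pow hN.ne'] at hx; exact zero_ne_one hx
  have hN0 : (N : ℂ) ≠ 0 := by exact_mod_cast hN.ne'
  let P : V →ₗ[ℂ] V := (N : ℂ)⁻¹ • ∑ i ∈ Finset.range N, (x⁻¹) ^ i • A ^ i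
  have hPa : ∀ v, P v = (N : ℂ)⁻¹ • ∑ i ∈ Finset.range N, (x⁻¹) ^ i • (A ^ i) v := by
    intro v; simp [P, LinearMap.sum_apply]
  have hproj : LinearMap.IsProj (Module.End.eigenspace A x) P := by
    constructor
    · intro v
      rw [Module.End.mem_eigenspace_iff, hPa, map_smul, smul_comm]
      congr 1
      rw [map_sum, Finset.smul_sum]
      have h1 := Finset.sum_range_succ (fun i => x • ((x⁻¹) ^ i • (A ^ i) v)) N
      have h2 := Finset.sum_range_succ' (fun i => x • ((x⁻¹) ^ i • (A ^ i) v)) N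
      rw [h1] at h2
      have h3 : x • ((x⁻¹) ^ N • (A ^ N) v) = x • ((x⁻¹) ^ 0 • (A ^ 0) v) := by
        rw [hA, inv_pow, hx]; simp
      rw [h3] at h2
      rw [add_right_cancel h2]
      refine Finset.sum_congr rfl fun i _ => ?_
      rw [map_smul, smul_smul, pow_succ' (x⁻¹), mul_inv_cancel_left₀ hx0, pow_succ' A]; rfl
    · intro v hv
      rw [Module.End.mem_eigenspace_iff] at hv
      have hp : ∀ i, (A ^ i) v = x ^ i • v := by
        intro i
        induction i with
        | zero => simp
        | succ i ih => rw [pow_succ' A, Module.End.mul_apply, ih, map_smul, hv, smul_smul, pow_succ]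
      rw [hPa, Finset.sum_congr rfl (g := fun _ => v)]
      · rw [Finset.sum_const, Finset.card_range, ← Nat.cast_smul_eq_nsmul ℂ, smul_smul,
          inv_mul_cancel₀ hN0, one_smul]
      · intro i _
        rw [hp, smul_smul, ← mul_pow, inv_mul_cancel₀ hx0, one_pow, one_smul]
  rw [← hproj.trace]
  simp [P]

/-- Fourier inversion: trace through multiplicities -/
theorem eig_trace {V : Type} [AddCommGroup V] [Module ℂ V] [FiniteDimensional ℂ V] (A : V →ₗ[ℂ] V)
    {N : ℕ} (hN : 0 < N) (hA : A ^ N = 1) {ζ : ℂ} (hζ : IsPrimitiveRoot ζ N) {j : ℕ} (hj : j < N) :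
    LinearMap.trace ℂ V (A ^ j) =
      ∑ a ∈ Finset.range N, (ζ ^ a) ^ j * (Module.finrank ℂ (Module.End.eigenspace A (ζ ^ a)) : ℂ) := by
  have hN0 : (N : ℂ) ≠ 0 := by exact_mod_cast hN.ne'
  have h1 : ∀ a ∈ Finset.range N, (ζ ^ a) ^ j * (Module.finrank ℂ (Module.End.eigenspace A (ζ ^ a)) : ℂ)
      = (N : ℂ)⁻¹ * ∑ i ∈ Finset.range N, ((ζ ^ a) ^ j * ((ζ ^ a)⁻¹) ^ i) * LinearMap.trace ℂ V (A ^ i) := by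
    intro a _
    rw [eig_dim A hN hA (by rw [← pow_mul, mul_comm, pow_mul, hζ.pow_eq_one, one_pow])]
    rw [mul_left_comm, Finset.mul_sum]
    congr 1
    refine Finset.sum_congr rfl fun i _ => ?_
    ring
  rw [Finset.sum_congr rfl h1, ← Finset.mul_sum, Finset.sum_comm]
  have h2 : ∀ i ∈ Finset.range N, ∑ a ∈ Finset.range N, ((ζ ^ a) ^ j * ((ζ ^ a)⁻¹) ^ i) * LinearMap.trace ℂ V (A ^ i)
      = if i = j then (N : ℂ) * LinearMap.trace ℂ V (A ^ j) else 0 := by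
    intro i hi
    rw [← Finset.sum_mul, root_sum hN hζ (Finset.mem_range.1 hi) hj]
    split_ifs with h
    · rw [h]
    · rw [zero_mul]
  rw [Finset.sum_congr rfl h2, Finset.sum_ite_eq' , if_pos (Finset.mem_range.2 hj), inv_mul_cancel_left₀ hN0]

/-- symmetric traces: an odd dimensional space has an odd eigenspace for 1 or -1 -/
theorem sym_odd {V : Type} [AddCommGroup V] [Module ℂ V] [FiniteDimensional ℂ V] (A : V →ₗ[ℂ] V)
    {N : ℕ} (hN : 0 < N) (hA : A ^ N = 1)
    (hsym : ∀ i < N, LinearMap.trace ℂ V (A ^ i) = LinearMap.trace ℂ V (A ^ (N - i)))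
    (hodd : Odd (Module.finrank ℂ V)) : ∃ l : ℂ, l ^ 2 = 1 ∧ Odd (Module.finrank ℂ (Module.End.eigenspace A l)) := by
  obtain ⟨ζ, hζ⟩ : ∃ ζ : ℂ, IsPrimitiveRoot ζ N := ⟨_, Complex.isPrimitiveRoot_exp N hN.ne'⟩
  have hz0 : ζ ≠ 0 := hζ.ne_zero hN.ne'
  set m : ℕ → ℕ := fun a => Module.finrank ℂ (Module.End.eigenspace A (ζ ^ a)) with hm
  have hdim : Module.finrank ℂ V = ∑ a ∈ Finset.range N, m a := by
    have h := eig_trace A hN hA hζ hN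
    simp only [pow_zero, one_mul] at h
    have h2 : LinearMap.trace ℂ V 1 = Module.finrank ℂ V := LinearMap.trace_one ℂ V
    rw [h2] at h
    exact_mod_cast h
  have hinv : ∀ x : ℂ, x ^ N = 1 → Module.finrank ℂ (Module.End.eigenspace A x) =
      Module.finrank ℂ (Module.End.eigenspace A x⁻¹) := by
    intro x hx
    have hx0 : x ≠ 0 := by rintro rfl; rw [zero_pow hN.ne'] at hx; exact zero_ne_one hx
    have h1 := eig_dim A hN hA hx
    have h2 := eig_dim A hN hA (x := x⁻¹) (by rw [inv_pow, hx, inv_one])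
    have h3 : ∑ i ∈ Finset.range N, (x⁻¹) ^ i * LinearMap.trace ℂ V (A ^ i) =
        ∑ i ∈ Finset.range N, (x⁻¹⁻¹) ^ i * LinearMap.trace ℂ V (A ^ i) := by
      obtain ⟨N', rfl⟩ : ∃ N', N = N' + 1 := ⟨N - 1, by omega⟩
      rw [Finset.sum_range_succ', Finset.sum_range_succ' (fun i => (x⁻¹⁻¹) ^ i * LinearMap.trace ℂ V (A ^ i))]
      congr 1
      · rw [← Finset.sum_range_reflect]
        refine Finset.sum_congr rfl fun i hi => ?_
        have hi' := Finset.mem_range.1 hi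
        have e1 : N' - 1 - i + 1 = N' - i := by omega
        have e2 : N' + 1 - (i + 1) = N' - i := by omega
        rw [e1, hsym (i+1) (by omega), e2, inv_inv]
        congr 1
        have h4 : x ^ (N' - i) * x ^ (i + 1) = 1 := by
          rw [← pow_add, show N' - i + (i + 1) = N' + 1 by omega, hx]
        rw [inv_pow]
        exact inv_eq_of_mul_eq_one_right h4
    rw [h3, ← h2] at h1
    exact_mod_cast h1
  by_contra hcon
  push Not at hcon
  have hev : ∀ l : ℂ, l ^ 2 = 1 → Even (Module.finrank ℂ (Module.End.eigenspace A l)) :=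
    fun l hl => Nat.not_odd_iff_even.1 (hcon l hl)
  have key : ((Module.finrank ℂ V : ℕ) : ZMod 2) = 0 := by
    rw [hdim, Nat.cast_sum]
    refine Finset.sum_involution (fun a _ => if a = 0 then 0 else N - a) ?_ ?_ ?_ ?_
    · intro a ha
      have ha' := Finset.mem_range.1 ha
      have h5 : m (if a = 0 then 0 else N - a) = m a := by
        split_ifs with h
        · rw [h]
        · simp only [hm]
          rw [hinv (ζ ^ a) (by rw [← pow_mul, mul_comm, pow_mul, hζ.pow_eq_one, one_pow])]
          have : ζ ^ (N - a) = (ζ ^ a)⁻¹ := by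
            apply eq_inv_of_mul_eq_one_left
            rw [← pow_add, show N - a + a = N by omega, hζ.pow_eq_one]
          rw [this]
      rw [h5]
      exact CharTwo.add_self_eq_zero _
    · intro a ha hne heq
      apply hne
      have ha' := Finset.mem_range.1 ha
      have h6 : (ζ ^ a) ^ 2 = 1 := by
        by_cases h : a = 0
        · rw [h]; simp
        · rw [if_neg h] at heq
          rw [← pow_mul, show a * 2 = N by omega, hζ.pow_eq_one]
      obtain ⟨k, hk⟩ := hev _ h6
      simp only [hm]
      rw [hk, Nat.cast_add]
      exact CharTwo.add_self_eq_zero _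
    · intro a ha
      have ha' := Finset.mem_range.1 ha
      rw [Finset.mem_range]
      split_ifs <;> omega
    · intro a ha
      have ha' := Finset.mem_range.1 ha
      by_cases h : a = 0
      · simp [h]
      · have : N - a ≠ 0 := by omega
        simp only [h, this, if_false]
        omega
  rw [ZMod.natCast_eq_zero_iff_even] at key
  exact (Nat.not_even_iff_odd.2 hodd) key

/-- equal traces of an element of 2-power order -/
theorem parity {V V' : Type} [AddCommGroup V] [Module ℂ V] [FiniteDimensional ℂ V]
    [AddCommGroup V'] [Module ℂ V'] [FiniteDimensional ℂ V'] (A : V →ₗ[ℂ] V) (A' : V' →ₗ[ℂ] V') {s : ℕ}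
    (hA : A ^ (2 ^ s) = 1) (hA' : A' ^ (2 ^ s) = 1)
    (h : LinearMap.trace ℂ V A = LinearMap.trace ℂ V' A') :
    Odd (Module.finrank ℂ V) ↔ Odd (Module.finrank ℂ V') := by
  -- enlarge the exponent
  have hB : A ^ (2 ^ (s+1)) = 1 := by rw [pow_succ, pow_mul, hA, one_pow]
  have hB' : A' ^ (2 ^ (s+1)) = 1 := by rw [pow_succ, pow_mul, hA', one_pow]
  set N := 2 ^ (s+1) with hNdef
  have hN : 1 < N := Nat.one_lt_two_pow (by omega)
  obtain ⟨ζ, hζ⟩ : ∃ ζ : ℂ, IsPrimitiveRoot ζ N := ⟨_, Complex.isPrimitiveRoot_exp N (by omega)⟩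
  set m : ℕ → ℕ := fun a => Module.finrank ℂ (Module.End.eigenspace A (ζ ^ a)) with hm
  set m' : ℕ → ℕ := fun a => Module.finrank ℂ (Module.End.eigenspace A' (ζ ^ a)) with hm'
  have hdim : Module.finrank ℂ V = ∑ a ∈ Finset.range N, m a := by
    have h := eig_trace A (by omega) hB hζ (show 0 < N by omega)
    simp only [pow_zero, one_mul] at h
    have h2 : LinearMap.trace ℂ V 1 = Module.finrank ℂ V := LinearMap.trace_one ℂ V
    rw [h2] at h
    exact_mod_cast h
  have hdim' : Module.finrank ℂ V' = ∑ a ∈ Finset.range N, m' a := by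
    have h := eig_trace A' (by omega) hB' hζ (show 0 < N by omega)
    simp only [pow_zero, one_mul] at h
    have h2 : LinearMap.trace ℂ V' 1 = Module.finrank ℂ V' := LinearMap.trace_one ℂ V'
    rw [h2] at h
    exact_mod_cast h
  have ht := eig_trace A (by omega) hB hζ (show 1 < N by omega)
  have ht' := eig_trace A' (by omega) hB' hζ (show 1 < N by omega)
  simp only [pow_one] at ht ht'
  rw [ht, ht'] at h
  let P : Polynomial ℤ := ∑ a ∈ Finset.range N, Polynomial.C ((m a : ℤ) - m' a) * Polynomial.X ^ a
  have hP : Polynomial.aeval ζ P = 0 := by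
    simp only [P, map_sum, map_mul, Polynomial.aeval_X, map_pow, Polynomial.aeval_C, map_sub]
    rw [← sub_eq_zero, ← Finset.sum_sub_distrib] at h
    rw [← h]
    refine Finset.sum_congr rfl fun a _ => ?_
    simp only [hm, hm', map_natCast]
    ring
  have hdvd : Polynomial.cyclotomic N ℤ ∣ P := by
    rw [Polynomial.cyclotomic_eq_minpoly hζ (by omega)]
    exact minpoly.isIntegrallyClosed_dvd (hζ.isIntegral (by omega)) hP
  obtain ⟨Q, hQ⟩ := hdvd
  have h1 := congrArg (Polynomial.eval 1) hQ
  rw [Polynomial.eval_mul] at h1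
  have : Fact (Nat.Prime 2) := ⟨Nat.prime_two⟩
  have h2 : Polynomial.eval 1 (Polynomial.cyclotomic N ℤ) = 2 := by
    rw [hNdef]
    have := Polynomial.eval_one_cyclotomic_prime_pow (R := ℤ) (p := 2) s
    simp at this ⊢
  have h3 : Polynomial.eval 1 P = (Module.finrank ℂ V : ℤ) - Module.finrank ℂ V' := by
    rw [hdim, hdim']
    simp [P, Polynomial.eval_finsetSum, Finset.sum_sub_distrib]
  rw [h2, h3] at h1
  rw [Nat.odd_iff, Nat.odd_iff]
  omega

end LinAlg

end SpP


namespace SpP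

set_option linter.unusedSectionVars false
set_option linter.unusedVariables false
set_option linter.unusedSimpArgs false

section TrGen

variable {X : Type} [AddCommGroup X] [Module ℂ X] [FiniteDimensional ℂ X]
variable {G : Type} [Group G] [Fintype G] {ρ : Representation ℂ G X}

theorem rho_comp (g h : G) : ρ g ∘ₗ ρ h = ρ (g * h) := by
  rw [map_mul]; rfl

open Classical in
theorem avg_def (K : Subgroup G) : avg ρ K = (Nat.card K : ℂ)⁻¹ •
    ∑ g ∈ Finset.univ.filter (fun g : G => g ∈ K), (ρ g : X →ₗ[ℂ] X) := rfl

theorem comp_fsum {ι : Type} (A : X →ₗ[ℂ] X) (s : Finset ι) (f : ι → (X →ₗ[ℂ] X)) :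
    A ∘ₗ (∑ i ∈ s, f i) = ∑ i ∈ s, A ∘ₗ f i := by
  ext x; simp [LinearMap.sum_apply]

theorem tr_avg {K : Subgroup G} {g : G} (hgK : ∀ k ∈ K, g⁻¹ * k * g ∈ K)
    (hC : ∀ k ∈ K, g * k = k * g → k = 1) {Y : Submodule ℂ X} (hY : Stab ρ K Y)
    (hgY : ∀ y ∈ Y, ρ g y ∈ Y) : trOn Y (ρ g ∘ₗ avg ρ K) = trOn Y (ρ g) := by
  classical
  let φ : K → K := fun k => ⟨g⁻¹ * (k : G)⁻¹ * g * k, K.mul_mem (hgK _ (K.inv_mem k.2)) k.2⟩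
  have hinj : Function.Injective φ := by
    intro k1 k2 h
    have h1 : g⁻¹ * (k1 : G)⁻¹ * g * k1 = g⁻¹ * (k2 : G)⁻¹ * g * k2 := congrArg Subtype.val h
    have h2 : g * ((k2 : G) * (k1 : G)⁻¹)⁻¹ = ((k2 : G) * (k1 : G)⁻¹)⁻¹ * g := by
      have h3 : (k1 : G)⁻¹ * g * k1 = (k2 : G)⁻¹ * g * k2 := by
        have := congrArg (fun x => g * x) h1
        simpa [mul_assoc] using this
      have h4 := congrArg (fun x => (k1 : G) * x * (k2 : G)⁻¹) h3
      simp only [mul_assoc, mul_inv_cancel, mul_one, mul_inv_cancel_left, mul_inv_rev, inv_inv] at h4 ⊢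
      exact h4
    have h5 := hC _ (K.inv_mem (K.mul_mem k2.2 (K.inv_mem k1.2))) h2
    rw [inv_eq_one, mul_inv_eq_one] at h5
    exact (Subtype.ext h5).symm
  have hsurj : Function.Surjective φ := Finite.surjective_of_injective hinj
  have hterm : ∀ k ∈ K, trOn Y (ρ (g * k)) = trOn Y (ρ g) := by
    intro k hk
    obtain ⟨k', hk'⟩ := hsurj ⟨k, hk⟩
    have h1 : g⁻¹ * (k' : G)⁻¹ * g * k' = k := congrArg Subtype.val hk'
    have h2 : g * k = (k' : G)⁻¹ * (g * k') := by rw [← h1]; group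
    rw [h2, ← rho_comp, trOn_comm (hY _ (K.inv_mem k'.2)), rho_comp]
    · rw [mul_assoc, mul_inv_cancel, mul_one]
    · intro y hy
      rw [rho_mul]; exact hgY _ (hY _ k'.2 y hy)
  rw [avg_def, LinearMap.comp_smul, map_smul, comp_fsum, map_sum]
  rw [Finset.sum_congr rfl (g := fun _ => trOn Y (ρ g))]
  · rw [Finset.sum_const, card_filter_sub, ← Nat.cast_smul_eq_nsmul ℂ, smul_smul,
      inv_mul_cancel₀ (card_sub_ne K), one_smul]
  · intro k hk
    rw [rho_comp]
    exact hterm k (Finset.mem_filter.1 hk).2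

theorem tr_fix {K : Subgroup G} {g : G} (hgK : ∀ k ∈ K, g⁻¹ * k * g ∈ K)
    (hC : ∀ k ∈ K, g * k = k * g → k = 1) {Y : Submodule ℂ X} (hY : Stab ρ K Y)
    (hgY : ∀ y ∈ Y, ρ g y ∈ Y) : trOn (Y ⊓ fix ρ K) (ρ g) = trOn Y (ρ g) := by
  rw [← tr_avg hgK hC hY hgY, trOn_sub (Z := Y ⊓ fix ρ K) inf_le_left]
  · apply trOn_congr
    intro y hy
    rw [LinearMap.comp_apply, avg_of_fix hy.2]
  · intro y hy
    exact ⟨hgY _ (avg_mem hY hy), fix_normalizes hgK (avg_mem_fix _ _ _)⟩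

theorem restrict_pow_val {Y : Submodule ℂ X} {A : X →ₗ[ℂ] X} (hA : ∀ y ∈ Y, A y ∈ Y) (m : ℕ) (y : Y) :
    (((A.restrict hA) ^ m) y : X) = (A ^ m) (y : X) := by
  induction m with
  | zero => simp
  | succ m ih => rw [pow_succ', pow_succ', Module.End.mul_apply, Module.End.mul_apply, ← ih]; rfl

theorem rho_restrict_pow {Y : Submodule ℂ X} {g : G} (hA : ∀ y ∈ Y, ρ g y ∈ Y) {N : ℕ} (hN : g ^ N = 1) :
    ((ρ g : X →ₗ[ℂ] X).restrict hA) ^ N = 1 := by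
  ext y
  rw [restrict_pow_val, ← map_pow, hN, map_one]; rfl

theorem parity_fix {K : Subgroup G} {g : G} (hgK : ∀ k ∈ K, g⁻¹ * k * g ∈ K)
    (hC : ∀ k ∈ K, g * k = k * g → k = 1) {Y : Submodule ℂ X} (hY : Stab ρ K Y)
    (hgY : ∀ y ∈ Y, ρ g y ∈ Y) {s : ℕ} (hs : g ^ (2 ^ s) = 1) :
    Odd (Module.finrank ℂ Y) ↔ Odd (Module.finrank ℂ (Y ⊓ fix ρ K : Submodule ℂ X)) := by
  have hgY' : ∀ y ∈ Y ⊓ fix ρ K, ρ g y ∈ Y ⊓ fix ρ K :=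
    fun y hy => ⟨hgY y hy.1, fix_normalizes hgK hy.2⟩
  apply parity ((ρ g : X →ₗ[ℂ] X).restrict hgY) ((ρ g : X →ₗ[ℂ] X).restrict hgY')
    (rho_restrict_pow hgY hs) (rho_restrict_pow hgY' hs)
  rw [← trOn_eq, ← trOn_eq, tr_fix hgK hC hY hgY]

theorem eig_restrict {M : Submodule ℂ X} {A : X →ₗ[ℂ] X} (hA : ∀ y ∈ M, A y ∈ M) (l : ℂ) :
    Module.finrank ℂ (Module.End.eigenspace (A.restrict hA) l) =
      Module.finrank ℂ (M ⊓ Module.End.eigenspace A l : Submodule ℂ X) := by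
  have key : (Module.End.eigenspace (A.restrict hA) l).map M.subtype = M ⊓ Module.End.eigenspace A l := by
   ext x
   constructor
   · rintro ⟨y, hy, rfl⟩
     rw [SetLike.mem_coe, Module.End.mem_eigenspace_iff] at hy
     refine ⟨y.2, ?_⟩
     rw [SetLike.mem_coe, Module.End.mem_eigenspace_iff]
     exact congrArg Subtype.val hy
   · rintro ⟨hx, hxe⟩
     rw [SetLike.mem_coe, Module.End.mem_eigenspace_iff] at hxe
     refine ⟨⟨x, hx⟩, ?_, rfl⟩
     rw [SetLike.mem_coe, Module.End.mem_eigenspace_iff]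
     exact Subtype.ext hxe
  rw [← key, Submodule.finrank_map_subtype_eq]

theorem sym_sub {M : Submodule ℂ X} {h : G} {N : ℕ} (hN : 0 < N) (hh : h ^ N = 1)
    (hM : ∀ y ∈ M, ρ h y ∈ M)
    (hsym : ∀ i < N, trOn M (ρ (h ^ i)) = trOn M (ρ (h ^ (N - i))))
    (hodd : Odd (Module.finrank ℂ M)) :
    ∃ l : ℂ, l ^ 2 = 1 ∧ Odd (Module.finrank ℂ (M ⊓ Module.End.eigenspace (ρ h) l : Submodule ℂ X)) := by
  have hMp : ∀ i, ∀ y ∈ M, ρ (h ^ i) y ∈ M := by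
    intro i
    induction i with
    | zero => intro y hy; rw [pow_zero, rho_one]; exact hy
    | succ i ih => intro y hy; rw [pow_succ', rho_mul]; exact hM _ (ih y hy)
  have htr : ∀ i, LinearMap.trace ℂ M (((ρ h : X →ₗ[ℂ] X).restrict hM) ^ i) = trOn M (ρ (h ^ i)) := by
    intro i
    rw [trOn_eq (hMp i)]
    congr 1
    ext y
    rw [restrict_pow_val, ← map_pow]; rfl
  obtain ⟨l, hl, hl'⟩ := sym_odd ((ρ h : X →ₗ[ℂ] X).restrict hM) hN (rho_restrict_pow hM hh)
    (by intro i hi; rw [htr, htr, hsym i hi]) hodd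
  exact ⟨l, hl, by rwa [← eig_restrict hM]⟩

end TrGen

section SymSec

variable {n : ℕ} {F : Type} [Field F] [Fintype F]
variable {X : Type} [AddCommGroup X] [Module ℂ X] [FiniteDimensional ℂ X]
variable {ρ : Representation ℂ (GT n F) X} {ν : Fˣ}

theorem uu_triv {i : ℕ} : (uu i 0 0 : GT n F) = 1 := by
  apply gt_ext
  intro x
  rw [uu_smul (by simp)]; simp

theorem hu_cent {i : ℕ} (hi : i < n) {a : Fˣ} (ha : a * a ≠ 1) {u : GT n F} (hu : u ∈ Gk i)
    (hu' : ∀ w ∈ (Wk i : Submodule F (W n F)), (a : F) • u • w = w → w = 0)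
    {k : GT n F} (hk : k ∈ U i) (hc : (hh i a * u) * k = k * (hh i a * u)) : k = 1 := by
  obtain ⟨w, hw, b, rfl⟩ := U_exists hi hk
  have h1 := congrArg (fun g : GT n F => g • (f i : W n F)) hc
  simp only [mul_smul] at h1
  have huw := smul_mem_Wk hu hw
  rw [uu_f hi hw, Gk_f hu, hh_f hi, smul_lin, uu_f hi hw, smul_add, smul_add, smul_add, smul_add,
    smul_lin, smul_lin, Gk_f hu, Gk_e hu, hh_f hi, hh_e hi, hh_Wk hi a huw] at h1
  have ha0 : (a : F) ≠ 0 := a.ne_zero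
  have hb : b = 0 := by
    have h2 := congrArg (fun z => B z (f i : W n F)) h1
    simp [B_ff, B_ef hi, Wk_f hw, Wk_f huw] at h2
    have h3 : b * ((a : F) * a - 1) = 0 := by
      field_simp at h2
      linear_combination h2
    rcases mul_eq_zero.1 h3 with h | h
    · exact h
    · exfalso; apply ha
      apply Units.ext
      simpa using sub_eq_zero.1 h
  rw [hb] at h1 ⊢
  have hw0 : w = 0 := by
    apply hu' w hw
    have h4 : u • w = ((a⁻¹ : Fˣ) : F) • w := by
      simpa using h1
    rw [h4, smul_smul, Units.mul_inv, one_smul]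
  rw [hw0, uu_triv]

theorem hh_norm {i : ℕ} (hi : i < n) (a : Fˣ) {u : GT n F} (hu : u ∈ Gk i) {k : GT n F} (hk : k ∈ U i) :
    (hh i a * u)⁻¹ * k * (hh i a * u) ∈ U i := by
  have h : (hh i a * u)⁻¹ * k * (hh i a * u) = u⁻¹ * ((hh i a)⁻¹ * k * hh i a) * u := by group
  rw [h]
  exact U_conj_Gk' hu (U_conj_hh' hi a hk)

theorem sym_aux {i : ℕ} (hi : i < n) {Y : Submodule ℂ X} (hY : Stab ρ (Gk (i+1)) Y)
    {K : Subgroup (GT n F)} (hK : K ≤ Gk i)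
    (hKu : ∀ u ∈ K, ∀ a : Fˣ, a ≠ 1 → ∀ w ∈ (Wk i : Submodule F (W n F)), (a : F) • u • w = w → w = 0)
    (a : Fˣ) (ha : a * a ≠ 1) : trOn (Y ⊓ fix ρ (U i) ⊓ fix ρ K) (ρ (hh i a)) =
      trOn Y (ρ (hh i a) ∘ₗ avg ρ K) := by
  classical
  have hK1 : K ≤ Gk (i+1) := hK.trans (Gk_mono (Nat.le_succ i))
  have ha1 : a ≠ 1 := by rintro rfl; simp at ha
  have h1 : trOn (Y ⊓ fix ρ (U i) ⊓ fix ρ K) (ρ (hh i a)) =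
      trOn (Y ⊓ fix ρ (U i) ⊓ fix ρ K) (ρ (hh i a) ∘ₗ avg ρ (U i) ∘ₗ avg ρ K) := by
    apply trOn_congr
    intro y hy
    rw [LinearMap.comp_apply, LinearMap.comp_apply, avg_of_fix hy.2, avg_of_fix hy.1.2]
  rw [h1, ← trOn_sub (Y := Y) (inf_le_left.trans inf_le_left)]
  · rw [avg_def (ρ := ρ) K, LinearMap.comp_smul, LinearMap.comp_smul, map_smul, LinearMap.comp_smul, map_smul]
    congr 1
    rw [comp_fsum, comp_fsum, comp_fsum, map_sum, map_sum]
    refine Finset.sum_congr rfl fun u hu => ?_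
    have hu' := (Finset.mem_filter.1 hu).2
    have h2 : ρ (hh i a) ∘ₗ avg ρ (U i) ∘ₗ ρ u = ρ (hh i a * u) ∘ₗ avg ρ (U i) := by
      ext x
      simp only [LinearMap.comp_apply]
      rw [rho_mul, rho_avg (g := u) (fun h hh => U_conj_Gk (hK hu') hh) (fun h hh => U_conj_Gk' (hK hu') hh)]
    rw [h2, rho_comp, tr_avg]
    · intro k hk; exact hh_norm hi a (hK hu') hk
    · intro k hk hc
      exact hu_cent hi ha (hK hu') (hKu u hu' a ha1) hk hc
    · exact hY.mono (U_le i)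
    · exact hY _ (Subgroup.mul_mem _ (hh_mem hi a) (hK1 hu'))
  · intro y hy
    simp only [LinearMap.comp_apply]
    refine ⟨⟨?_, ?_⟩, ?_⟩
    · exact hY _ (hh_mem hi a) _ (avg_mem (hY.mono (U_le i)) (avg_mem (hY.mono hK1) hy))
    · exact fix_hh hi a (avg_mem_fix _ _ _)
    · intro u hu
      rw [← hh_rho_comm hi a (hK hu), rho_avg (g := u) (fun h hh => U_conj_Gk (hK hu) hh)
        (fun h hh => U_conj_Gk' (hK hu) hh), avg_mem_fix ρ K _ u hu]

theorem sym_tr {i : ℕ} (hi : i < n) {Y : Submodule ℂ X} (hY : Stab ρ (Gk (i+1)) Y)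
    {K : Subgroup (GT n F)} (hK : K ≤ Gk i)
    (hKu : ∀ u ∈ K, ∀ a : Fˣ, a ≠ 1 → ∀ w ∈ (Wk i : Submodule F (W n F)), (a : F) • u • w = w → w = 0)
    (a : Fˣ) : trOn (Y ⊓ fix ρ (U i) ⊓ fix ρ K) (ρ (hh i a)) =
      trOn (Y ⊓ fix ρ (U i) ⊓ fix ρ K) (ρ (hh i a⁻¹)) := by
  classical
  by_cases ha : a * a = 1
  · rw [show a⁻¹ = a from inv_eq_of_mul_eq_one_left ha]
  · have ha' : a⁻¹ * a⁻¹ ≠ 1 := by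
      intro h; apply ha
      rw [← mul_inv, inv_eq_one] at h; exact h
    rw [sym_aux hi hY hK hKu a ha, sym_aux hi hY hK hKu a⁻¹ ha']
    rw [avg_def, LinearMap.comp_smul, LinearMap.comp_smul, map_smul, map_smul]
    congr 1
    rw [comp_fsum, comp_fsum, map_sum, map_sum]
    refine Finset.sum_congr rfl fun u hu => ?_
    have hu' := (Finset.mem_filter.1 hu).2
    have hK1 : K ≤ Gk (i+1) := hK.trans (Gk_mono (Nat.le_succ i))
    rw [rho_comp, rho_comp]
    have h1 : hh i a * u = (ww i)⁻¹ * (hh i a⁻¹ * u * ww i : GT n F) := by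
      rw [mul_assoc, ww_comm hi (hK hu'), ← mul_assoc (hh i a⁻¹), ← ww_hh hi]
      group
    rw [h1, ← rho_comp, trOn_comm, rho_comp]
    · rw [mul_assoc, mul_inv_cancel, mul_one]
    · exact hY _ (Subgroup.inv_mem _ (ww_mem hi))
    · exact hY _ (Subgroup.mul_mem _ (Subgroup.mul_mem _ (hh_mem hi _) (hK1 hu')) (ww_mem hi))

theorem sym_cor {i : ℕ} (hi : i < n) (ν : Fˣ) {Y : Submodule ℂ X} (hY : Stab ρ (Gk (i+1)) Y)
    {K : Subgroup (GT n F)} (hK : K ≤ Gk i)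
    (hKu : ∀ u ∈ K, ∀ a : Fˣ, a ≠ 1 → ∀ w ∈ (Wk i : Submodule F (W n F)), (a : F) • u • w = w → w = 0)
    (hodd : Odd (Module.finrank ℂ (Y ⊓ fix ρ (U i) ⊓ fix ρ K : Submodule ℂ X))) :
    ∃ l : ℂ, l ^ 2 = 1 ∧ Odd (Module.finrank ℂ (Y ⊓ fix ρ (U i) ⊓ fix ρ K ⊓
      Module.End.eigenspace (ρ (hh i ν)) l : Submodule ℂ X)) := by
  have hN : ν ^ Fintype.card Fˣ = 1 := pow_card_eq_one
  refine sym_sub (N := Fintype.card Fˣ) Fintype.card_pos ?_ ?_ ?_ hodd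
  · rw [← hh_pow hi, hN, hh_one hi]
  · intro y hy
    refine ⟨⟨hY _ (hh_mem hi ν) y hy.1.1, fix_hh hi ν hy.1.2⟩, ?_⟩
    intro u hu
    rw [← hh_rho_comm hi ν (hK hu), hy.2 u hu]
  · intro m hm
    rw [← hh_pow hi, ← hh_pow hi, sym_tr hi hY hK hKu]
    congr 3
    apply inv_eq_of_mul_eq_one_right
    rw [← pow_add, show m + (Fintype.card Fˣ - m) = Fintype.card Fˣ by omega, hN]

theorem bot_unip {i : ℕ} : ∀ u ∈ (⊥ : Subgroup (GT n F)), ∀ a : Fˣ, a ≠ 1 →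
    ∀ w ∈ (Wk i : Submodule F (W n F)), (a : F) • u • w = w → w = 0 := by
  intro u hu a ha w hw h
  rw [Subgroup.mem_bot] at hu
  rw [hu, one_smul] at h
  have h1 : ((a : F) - 1) • w = 0 := by rw [sub_smul, h, one_smul, sub_self]
  rcases smul_eq_zero.1 h1 with h2 | h2
  · exfalso; apply ha; apply Units.ext; simpa using sub_eq_zero.1 h2
  · exact h2

theorem U_unip {j : ℕ} (hj : j + 1 < n) : ∀ u ∈ (U j : Subgroup (GT n F)), ∀ a : Fˣ, a ≠ 1 →
    ∀ w ∈ (Wk (j+1) : Submodule F (W n F)), (a : F) • u • w = w → w = 0 := by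
  intro u hu a ha w hw h
  have ha1 : (a : F) - 1 ≠ 0 := by
    intro h2; apply ha; apply Units.ext; simpa using sub_eq_zero.1 h2
  have hsc : ∀ x : F, (a : F) * x = x → x = 0 := by
    intro x hx
    have : ((a : F) - 1) * x = 0 := by linear_combination hx
    exact (mul_eq_zero.1 this).resolve_left ha1
  have hue := (mem_U.1 hu).2.1
  have h1 : B w (e j) = 0 := by
    apply hsc
    have h2 : B (u • w) (e j) = B w (e j) := by
      have := B_smul u w (e j)
      rwa [hue] at this
    have h3 := congrArg (fun z => B z (e j : W n F)) h
    simp only [map_smul, LinearMap.smul_apply, smul_eq_mul] at h3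
    rw [h2] at h3
    exact h3
  obtain ⟨w', hw', hww⟩ := Wk_decomp (by omega : j < n) hw
  rw [h1, zero_smul, sub_zero] at hww
  obtain ⟨c, hc⟩ := (mem_U.1 hu).2.2 w' hw'
  set x := B w (f j) with hx
  have h4 : u • w = w + c • e j := by
    rw [hww, smul_add, smul_lin, hue, hc]; abel
  rw [h4] at h
  have h5 : w' = 0 := by
    have h6 : ((a : F) - 1) • w' = (-((a : F) * x + a * c - x)) • (e j : W n F) := by
      rw [hww] at h
      rw [← sub_eq_zero] at h ⊢
      rw [← h]; module
    have h7 : ((a : F) * x + a * c - x) = 0 := by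
      have := congrArg (fun z => B z (f j : W n F)) h6
      simp [Wk_f hw', B_ef (by omega : j < n)] at this
      linear_combination this
    rw [h7, neg_zero, zero_smul] at h6
    exact (smul_eq_zero.1 h6).resolve_left ha1
  have hw2 : w = x • e j := by rw [hww, h5, add_zero]
  have h8 : u • w = w := by rw [hw2, smul_lin, hue]
  rw [← h4, h8] at h
  have h9 : ((a : F) - 1) • w = 0 := by rw [sub_smul, h, one_smul, sub_self]
  exact (smul_eq_zero.1 h9).resolve_left ha1

end SymSec

end SpP


namespace SpP

set_option linter.unusedSectionVars false
set_option linter.unusedVariables false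
set_option linter.unusedSimpArgs false

section GamSec

variable {n : ℕ} {F : Type} [Field F] 

/-- elements of the Levi subgroup acting through a rotation-like matrix -/
structure Gam (j : ℕ) (g : GT n F) (c d s : F) : Prop where
  mem : g ∈ Gk (j+2)
  ei : g • (e (j+1) : W n F) = c • e (j+1) + d • e j
  ej : g • (e j : W n F) = (-d) • e (j+1) + c • e j
  fi : g • (f (j+1) : W n F) = (s * c) • f (j+1) + (s * d) • f j
  fj : g • (f j : W n F) = (-(s * d)) • f (j+1) + (s * c) • f j
  wk : ∀ x ∈ (Wk j : Submodule F (W n F)), g • x = x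

theorem Gam.mul {j : ℕ} {g g' : GT n F} {c d s c' d' s' : F} (h : Gam j g c d s)
    (h' : Gam j g' c' d' s') : Gam j (g * g') (c * c' - d * d') (c * d' + d * c') (s * s') where
  mem := mul_mem h.mem h'.mem
  ei := by rw [mul_smul, h'.ei, smul_add, smul_lin, smul_lin, h.ei, h.ej]; module
  ej := by rw [mul_smul, h'.ej, smul_add, smul_lin, smul_lin, h.ei, h.ej]; module
  fi := by rw [mul_smul, h'.fi, smul_add, smul_lin, smul_lin, h.fi, h.fj]; module
  fj := by rw [mul_smul, h'.fj, smul_add, smul_lin, smul_lin, h.fi, h.fj]; module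
  wk := by intro x hx; rw [mul_smul, h'.wk x hx, h.wk x hx]

theorem Gam.one {j : ℕ} : Gam j (1 : GT n F) 1 0 1 := by
  constructor
  · exact one_mem _
  all_goals simp

theorem Gam.pow {j : ℕ} {g : GT n F} {c d s : F} (h : Gam j g c d s) (hs : c ^ 2 + d ^ 2 = s) (m : ℕ) :
    ∃ c' d' : F, Gam j (g ^ m) c' d' (s ^ m) ∧ c' ^ 2 + d' ^ 2 = s ^ m := by
  induction m with
  | zero => exact ⟨1, 0, by simpa using Gam.one, by simp⟩
  | succ m ih =>
    obtain ⟨c', d', h1, h2⟩ := ih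
    refine ⟨c' * c - d' * d, c' * d + d' * c, ?_, ?_⟩
    · rw [pow_succ, pow_succ]; exact h1.mul h
    · rw [pow_succ s m, ← h2]; linear_combination (c' ^ 2 + d' ^ 2) * hs

theorem Gam.exists {j : ℕ} (hj : j + 1 < n) {c d : F} (hs : c ^ 2 + d ^ 2 = -1) :
    ∃ g : GT n F, Gam j g c d (-1) := by
  have h1 : j ≠ j + 1 := by omega
  have h2 : j < n := by omega
  let φ : W n F →ₗ[F] W n F := LinearMap.id + rk (f (j+1)) ((c - 1) • e (j+1) + d • e j)
    + rk (f j) ((-d) • e (j+1) + (c - 1) • e j)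
    - rk (e (j+1)) ((-c - 1) • f (j+1) + (-d) • f j) - rk (e j) (d • f (j+1) + (-c - 1) • f j)
  have hφ : ∀ x y, B (φ x) (φ y) = B x y := by
    intro x y
    simp only [φ, LinearMap.sub_apply, LinearMap.add_apply, LinearMap.id_apply, LinearMap.smul_apply,
      rk_apply, map_add, map_smul, map_sub, smul_eq_mul, B_self, B_ee, B_ff, B_ef hj, B_fe hj,
      B_ef h2, B_fe h2, B_ef_ne h1, B_ef_ne h1.symm, B_fe_ne h1, B_fe_ne h1.symm]
    rw [B_swap (f j) y, B_swap (e j) y, B_swap (f (j+1)) y, B_swap (e (j+1)) y]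
    linear_combination (B x (f (j+1)) * B y (e (j+1)) - B x (e (j+1)) * B y (f (j+1)) + B x (f j) * B y (e j) - B x (e j) * B y (f j)) * hs
  have hg : ∀ x : W n F, mkG φ • x = x + B x (f (j+1)) • ((c - 1) • e (j+1) + d • e j)
    + B x (f j) • ((-d) • e (j+1) + (c - 1) • e j)
    - B x (e (j+1)) • ((-c - 1) • f (j+1) + (-d) • f j) - B x (e j) • (d • f (j+1) + (-c - 1) • f j) := by
    intro x; rw [mkG_smul hφ]; rfl
  refine ⟨mkG φ, ?_, ?_, ?_, ?_, ?_, ?_⟩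
  · intro l hl
    have a1 : l ≠ j + 1 := by omega
    have a2 : l ≠ j := by omega
    rw [hg, hg]
    simp [B_ee, B_ff, B_ef_ne a1, B_ef_ne a2, B_fe_ne a1, B_fe_ne a2]
  · rw [hg]; simp only [B_ee, B_ff, B_ef hj, B_fe hj,
      B_ef h2, B_fe h2, B_ef_ne h1, B_ef_ne h1.symm, B_fe_ne h1, B_fe_ne h1.symm]; module
  · rw [hg]; simp only [B_ee, B_ff, B_ef hj, B_fe hj,
      B_ef h2, B_fe h2, B_ef_ne h1, B_ef_ne h1.symm, B_fe_ne h1, B_fe_ne h1.symm]; module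
  · rw [hg]; simp only [B_ee, B_ff, B_ef hj, B_fe hj,
      B_ef h2, B_fe h2, B_ef_ne h1, B_ef_ne h1.symm, B_fe_ne h1, B_fe_ne h1.symm]; module
  · rw [hg]; simp only [B_ee, B_ff, B_ef hj, B_fe hj,
      B_ef h2, B_fe h2, B_ef_ne h1, B_ef_ne h1.symm, B_fe_ne h1, B_fe_ne h1.symm]; module
  · intro x hx
    rw [hg, Wk_e hx, Wk_f hx, Wk_e (Wk_mono (Nat.le_succ j) hx), Wk_f (Wk_mono (Nat.le_succ j) hx)]
    simp

theorem Gam.norm {j : ℕ} {g : GT n F} {c d : F} (h : Gam j g c d (-1))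
    (hs : c ^ 2 + d ^ 2 = -1) {k : GT n F} (hk : k ∈ QQ j) : g⁻¹ * k * g ∈ QQ j := by
  obtain ⟨k1, k2, k3, k4⟩ := mem_QQ.1 hk
  have i1 : g⁻¹ • (e (j+1) : W n F) = (-c) • e (j+1) + d • e j := by
    rw [inv_smul_eq_iff, smul_add, smul_lin, smul_lin, h.ei, h.ej]
    have : (1 : F) = -(c ^ 2 + d ^ 2) := by rw [hs]; ring
    calc (e (j+1) : W n F) = (1 : F) • e (j+1) := by simp
      _ = _ := by rw [this]; module
  have i2 : g⁻¹ • (e j : W n F) = (-d) • e (j+1) + (-c) • e j := by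
    rw [inv_smul_eq_iff, smul_add, smul_lin, smul_lin, h.ei, h.ej]
    have : (1 : F) = -(c ^ 2 + d ^ 2) := by rw [hs]; ring
    calc (e j : W n F) = (1 : F) • e j := by simp
      _ = _ := by rw [this]; module
  refine mem_QQ.2 ⟨mul_mem (mul_mem (inv_mem h.mem) k1) h.mem, ?_, ?_, ?_⟩
  · rw [mul_smul, mul_smul, inv_smul_eq_iff, h.ei, smul_add, smul_lin, smul_lin, k2, k3]
  · rw [mul_smul, mul_smul, inv_smul_eq_iff, h.ej, smul_add, smul_lin, smul_lin, k2, k3]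
  · intro x hx
    obtain ⟨a, b, hab⟩ := k4 x hx
    refine ⟨-(a * c) - b * d, a * d - b * c, ?_⟩
    have hx' : g⁻¹ • x = x := by rw [inv_smul_eq_iff, h.wk x hx]
    rw [mul_smul, mul_smul, h.wk x hx, hab, smul_add, smul_add, smul_lin, smul_lin, i1, i2, hx']
    module

theorem span_form {j : ℕ} (hj : j + 1 < n) {x : W n F} (hx : x ∈ (Wk (j+2) : Submodule F (W n F)))
    (hw : ∀ w ∈ (Wk j : Submodule F (W n F)), B x w = 0) :
    x = B x (f (j+1)) • e (j+1) - B x (e (j+1)) • f (j+1) + (B x (f j) • e j - B x (e j) • f j) := by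
  have h1 : j ≠ j + 1 := by omega
  obtain ⟨x', hx', h⟩ := Wk_decomp hj hx
  obtain ⟨x'', hx'', h'⟩ := Wk_decomp (by omega : j < n) hx'
  have e1 : B x (f j) = B x' (f j) := by
    rw [h]; simp [B_ff, B_ef_ne h1.symm]
  have e2 : B x (e j) = B x' (e j) := by
    rw [h]; simp [B_ee, B_fe_ne h1.symm]
  have h0 : x'' = 0 := by
    by_contra hne
    obtain ⟨y, hy, hBy⟩ := Wk_nondeg hx'' hne
    apply hBy
    have := hw y hy
    rw [h, h'] at this
    have hy' := Wk_mono (Nat.le_succ j) hy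
    simpa [B_swap (e j) y, B_swap (f j) y, B_swap (e (j+1)) y, B_swap (f (j+1)) y,
      Wk_e hy, Wk_f hy, Wk_e hy', Wk_f hy'] using this
  rw [h0, add_zero] at h'
  rw [e1, e2, ← h', ← h]

theorem Gam.cent {j : ℕ} (hj : j + 1 < n) {g : GT n F} {c d : F} (h : Gam j g c d (-1))
    (hs : c ^ 2 + d ^ 2 = -1) (hc : 2 * c ≠ 0) {k : GT n F} (hk : k ∈ QQ j)
    (hgk : g * k = k * g) : k = 1 := by
  have h1 : j ≠ j + 1 := by omega
  have h2 : j < n := by omega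
  obtain ⟨k1, k2, k3, k4⟩ := mem_QQ.1 hk
  have comm : ∀ x : W n F, g • k • x = k • g • x := by
    intro x; rw [← mul_smul, hgk, mul_smul]
  have kW : ∀ x ∈ (Wk j : Submodule F (W n F)), k • x = x := by
    intro x hx
    obtain ⟨a, b, hab⟩ := k4 x hx
    have h3 := comm x
    rw [h.wk x hx, hab, smul_add, smul_add, smul_lin, smul_lin, h.wk x hx, h.ei, h.ej] at h3
    have h4 := congrArg (fun z => B z (f (j+1) : W n F)) h3
    have h5 := congrArg (fun z => B z (f j : W n F)) h3
    have hx' := Wk_mono (Nat.le_succ j) hx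
    simp [B_ef hj, B_ef h2, B_ef_ne h1, B_ef_ne h1.symm, Wk_f hx, Wk_f hx'] at h4 h5
    have ha : a * (2 * c) = 0 := by linear_combination (-1) * (c - 1) * h4 - d * h5 + a * hs
    have hb : b * (2 * c) = 0 := by linear_combination (-1) * (c - 1) * h5 + d * h4 + b * hs
    rw [hab, (mul_eq_zero.1 ha).resolve_right hc, (mul_eq_zero.1 hb).resolve_right hc]
    simp
  have pair : ∀ x y : W n F, k • y = y → B (k • x) y = B x y := by
    intro x y hy
    have := B_smul k x y
    rwa [hy] at this
  have hfi := span_form hj (smul_mem_Wk k1 (f_mem_Wk (by omega : j + 1 < j + 2)))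
    (fun w hw => by
      have hw' := Wk_mono (Nat.le_succ j) hw
      rw [pair _ _ (kW w hw), B_swap, Wk_f hw', neg_zero])
  have hfj := span_form hj (smul_mem_Wk k1 (f_mem_Wk (by omega : j < j + 2)))
    (fun w hw => by
      rw [pair _ _ (kW w hw), B_swap, Wk_f hw, neg_zero])
  rw [pair _ _ k2, pair _ _ k3, B_fe hj, B_fe_ne h1.symm] at hfi
  rw [pair _ _ k2, pair _ _ k3, B_fe h2, B_fe_ne h1] at hfj
  generalize B (k • (f (j+1) : W n F)) (f (j+1)) = x at hfi
  generalize B (k • (f (j+1) : W n F)) (f j) = y at hfi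
  generalize B (k • (f j : W n F)) (f (j+1)) = y' at hfj
  generalize B (k • (f j : W n F)) (f j) = z at hfj
  have hyy : y = y' := by
    have := B_smul k (f (j+1)) (f j)
    rw [hfi, hfj] at this
    simp [B_ee, B_ff, B_ef hj, B_fe hj,
      B_ef h2, B_fe h2, B_ef_ne h1, B_ef_ne h1.symm, B_fe_ne h1, B_fe_ne h1.symm] at this
    linear_combination this
  subst hyy
  have e1 := comm (f (j+1))
  have e2 := comm (f j)
  rw [h.fi, smul_add, smul_lin, smul_lin, hfi, hfj] at e1
  rw [h.fj, smul_add, smul_lin, smul_lin, hfi, hfj] at e2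
  simp only [smul_add, smul_sub, smul_lin, h.ei, h.ej, h.fi, h.fj] at e1 e2
  have e11 := congrArg (fun z => B z (f (j+1) : W n F)) e1
  have e12 := congrArg (fun z => B z (f j : W n F)) e1
  have e22 := congrArg (fun z => B z (f j : W n F)) e2
  simp [B_ff, B_ef hj, B_ef h2, B_ef_ne h1, B_ef_ne h1.symm] at e11 e12 e22
  have hx : x * (2 * c) = 0 := by linear_combination e11
  have hz : z * (2 * c) = 0 := by linear_combination e22
  have hx' := (mul_eq_zero.1 hx).resolve_right hc
  have hz' := (mul_eq_zero.1 hz).resolve_right hc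
  have hy : y * (2 * c) = 0 := by rw [hx', hz'] at e12; linear_combination e12
  have hy' := (mul_eq_zero.1 hy).resolve_right hc
  subst hx' hz' hy'
  apply Gk_ext2 hj k1 (one_mem _)
  · rw [k2, one_smul]
  · rw [hfi, one_smul]; simp
  · rw [k3, one_smul]
  · rw [hfj, one_smul]; simp
  · intro x hx; rw [kW x hx, one_smul]

end GamSec

section GamPar

variable {n : ℕ} {F : Type} [Field F] [Fintype F]
variable {X : Type} [AddCommGroup X] [Module ℂ X] [FiniteDimensional ℂ X]
variable {ρ : Representation ℂ (GT n F) X} {ν : Fˣ}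

theorem gam_two {j : ℕ} (hj : j + 1 < n) (h2 : (2 : F) ≠ 0) :
    ∃ (g : GT n F) (c d : F) (s : ℕ), Gam j g c d (-1) ∧ c ^ 2 + d ^ 2 = -1 ∧ 2 * c ≠ 0 ∧ g ^ 2 ^ s = 1 := by
  by_cases hsq : ∃ ι : F, ι ^ 2 = -1
  · obtain ⟨ι, hι⟩ := hsq
    have hι0 : ι ≠ 0 := by rintro rfl; norm_num at hι
    obtain ⟨g, hg⟩ := Gam.exists hj (c := ι) (d := 0) (by rw [hι]; ring)
    refine ⟨g, ι, 0, 2, hg, by rw [hι]; ring, mul_ne_zero h2 hι0, ?_⟩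
    have g2 := hg.mul hg
    have g4 := g2.mul g2
    have hgg : g ^ 2 ^ 2 = g * g * (g * g) := by norm_num [pow_succ, mul_assoc]
    rw [hgg]
    have c1 : (ι * ι - 0 * 0) = -1 := by linear_combination hι
    rw [c1] at g4
    apply Gk_ext2 hj g4.mem (one_mem _)
    · rw [g4.ei, one_smul]; simp
    · rw [g4.fi, one_smul]; simp
    · rw [g4.ej, one_smul]; simp
    · rw [g4.fj, one_smul]; simp
    · intro x hx; rw [g4.wk x hx, one_smul]
  · push Not at hsq
    obtain ⟨p, hp⟩ := CharP.exists F
    have : NeZero p := ⟨(CharP.char_is_prime F p).ne_zero⟩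
    obtain ⟨a, b, hab⟩ := CharP.sq_add_sq F p (-1)
    obtain ⟨g, hg⟩ := Gam.exists hj (c := (a : F)) (d := (b : F)) (by rw [hab]; simp)
    obtain ⟨s, m, hm, hsm⟩ := Nat.exists_eq_two_pow_mul_odd (orderOf_pos g).ne'
    obtain ⟨c, d, h1, h3⟩ := hg.pow (by rw [hab]; simp) m
    rw [hm.neg_one_pow] at h1 h3
    refine ⟨g ^ m, c, d, s, h1, h3, mul_ne_zero h2 ?_, ?_⟩
    · rintro rfl
      exact hsq d (by rw [← h3]; ring)
    · rw [← pow_mul, mul_comm, ← hsm, pow_orderOf_eq_one]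

/-- root subgroup -/
def XA (j : ℕ) : Subgroup (GT n F) where
  carrier := {g | ∃ c : F, g = xa j c}
  mul_mem' := by
    rintro _ _ ⟨c, rfl⟩ ⟨d, rfl⟩
    exact ⟨c + d, xa_add c d⟩
  one_mem' := ⟨0, xa_zero.symm⟩
  inv_mem' := by
    rintro _ ⟨c, rfl⟩
    exact ⟨-c, xa_inv c⟩

theorem hneg_xa {j : ℕ} (hj : j + 1 < n) (c : F) :
    (hh (j+1) (-1) : GT n F) * xa j c = xa j (-c) * hh (j+1) (-1) := by
  have h1 : j ≠ j + 1 := by omega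
  apply gt_ext
  intro x
  rw [mul_smul, mul_smul, hh_smul hj, hh_smul hj, xa_smul, xa_smul]
  simp [B_ee, B_ff, B_ef hj, B_fe hj, B_ef_ne h1, B_ef_ne h1.symm, B_fe_ne h1, B_fe_ne h1.symm]
  module

theorem par_QU {j : ℕ} (hj : j + 1 < n) (h2 : (2 : F) ≠ 0) {Y : Submodule ℂ X}
    (hY : Stab ρ (Gk (j+2)) Y) : Odd (Module.finrank ℂ Y) ↔
      Odd (Module.finrank ℂ (Y ⊓ fix ρ (U (j+1)) ⊓ fix ρ (U j) : Submodule ℂ X)) := by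
  obtain ⟨g, c, d, s, hg, hs, hc, hgs⟩ := gam_two hj h2
  have hQ : (QQ j : Subgroup (GT n F)) ≤ Gk (j+2) := fun k hk => (mem_QQ.1 hk).1
  rw [parity_fix (K := QQ j) (fun k hk => hg.norm hs hk) (fun k hk => hg.cent hj hs hc hk)
    (hY.mono hQ) (fun y hy => hY g hg.mem y hy) hgs]
  have hxG : ∀ c : F, (xa j c : GT n F) ∈ Gk (j+2) := fun c => (U_le _) (xa_mem c)
  have hstab : Stab ρ (XA j) (Y ⊓ fix ρ (QQ j)) := by
    rintro _ ⟨c, rfl⟩ y hy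
    refine ⟨hY _ (hxG c) y hy.1, fix_normalizes (fun k hk => QQ_xa hj hk c) hy.2⟩
  have hhQ : ∀ k ∈ (QQ j : Subgroup (GT n F)), (hh (j+1) (-1))⁻¹ * k * hh (j+1) (-1) ∈ QQ j := by
    intro k hk
    obtain ⟨k1, k2, k3, k4⟩ := mem_QQ.1 hk
    have hi : (hh (j+1) (-1) : GT n F)⁻¹ = hh (j+1) (-1) := by rw [hh_inv hj]; simp
    rw [hi]
    have hej : (hh (j+1) (-1) : GT n F) • (e j : W n F) = e j := hh_Wk hj _ (e_mem_Wk (by omega))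
    refine mem_QQ.2 ⟨mul_mem (mul_mem (hh_mem hj _) k1) (hh_mem hj _), ?_, ?_, ?_⟩
    · rw [mul_smul, mul_smul, hh_e hj, smul_lin, k2, smul_lin, hh_e hj]; simp
    · rw [mul_smul, mul_smul, hej, k3, hej]
    · intro x hx
      have hx' := Wk_mono (Nat.le_succ j) hx
      obtain ⟨a, b, hab⟩ := k4 x hx
      refine ⟨-a, b, ?_⟩
      rw [mul_smul, mul_smul, hh_Wk hj _ hx', hab, smul_add, smul_add, smul_lin, smul_lin, hh_e hj, hej,
        hh_Wk hj _ hx']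
      simp
  rw [parity_fix (K := XA j) (g := hh (j+1) (-1)) (s := 1) ?_ ?_ hstab ?_ ?_]
  · have : Y ⊓ fix ρ (QQ j) ⊓ fix ρ (XA j) = Y ⊓ fix ρ (U (j+1)) ⊓ fix ρ (U j) := by
      apply le_antisymm
      · rintro y ⟨⟨h1, h3⟩, h4⟩
        refine ⟨⟨h1, ?_⟩, fix_mono U_le_QQ h3⟩
        apply mem_fix.2
        intro u hu
        obtain ⟨c, hc⟩ := U_shift hj hu
        obtain ⟨v, hv, huv⟩ := hc 0
        have h5 : u = xa j c * v := by rw [xa_zero, mul_one, add_zero] at huv; exact huv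
        rw [h5, rho_mul, mem_fix.1 h3 v hv, mem_fix.1 h4 _ ⟨c, rfl⟩]
      · rintro y ⟨⟨h1, h3⟩, h4⟩
        refine ⟨⟨h1, ?_⟩, ?_⟩
        · apply mem_fix.2; intro g hg; exact MM_QQ hj ⟨h3, h4⟩ hg
        · apply mem_fix.2; rintro _ ⟨c, rfl⟩
          exact mem_fix.1 h3 _ (xa_mem c)
    rw [this]
  · rintro _ ⟨c, rfl⟩
    refine ⟨-c, ?_⟩
    rw [mul_assoc, inv_mul_eq_iff_eq_mul, hneg_xa hj, neg_neg]
  · rintro _ ⟨c, rfl⟩ hcm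
    rw [hneg_xa hj] at hcm
    have h3 := congrArg (fun g : GT n F => B (g • (e j : W n F)) (f (j+1))) (mul_right_cancel hcm)
    simp [xa_e (by omega : j < n), B_ef hj, B_ef_ne (by omega : j ≠ j + 1)] at h3
    have h4 : c * 2 = 0 := by linear_combination -h3
    rw [(mul_eq_zero.1 h4).resolve_right h2, xa_zero]
  · intro y hy
    exact ⟨hY _ (hh_mem hj _) y hy.1, fix_normalizes hhQ hy.2⟩
  · rw [pow_one, ← hh_pow hj]; simp [hh_one hj]

end GamPar

end SpP


namespace SpP

set_option linter.unusedSectionVars false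
set_option linter.unusedVariables false
set_option linter.unusedSimpArgs false

section RankOne

variable {n : ℕ} {F : Type} [Field F] [Fintype F]
variable {X : Type} [AddCommGroup X] [Module ℂ X] [FiniteDimensional ℂ X]
variable {ρ : Representation ℂ (GT n F) X} {ν : Fˣ}

theorem Wk1_mem (x s : F) : x • (e 0 : W n F) + s • f 0 ∈ (Wk 1 : Submodule F (W n F)) :=
  add_mem (Submodule.smul_mem _ _ (e_mem_Wk (by omega))) (Submodule.smul_mem _ _ (f_mem_Wk (by omega)))

theorem Wk1_form (hn : 0 < n) {v : W n F} (hv : v ∈ (Wk 1 : Submodule F (W n F))) :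
    v = B v (f 0) • e 0 + (-B v (e 0)) • f 0 := by
  obtain ⟨x', hx', h⟩ := Wk_decomp hn hv
  rw [Wk_zero hx', add_zero] at h
  conv_lhs => rw [h]
  module

open Classical in
theorem sum_Wk1 {A : Type} [AddCommMonoid A] (hn : 0 < n) (φ : W n F → A) :
    ∑ v ∈ Finset.univ.filter (fun v : W n F => v ∈ (Wk 1 : Submodule F (W n F))), φ v =
      ∑ s : F, ∑ x : F, φ (x • e 0 + s • f 0) := by
  rw [← Finset.sum_product']
  symm
  refine Finset.sum_nbij' (fun p : F × F => p.2 • (e 0 : W n F) + p.1 • f 0)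
    (fun v => (-B v (e 0), B v (f 0))) ?_ ?_ ?_ ?_ ?_
  · intro p _; simpa using Wk1_mem p.2 p.1
  · intro v _; simp
  · intro p _; simp [B_ee, B_ff, B_ef hn, B_fe hn]
  · intro v hv
    simp only [Finset.mem_filter, Finset.mem_univ, true_and] at hv
    exact (Wk1_form hn hv).symm
  · intro p _; rfl

theorem U0_form (hn : 0 < n) {u : GT n F} (hu : u ∈ U 0) : ∃ b : F, u = tv b (e 0) := by
  obtain ⟨w, hw, b, rfl⟩ := U_exists hn hu
  refine ⟨-b, ?_⟩
  rw [Wk_zero hw]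
  apply gt_ext
  intro x
  rw [uu_smul (by simp), tv_smul]
  simp only [map_zero, zero_smul, sub_zero, zero_add]
  module

theorem tv_fc (hn : 0 < n) (c : Fˣ) :
    (tv (c : F) (f 0) : GT n F) = tv (-((c⁻¹ : Fˣ) : F)) (e 0) * (ww 0 * hh 0 c) * tv (-((c⁻¹ : Fˣ) : F)) (e 0) := by
  have hc : (c : F) ≠ 0 := c.ne_zero
  apply gt_ext
  intro x
  simp only [mul_smul, tv_smul, ww_smul hn, hh_smul hn]
  simp [B_ee, B_ff, B_ef hn, B_fe hn]
  match_scalars <;> field_simp <;> ring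

theorem trOn_conj {H : Subgroup (GT n F)} {Y : Submodule ℂ X} (hY : Stab ρ H Y) {g h : GT n F}
    (hg : g ∈ H) (hh : h ∈ H) : trOn Y (ρ (g * h * g⁻¹)) = trOn Y (ρ h) := by
  have : trOn Y ((ρ g : X →ₗ[ℂ] X) ∘ₗ ρ (h * g⁻¹)) = trOn Y (ρ (h * g⁻¹) ∘ₗ ρ g) :=
    trOn_comm (fun y hy => hY g hg y hy) (fun y hy => hY _ (mul_mem hh (inv_mem hg)) y hy)
  rw [rho_comp, rho_comp] at this
  rw [mul_assoc, this, inv_mul_cancel_right]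

/-- root group sums -/
noncomputable def RR (ρ : Representation ℂ (GT n F) X) (v : W n F) : X →ₗ[ℂ] X := ∑ b : F, ρ (tv b v)

theorem RR_apply (v : W n F) (y : X) : RR ρ v y = ∑ b : F, ρ (tv b v) y := by
  unfold RR; rw [LinearMap.sum_apply]

theorem RR_conj (g : GT n F) (v : W n F) (y : X) : RR ρ (g • v) (ρ g y) = ρ g (RR ρ v y) := by
  rw [RR_apply, RR_apply, map_sum]
  apply Finset.sum_congr rfl
  intro b _
  rw [← rho_mul, ← rho_mul, tv_conj]

theorem tr_tv_conj {Y : Submodule ℂ X} (hY : Stab ρ (Gk 1) Y) (b : F) {v w : W n F}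
    (hv : v ∈ (Wk 1 : Submodule F (W n F))) (hv0 : v ≠ 0)
    (hw : w ∈ (Wk 1 : Submodule F (W n F))) (hw0 : w ≠ 0) :
    trOn Y (ρ (tv b v)) = trOn Y (ρ (tv b w)) := by
  obtain ⟨g, hg, rfl⟩ := Gk_trans hv hv0 hw hw0
  have : tv b (g • v) = g * tv b v * g⁻¹ := by rw [tv_conj, mul_inv_cancel_right]
  rw [this, trOn_conj hY hg (tv_mem_Gk b hv)]

theorem RR_e_fix (hn : 0 < n) {y : X} (hy : y ∈ fix ρ (U 0)) : RR ρ (e 0 : W n F) y = (Fintype.card F : ℂ) • y := by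
  rw [RR_apply, Finset.sum_congr rfl (fun b _ => mem_fix.1 hy _ (tve_mem b))]
  simp [Nat.cast_smul_eq_nsmul]

theorem RR_e_mem (hn : 0 < n) (y : X) : RR ρ (e 0 : W n F) y ∈ fix ρ (U 0) := by
  rw [mem_fix]
  intro u hu
  obtain ⟨c, rfl⟩ := U0_form hn hu
  rw [RR_apply, map_sum]
  rw [← Equiv.sum_comp (Equiv.addLeft c) (fun b => ρ (tv b (e 0 : W n F)) y)]
  apply Finset.sum_congr rfl
  intro b _
  rw [← rho_mul, tv_add]; rfl

theorem tr_RR (hn : 0 < n) {Y : Submodule ℂ X} (hY : Stab ρ (Gk 1) Y) {v : W n F}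
    (hv : v ∈ (Wk 1 : Submodule F (W n F))) (hv0 : v ≠ 0) :
    trOn Y (RR ρ v) = Fintype.card F * Module.finrank ℂ (Y ⊓ fix ρ (U 0) : Submodule ℂ X) := by
  have he0 : (e 0 : W n F) ≠ 0 := by
    intro h
    have := B_ef (F := F) hn
    rw [h] at this; simp at this
  have h1 : trOn Y (RR ρ v) = trOn Y (RR ρ (e 0 : W n F)) := by
    unfold RR
    rw [map_sum, map_sum]
    exact Finset.sum_congr rfl (fun b _ => tr_tv_conj hY b hv hv0 (e_mem_Wk (by omega)) he0)
  rw [h1, trOn_sub (inf_le_left : Y ⊓ fix ρ (U 0) ≤ Y), trOn_scalar (c := (Fintype.card F : ℂ))]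
  · intro y hy; exact RR_e_fix hn hy.2
  · intro y hy
    refine ⟨?_, RR_e_mem hn y⟩
    rw [RR_apply]
    exact Submodule.sum_mem _ (fun b _ => hY _ (tv_mem_Gk b (e_mem_Wk (by omega))) y hy)

open Classical in
/-- central sum -/
noncomputable def ZZ (ρ : Representation ℂ (GT n F) X) : X →ₗ[ℂ] X :=
  ∑ v ∈ Finset.univ.filter (fun v : W n F => v ∈ (Wk 1 : Submodule F (W n F))), RR ρ v

open Classical in
theorem ZZ_comm {g : GT n F} (hg : g ∈ Gk 1) (y : X) : ZZ ρ (ρ g y) = ρ g (ZZ ρ y) := by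
  unfold ZZ
  rw [LinearMap.sum_apply, LinearMap.sum_apply, map_sum]
  symm
  refine Finset.sum_nbij' (fun v => g • v) (fun v => g⁻¹ • v) ?_ ?_ ?_ ?_ ?_
  · intro v hv
    simp only [Finset.mem_filter, Finset.mem_univ, true_and] at hv ⊢
    exact smul_mem_Wk hg hv
  · intro v hv
    simp only [Finset.mem_filter, Finset.mem_univ, true_and] at hv ⊢
    exact smul_mem_Wk (inv_mem hg) hv
  · intro v _; simp
  · intro v _; simp
  · intro v _; exact (RR_conj g v y).symm

theorem E_RR (hn : 0 < n) {y : X} (hy : y ∈ fix ρ (U 0)) (h0 : ∑ a : Fˣ, ρ (hh 0 a) y = 0)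
    (s x : F) (hs : s ≠ 0) : E ρ 0 (RR ρ (x • (e 0 : W n F) + s • f 0) y) = y := by
  set v : W n F := x • (e 0 : W n F) + s • f 0 with hv
  obtain ⟨u, hu, huv⟩ := U_trans hn (Wk1_mem (n := n) x s) hs (by simp [B_ee, B_fe hn])
  rw [RR_apply, sum_units, tv_zero, rho_one, map_add, E_fix hy, map_sum]
  have key : ∀ b : Fˣ, E ρ 0 (ρ (tv (b : F) v) y) =
      E ρ 0 (ρ (ww 0) (ρ (hh 0 (b * (Units.mk0 s hs * Units.mk0 s hs))) y)) := by
    intro b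
    have h1 : tv (b : F) v = u * tv (b : F) (s • f 0) * u⁻¹ := by
      rw [tv_conj, huv, mul_inv_cancel_right]
    have h2 : (b : F) * s ^ 2 = ((b * (Units.mk0 s hs * Units.mk0 s hs) : Fˣ) : F) := by
      simp [sq]
    rw [h1, tv_scale, h2, tv_fc hn]
    simp only [rho_mul]
    rw [mem_fix.1 hy _ (inv_mem hu), mem_fix.1 hy _ (tve_mem _), E_U hu, E_U (tve_mem _)]
  have h3 : ∑ b : Fˣ, ρ (hh 0 (b * (Units.mk0 s hs * Units.mk0 s hs))) y = ∑ a : Fˣ, ρ (hh 0 a) y :=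
    Fintype.sum_equiv (Equiv.mulRight (Units.mk0 s hs * Units.mk0 s hs)) _ _ (fun b => rfl)
  rw [Finset.sum_congr rfl (fun b _ => key b), ← map_sum, ← map_sum, h3, h0]
  simp

theorem ZZ_fix (hn : 0 < n) {y : X} (hy : y ∈ fix ρ (U 0)) (h0 : ∑ a : Fˣ, ρ (hh 0 a) y = 0) :
    E ρ 0 (ZZ ρ y) = (2 * (Fintype.card F : ℂ) ^ 2 - Fintype.card F) • y := by
  classical
  unfold ZZ
  rw [LinearMap.sum_apply, sum_Wk1 hn (fun v => RR ρ v y), sum_units, map_add, map_sum]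
  have h1 : ∀ x : F, E ρ 0 (RR ρ (x • (e 0 : W n F) + (0 : F) • f 0) y) = (Fintype.card F : ℂ) • y := by
    intro x
    rw [zero_smul, add_zero, RR_apply]
    simp only [tv_scale]
    rw [Finset.sum_congr rfl (fun b _ => mem_fix.1 hy _ (tve_mem _)), map_sum, E_fix hy]
    simp [Nat.cast_smul_eq_nsmul]
  have h2 : E ρ 0 (∑ c : Fˣ, ∑ x : F, RR ρ (x • (e 0 : W n F) + (c : F) • f 0) y) =
      ∑ c : Fˣ, ∑ x : F, y := by
    rw [map_sum]
    apply Finset.sum_congr rfl; intro c _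
    rw [map_sum]
    apply Finset.sum_congr rfl; intro x _
    exact E_RR hn hy h0 c x c.ne_zero
  rw [Finset.sum_congr rfl (fun x _ => h1 x), h2]
  have h3 : (Fintype.card Fˣ : ℂ) = (Fintype.card F : ℂ) - 1 := by
    have := sum_units (F := F) (fun _ => (1 : ℂ))
    simp at this
    rw [this]; ring
  simp only [Finset.sum_const, Finset.card_univ, ← Nat.cast_smul_eq_nsmul ℂ, smul_smul, h3]
  rw [← add_smul]
  congr 1
  ring

theorem rank_one_dim (hn : 0 < n) {Y : Submodule ℂ X} (hY : Irr ρ (Gk 1) Y)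
    (hne : Y ⊓ fix ρ (U 0) ≠ ⊥)
    (h1 : ∀ y ∈ Y, y ∈ fix ρ (U 0) → (∀ a : Fˣ, ρ (hh 0 a) y = y) → y = 0) :
    2 * Module.finrank ℂ Y = (Fintype.card F + 1) *
      Module.finrank ℂ (Y ⊓ fix ρ (U 0) : Submodule ℂ X) := by
  classical
  have hZY : ∀ y ∈ Y, ZZ ρ y ∈ Y := by
    intro y hy
    unfold ZZ
    rw [LinearMap.sum_apply]
    refine Submodule.sum_mem _ (fun v hv => ?_)
    rw [RR_apply]
    refine Submodule.sum_mem _ (fun b _ => hY.1 _ (tv_mem_Gk b ?_) y hy)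
    simpa using hv
  obtain ⟨c, hc⟩ := schur hY (ZZ ρ) hZY (fun g hg y _ => ZZ_comm hg y)
  obtain ⟨y, hy, hy0⟩ := Submodule.exists_mem_ne_zero_of_ne_bot hne
  have hs : ∑ a : Fˣ, ρ (hh 0 a) y = 0 := by
    apply h1
    · exact Submodule.sum_mem _ (fun a _ => hY.1 _ (hh_mem hn a) y hy.1)
    · exact Submodule.sum_mem _ (fun a _ => fix_hh hn a hy.2)
    · intro a
      rw [map_sum]
      refine Fintype.sum_equiv (Equiv.mulLeft a) _ _ (fun b => ?_)
      rw [← rho_mul, ← hh_mul hn]; rfl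
  have h2 := ZZ_fix hn hy.2 hs
  rw [hc y hy.1, map_smul, E_fix hy.2] at h2
  have hcv : c = 2 * (Fintype.card F : ℂ) ^ 2 - Fintype.card F := by
    have h3 : (c - (2 * (Fintype.card F : ℂ) ^ 2 - Fintype.card F)) • y = 0 := by
      rw [sub_smul, h2, sub_self]
    exact sub_eq_zero.1 ((smul_eq_zero.1 h3).resolve_right hy0)
  set q : ℂ := (Fintype.card F : ℂ) with hq
  set κ := Module.finrank ℂ (Y ⊓ fix ρ (U 0) : Submodule ℂ X) with hκ
  have ht := trOn_scalar hc
  have ht2 : trOn Y (ZZ ρ) = q * Module.finrank ℂ Y + (q ^ 2 - 1) * (q * κ) := by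
    unfold ZZ
    rw [map_sum]
    have hz : (0 : W n F) ∈ Finset.univ.filter (fun v : W n F => v ∈ (Wk 1 : Submodule F (W n F))) := by
      simp
    have hcard : ((Finset.univ.filter (fun v : W n F => v ∈ (Wk 1 : Submodule F (W n F)))).card : ℂ) = q ^ 2 := by
      have := sum_Wk1 (F := F) hn (fun _ => (1 : ℂ))
      simp at this
      rw [this]; ring
    rw [← Finset.add_sum_erase _ _ hz]
    congr 1
    · apply trOn_scalar
      intro y _
      rw [RR_apply]
      simp [tv_zero', Nat.cast_smul_eq_nsmul, hq]
    · rw [Finset.sum_congr rfl (fun v hv => tr_RR hn hY.1 (by simpa using (Finset.mem_erase.1 hv).2)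
        (Finset.mem_erase.1 hv).1), Finset.sum_const, Finset.card_erase_of_mem hz, nsmul_eq_mul,
        Nat.cast_sub (Finset.card_pos.2 ⟨_, hz⟩), hcard, Nat.cast_one]
  rw [ht2, hcv] at ht
  have hq0 : q ≠ 0 := qne
  have hq1 : q - 1 ≠ 0 := by
    intro h
    have : (Fintype.card F : ℂ) = 1 := by rw [← hq]; linear_combination h
    have h4 : Fintype.card F = 1 := by exact_mod_cast this
    have := Fintype.one_lt_card (α := F)
    omega
  have h5 : (2 * Module.finrank ℂ Y : ℂ) = (q + 1) * κ := by
    apply mul_left_cancel₀ (mul_ne_zero hq0 hq1)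
    linear_combination -ht
  rw [hq] at h5
  exact_mod_cast h5

end RankOne

section GoodSec

variable {n : ℕ} {F : Type} [Field F] [Fintype F]
variable {X : Type} [AddCommGroup X] [Module ℂ X] [FiniteDimensional ℂ X]

/-- good modules -/
def Good (ρ : Representation ℂ (GT n F) X) (ν : Fˣ) : ℕ → Submodule ℂ X → Prop
  | 0, Y => Module.finrank ℂ Y = 1
  | k + 1, Y => Irr ρ (Gk (k+1)) Y ∧
      ((k = 0 ∧ Y ⊓ fix ρ (U 0) = ⊥ ∧ Odd (Module.finrank ℂ Y)) ∨
        ∃ A ≤ Y ⊓ fix ρ (U k), ∃ l : ℂ, l ^ 2 = 1 ∧ (∀ a ∈ A, ρ (hh k ν) a = l • a) ∧ Good ρ ν k A)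

variable {ρ : Representation ℂ (GT n F) X} {ν : Fˣ}

theorem fix_bot : fix ρ (⊥ : Subgroup (GT n F)) = ⊤ := by
  apply le_antisymm le_top
  intro x _
  apply mem_fix.2
  intro g hg
  rw [Subgroup.mem_bot.1 hg, rho_one]

theorem exists_line {Y : Submodule ℂ X} (hY : Y ≠ ⊥) : ∃ L ≤ Y, Module.finrank ℂ L = 1 := by
  obtain ⟨y, hy, hy0⟩ := Submodule.exists_mem_ne_zero_of_ne_bot hY
  exact ⟨ℂ ∙ y, by rw [Submodule.span_singleton_le_iff_mem]; exact hy, finrank_span_singleton hy0⟩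

theorem ne_bot_of_odd {Y : Submodule ℂ X} (hY : Odd (Module.finrank ℂ Y)) : Y ≠ ⊥ := by
  rintro rfl; simp at hY

theorem eig_stab {i : ℕ} (hi : i < n) (l : ℂ) : Stab ρ (Gk i) (Module.End.eigenspace (ρ (hh i ν)) l) := by
  intro g hg y hy
  rw [Module.End.mem_eigenspace_iff] at hy ⊢
  rw [hh_rho_comm hi ν hg, hy, map_smul]

theorem par_one (hν : ∀ a : Fˣ, ∃ m : ℕ, a = ν ^ m) (hn : 0 < n) (hq : Odd (Fintype.card F)) {Y : Submodule ℂ X}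
    (hY : Irr ρ (Gk 1) Y) (hodd : Odd (Module.finrank ℂ Y)) : Good ρ ν 1 Y := by
  refine ⟨hY, ?_⟩
  by_cases hne : Y ⊓ fix ρ (U 0) = ⊥
  · exact Or.inl ⟨rfl, hne, hodd⟩
  right
  have fin : ∀ l : ℂ, l ^ 2 = 1 → Y ⊓ fix ρ (U 0) ⊓ Module.End.eigenspace (ρ (hh 0 ν)) l ≠ ⊥ →
     ∃ A ≤ Y ⊓ fix ρ (U 0), ∃ l : ℂ, l ^ 2 = 1 ∧ (∀ a ∈ A, ρ (hh 0 ν) a = l • a) ∧ Good ρ ν 0 A := by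
    intro l hl h
    obtain ⟨L, hL, hL1⟩ := exists_line h
    exact ⟨L, hL.trans inf_le_left, l, hl, fun a ha => Module.End.mem_eigenspace_iff.1 (hL ha).2, hL1⟩
  by_contra hcon
  have hκ : ¬ Odd (Module.finrank ℂ (Y ⊓ fix ρ (U 0) : Submodule ℂ X)) := by
    intro ho
    have ho' : Odd (Module.finrank ℂ (Y ⊓ fix ρ (U 0) ⊓ fix ρ (⊥ : Subgroup (GT n F)) : Submodule ℂ X)) := by
      rwa [fix_bot, inf_top_eq]
    obtain ⟨l, hl, h⟩ := sym_cor hn ν hY.1 bot_le bot_unip ho'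
    rw [fix_bot, inf_top_eq] at h
    exact hcon (fin l hl (ne_bot_of_odd h))
  have hd := rank_one_dim hn hY hne (by
    intro y hy hyf hya
    by_contra hy0
    apply hcon
    apply fin 1 (by norm_num)
    intro hb
    apply hy0
    have : y ∈ Y ⊓ fix ρ (U 0) ⊓ Module.End.eigenspace (ρ (hh 0 ν)) 1 :=
      ⟨⟨hy, hyf⟩, Module.End.mem_eigenspace_iff.2 (by rw [hya ν, one_smul])⟩
    rw [hb] at this
    exact (Submodule.mem_bot ℂ).1 this)
  rw [Nat.not_odd_iff_even] at hκ
  obtain ⟨κ, hκ⟩ := hκ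
  obtain ⟨m, hm⟩ := hq
  rw [hκ, hm] at hd
  have : Module.finrank ℂ Y = 2 * ((m + 1) * κ) := by
    apply Nat.eq_of_mul_eq_mul_left (by norm_num : 0 < 2)
    rw [hd]; ring
  rw [this] at hodd
  exact (Nat.not_odd_iff_even.2 (even_two_mul _)) hodd

theorem Par (hν : ∀ a : Fˣ, ∃ m : ℕ, a = ν ^ m) (hq : Odd (Fintype.card F)) (h2 : (2 : F) ≠ 0) :
    ∀ k, k ≤ n → ∀ Y : Submodule ℂ X, Stab ρ (Gk k) Y → Odd (Module.finrank ℂ Y) → ∃ Y' ≤ Y, Good ρ ν k Y'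
  | 0, _, Y, hY, ho => exists_line (ne_bot_of_odd ho)
  | 1, hk, Y, hY, ho => by
    obtain ⟨Y₁, hle, hI, ho1⟩ := exists_irr_odd (K := ⊥) bot_le hY (by rwa [fix_bot, inf_top_eq])
    rw [fix_bot, inf_top_eq] at ho1
    exact ⟨Y₁, hle, par_one hν hk hq hI ho1⟩
  | j + 2, hk, Y, hY, ho => by
    have hj : j + 1 < n := hk
    obtain ⟨Y₁, hle, hI, ho1⟩ := exists_irr_odd (K := ⊥) bot_le hY (by rwa [fix_bot, inf_top_eq])
    rw [fix_bot, inf_top_eq, par_QU hj h2 hI.1] at ho1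
    obtain ⟨l, hl, h3⟩ := sym_cor hj ν hI.1 (U_le j) (U_unip hj) ho1
    set Bm := Y₁ ⊓ fix ρ (U (j+1)) ⊓ Module.End.eigenspace (ρ (hh (j+1) ν)) l with hB
    have hBs : Stab ρ (Gk (j+1)) Bm :=
      ((hI.1.mono (Gk_mono (Nat.le_succ _))).inf (fix_stab _)).inf (eig_stab hj l)
    have h4 : Y₁ ⊓ fix ρ (U (j+1)) ⊓ fix ρ (U j) ⊓ Module.End.eigenspace (ρ (hh (j+1) ν)) l
        = Bm ⊓ fix ρ (U j) := by rw [hB, inf_right_comm]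
    rw [h4] at h3
    obtain ⟨B₁, hB1, hI1, ho2⟩ := exists_irr_odd (U_le j) hBs h3
    have ho2' : Odd (Module.finrank ℂ (B₁ ⊓ fix ρ (U j) ⊓ fix ρ (⊥ : Subgroup (GT n F)) : Submodule ℂ X)) := by
      rwa [fix_bot, inf_top_eq]
    have hj' : j < n := by omega
    obtain ⟨m, hm, h5⟩ := sym_cor hj' ν hI1.1 bot_le bot_unip ho2'
    rw [fix_bot, inf_top_eq] at h5
    have hCs : Stab ρ (Gk j) (B₁ ⊓ fix ρ (U j) ⊓ Module.End.eigenspace (ρ (hh j ν)) m) :=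
      ((hI1.1.mono (Gk_mono (Nat.le_succ _))).inf (fix_stab _)).inf (eig_stab hj' m)
    obtain ⟨A, hA, hAG⟩ := Par hν hq h2 j (by omega) _ hCs h5
    refine ⟨Y₁, hle, hI, Or.inr ⟨B₁, hB1.trans inf_le_left, l, hl, ?_, hI1, Or.inr ⟨A, hA.trans inf_le_left, m, hm, ?_, hAG⟩⟩⟩
    · intro a ha; exact Module.End.mem_eigenspace_iff.1 (hB1 ha).2
    · intro a ha; exact Module.End.mem_eigenspace_iff.1 (hA ha).2

end GoodSec

end SpP


namespace SpP

set_option linter.unusedSectionVars false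
set_option linter.unusedVariables false
set_option linter.unusedSimpArgs false

section Twist

variable {G : Type} [Group G]
variable {X : Type} [AddCommGroup X] [Module ℂ X]

/-- twisted vector space: the scalar `c` acts as the preimage of `c` under `σ`. -/
def Tw (σ : ℂ ≃+* ℂ) (X : Type) : Type := X

instance instTwGrp (σ : ℂ ≃+* ℂ) (X : Type) [AddCommGroup X] : AddCommGroup (Tw σ X) :=
  inferInstanceAs (AddCommGroup X)

instance instTwMod (σ : ℂ ≃+* ℂ) (X : Type) [AddCommGroup X] [Module ℂ X] : Module ℂ (Tw σ X) :=
  Module.compHom X (σ.symm : ℂ →+* ℂ)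

/-- the identity map to the twist. -/
def toTw (σ : ℂ ≃+* ℂ) (X : Type) [AddCommGroup X] : X ≃+ Tw σ X := AddEquiv.refl X

theorem smul_toTw (σ : ℂ ≃+* ℂ) (c : ℂ) (x : X) : c • toTw σ X x = toTw σ X (σ.symm c • x) := rfl

theorem toTw_smul (σ : ℂ ≃+* ℂ) (c : ℂ) (x : X) : toTw σ X (c • x) = σ c • toTw σ X x := by
  rw [smul_toTw, RingEquiv.symm_apply_apply]

/-- twisted linear map. -/
def twL (σ : ℂ ≃+* ℂ) (A : X →ₗ[ℂ] X) : Tw σ X →ₗ[ℂ] Tw σ X where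
  toFun x := toTw σ X (A ((toTw σ X).symm x))
  map_add' x y := by simp
  map_smul' c x := by
    show toTw σ X (A (σ.symm c • ((toTw σ X).symm x))) = _
    rw [map_smul, toTw_smul, RingEquiv.apply_symm_apply]; rfl

theorem twL_apply (σ : ℂ ≃+* ℂ) (A : X →ₗ[ℂ] X) (x : X) :
    twL σ A (toTw σ X x) = toTw σ X (A x) := rfl

/-- twisted representation. -/
def twr (σ : ℂ ≃+* ℂ) (ρ : Representation ℂ G X) : Representation ℂ G (Tw σ X) where
  toFun g := twL σ (ρ g)
  map_one' := by rw [map_one]; rfl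
  map_mul' g h := by rw [map_mul]; rfl

theorem twr_apply (σ : ℂ ≃+* ℂ) (ρ : Representation ℂ G X) (g : G) (x : X) :
    twr σ ρ g (toTw σ X x) = toTw σ X (ρ g x) := rfl

/-- twisted submodule. -/
def tw (σ : ℂ ≃+* ℂ) (Y : Submodule ℂ X) : Submodule ℂ (Tw σ X) where
  carrier := {x | (toTw σ X).symm x ∈ Y}
  add_mem' := fun ha hb => Y.add_mem ha hb
  zero_mem' := Y.zero_mem
  smul_mem' := fun c x hx => Y.smul_mem (σ.symm c) hx

theorem mem_tw {σ : ℂ ≃+* ℂ} {Y : Submodule ℂ X} {x : X} : toTw σ X x ∈ tw σ Y ↔ x ∈ Y := Iff.rfl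

/-- untwisted submodule. -/
def utw (σ : ℂ ≃+* ℂ) (Z : Submodule ℂ (Tw σ X)) : Submodule ℂ X where
  carrier := {x | toTw σ X x ∈ Z}
  add_mem' := fun ha hb => Z.add_mem ha hb
  zero_mem' := Z.zero_mem
  smul_mem' := fun c x hx => by
    show toTw σ X (c • x) ∈ Z
    rw [toTw_smul]; exact Z.smul_mem _ hx

theorem tw_utw (σ : ℂ ≃+* ℂ) (Z : Submodule ℂ (Tw σ X)) : tw σ (utw σ Z) = Z := rfl
theorem utw_tw (σ : ℂ ≃+* ℂ) (Z : Submodule ℂ X) : utw σ (tw σ Z) = Z := rfl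

theorem tw_bot (σ : ℂ ≃+* ℂ) : tw σ (⊥ : Submodule ℂ X) = ⊥ := rfl

theorem stab_tw {σ : ℂ ≃+* ℂ} {ρ : Representation ℂ G X} {H : Subgroup G} {Y : Submodule ℂ X}
    (h : Stab ρ H Y) : Stab (twr σ ρ) H (tw σ Y) := fun g hg y hy => h g hg _ hy

theorem irr_tw {σ : ℂ ≃+* ℂ} {ρ : Representation ℂ G X} {H : Subgroup G} {Y : Submodule ℂ X}
    (h : Irr ρ H Y) : Irr (twr σ ρ) H (tw σ Y) := by
  obtain ⟨h1, h2, h3⟩ := h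
  refine ⟨stab_tw h1, ?_, ?_⟩
  · intro hb
    apply h2
    rw [← utw_tw σ Y, hb]; rfl
  · intro Z hZ hs
    rcases h3 (utw σ Z) (fun x hx => hZ hx) (fun g hg y hy => hs g hg _ hy) with h | h
    · left; rw [← tw_utw σ Z, h, tw_bot]
    · right; rw [← tw_utw σ Z, h]

/-- twisted basis -/
noncomputable def twB {ι : Type} [Fintype ι] (σ : ℂ ≃+* ℂ) (b : Module.Basis ι ℂ X) :
    Module.Basis ι ℂ (Tw σ X) :=
  Module.Basis.ofEquivFun
    { toFun := fun x i => σ (b.equivFun ((toTw σ X).symm x) i)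
      map_add' := fun x y => by ext i; simp
      map_smul' := fun c x => by
        ext i
        obtain ⟨x, rfl⟩ := (toTw σ X).surjective x
        rw [smul_toTw]; simp
      invFun := fun v => toTw σ X (b.equivFun.symm (fun i => σ.symm (v i)))
      left_inv := fun x => by simp
      right_inv := fun v => by
        ext i
        simp only [AddEquiv.symm_apply_apply, LinearEquiv.apply_symm_apply,
          RingEquiv.apply_symm_apply] }

theorem twB_apply {ι : Type} [Fintype ι] (σ : ℂ ≃+* ℂ) (b : Module.Basis ι ℂ X) (i : ι) :
    twB σ b i = toTw σ X (b i) := by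
  classical
  rw [twB, Module.Basis.coe_ofEquivFun]
  show toTw σ X (b.equivFun.symm _) = _
  congr 1
  rw [LinearEquiv.symm_apply_eq]
  ext j
  simp [Finsupp.single_apply, Pi.single_apply]
  split_ifs <;> simp_all

theorem twB_repr {ι : Type} [Fintype ι] (σ : ℂ ≃+* ℂ) (b : Module.Basis ι ℂ X) (i : ι) (x : X) :
    (twB σ b).repr (toTw σ X x) i = σ (b.repr x i) := by
  rw [← Module.Basis.equivFun_apply, twB, Module.Basis.equivFun_ofEquivFun]
  show σ (b.equivFun x i) = _
  simp

variable [FiniteDimensional ℂ X]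

instance instTwFin (σ : ℂ ≃+* ℂ) : FiniteDimensional ℂ (Tw σ X) :=
  (twB σ (Module.finBasis ℂ X)).finiteDimensional_of_finite

theorem tr_twL (σ : ℂ ≃+* ℂ) (A : X →ₗ[ℂ] X) :
    LinearMap.trace ℂ (Tw σ X) (twL σ A) = σ (LinearMap.trace ℂ X A) := by
  classical
  rw [LinearMap.trace_eq_matrix_trace ℂ (Module.finBasis ℂ X),
    LinearMap.trace_eq_matrix_trace ℂ (twB σ (Module.finBasis ℂ X))]
  simp only [Matrix.trace, Matrix.diag, LinearMap.toMatrix_apply, map_sum]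
  refine Finset.sum_congr rfl fun i _ => ?_
  rw [twB_apply, twL_apply, twB_repr]

end Twist

end SpP


namespace SpP

set_option linter.unusedSectionVars false
set_option linter.unusedVariables false
set_option linter.unusedSimpArgs false

section SigTr

variable {X : Type} [AddCommGroup X] [Module ℂ X] [FiniteDimensional ℂ X]

theorem tr_auto {V : Type} [AddCommGroup V] [Module ℂ V] [FiniteDimensional ℂ V] (A : V →ₗ[ℂ] V)
    {N : ℕ} (hN : 0 < N) (hA : A ^ N = 1) (τ : ℂ →+* ℂ) (m : ℕ)
    (hτ : ∀ x : ℂ, x ^ N = 1 → τ x = x ^ m) :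
    τ (LinearMap.trace ℂ V A) = LinearMap.trace ℂ V (A ^ m) := by
  have hζ := Complex.isPrimitiveRoot_exp N hN.ne'
  set ζ := Complex.exp (2 * Real.pi * Complex.I / N) with hζd
  have hpw : ∀ a : ℕ, (ζ ^ a) ^ N = 1 := by
    intro a; rw [← pow_mul, mul_comm, pow_mul, hζ.pow_eq_one, one_pow]
  have hmod : ∀ m : ℕ, A ^ m = A ^ (m % N) := by
    intro m
    conv_lhs => rw [← Nat.div_add_mod m N, pow_add, pow_mul, hA, one_pow, one_mul]
  have hmod' : ∀ a m : ℕ, (ζ ^ a) ^ m = (ζ ^ a) ^ (m % N) := by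
    intro a m
    conv_lhs => rw [← Nat.div_add_mod m N, pow_add, pow_mul, hpw, one_pow, one_mul]
  have key : ∀ m : ℕ, LinearMap.trace ℂ V (A ^ m) =
      ∑ a ∈ Finset.range N, (ζ ^ a) ^ m * (Module.finrank ℂ (Module.End.eigenspace A (ζ ^ a)) : ℂ) := by
    intro m
    rw [hmod m, eig_trace A hN hA hζ (Nat.mod_lt _ hN)]
    refine Finset.sum_congr rfl fun a _ => ?_
    rw [hmod' a m]
  have h1 := key 1
  rw [pow_one] at h1
  rw [h1, key m, map_sum]
  refine Finset.sum_congr rfl fun a _ => ?_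
  rw [map_mul, map_natCast, pow_one, hτ _ (hpw a)]

variable {G : Type} [Group G] [Fintype G] {ρ : Representation ℂ G X}

theorem trOn_auto {Y : Submodule ℂ X} {g : G} (hA : ∀ y ∈ Y, ρ g y ∈ Y) {N : ℕ} (hN : 0 < N)
    (hg : g ^ N = 1) (τ : ℂ →+* ℂ) (m : ℕ)
    (hτ : ∀ x : ℂ, x ^ N = 1 → τ x = x ^ m) :
    τ (trOn Y (ρ g)) = trOn Y (ρ (g ^ m)) := by
  have hm : ∀ y ∈ Y, ρ (g ^ m) y ∈ Y := by
    intro y hy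
    rw [map_pow]
    rw [← restrict_pow_val hA m ⟨y, hy⟩]; exact Subtype.property _
  rw [trOn_eq hA, trOn_eq hm, tr_auto _ hN (rho_restrict_pow hA hg) τ m hτ]
  congr 1
  ext y
  rw [restrict_pow_val, ← map_pow]; rfl

theorem trOn_conj_inv {H : Subgroup G} {Y : Submodule ℂ X} (hY : Stab ρ H Y) {g : G}
    (hg : g ∈ H) : (starRingEnd ℂ) (trOn Y (ρ g)) = trOn Y (ρ g⁻¹) := by
  have hN : 0 < orderOf g := orderOf_pos g
  rw [trOn_auto (hY g hg) hN (pow_orderOf_eq_one g) (starRingEnd ℂ) (orderOf g - 1)]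
  · congr 2
    rw [eq_inv_iff_mul_eq_one, ← pow_succ, Nat.sub_add_cancel hN, pow_orderOf_eq_one]
  · intro x hx
    have hnx : ‖x‖ = 1 := Complex.norm_eq_one_of_pow_eq_one hx hN.ne'
    have hx0 : x ≠ 0 := by
      rintro rfl; simp at hnx
    have h1 : x * (starRingEnd ℂ) x = 1 := by
      rw [Complex.mul_conj, Complex.normSq_eq_norm_sq, hnx]; simp
    have h2 : x * x ^ (orderOf g - 1) = 1 := by
      rw [← pow_succ', Nat.sub_add_cancel hN, hx]
    exact mul_left_cancel₀ hx0 (h1.trans h2.symm)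

theorem trOn_tw (σ : ℂ ≃+* ℂ) {Y : Submodule ℂ X} {A : X →ₗ[ℂ] X} (hA : ∀ y ∈ Y, A y ∈ Y) :
    trOn (tw σ Y) (twL σ A) = σ (trOn Y A) := by
  rw [trOn_eq hA, ← tr_twL, trOn_eq (Y := tw σ Y) (A := twL σ A) (fun y hy => hA _ hy)]
  rfl

theorem finrank_tw (σ : ℂ ≃+* ℂ) (Y : Submodule ℂ X) :
    Module.finrank ℂ (tw σ Y) = Module.finrank ℂ Y := by
  have h := trOn_tw σ (Y := Y) (A := LinearMap.id) (fun y hy => hy)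
  have h2 : twL σ (LinearMap.id : X →ₗ[ℂ] X) = LinearMap.id := rfl
  rw [h2, trOn_id, trOn_id, map_natCast] at h
  exact_mod_cast h

end SigTr

section SigTv

variable {n : ℕ} {F : Type} [Field F] [Fintype F]
variable {X : Type} [AddCommGroup X] [Module ℂ X] [FiniteDimensional ℂ X]
variable {ρ : Representation ℂ (GT n F) X} {ν : Fˣ}

theorem tv_pow (b : F) (v : W n F) (m : ℕ) : (tv b v) ^ m = tv (m * b) v := by
  induction m with
  | zero => simp [tv_zero]
  | succ m ih => rw [pow_succ, ih, tv_add]; congr 1; push_cast; ring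

/-- hypothesis on the automorphism -/
def SigOK (σ : ℂ ≃+* ℂ) (r N : ℕ) : Prop := ∀ x : ℂ, x ^ N = 1 → σ x = x ^ 2 ^ r

theorem sig_tv {σ : ℂ ≃+* ℂ} {r : ℕ} (hσ : SigOK σ r (Fintype.card F)) {β : F} (hβ : β ^ 2 = 2) {k : ℕ}
    {Y : Submodule ℂ X} (hY : Stab ρ (Gk k) Y) (b : F) {v : W n F}
    (hv : v ∈ (Wk k : Submodule F (W n F))) :
    σ (trOn Y (ρ (tv b v))) = trOn Y (ρ (tv b (β ^ r • v))) := by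
  have h := trOn_auto (ρ := ρ) (Y := Y) (g := tv b v) (hY _ (tv_mem_Gk b hv)) (N := Fintype.card F)
    Fintype.card_pos (by rw [tv_pow, FiniteField.cast_card_eq_zero, zero_mul, tv_zero]) (σ : ℂ →+* ℂ) (2 ^ r) hσ
  have h2 : (tv b v) ^ 2 ^ r = tv b (β ^ r • v) := by
    rw [tv_pow, tv_scale]; congr 1
    rw [← pow_mul, mul_comm r 2, pow_mul, hβ]; push_cast; ring
  rw [← h2, ← h]; rfl

theorem sig_zz {σ : ℂ ≃+* ℂ} {r : ℕ} (hσ : SigOK σ r (Fintype.card F)) {β : F} (hβ : β ^ 2 = 2)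
    (h2 : (2 : F) ≠ 0) {k : ℕ}
    {Y : Submodule ℂ X} (hY : Stab ρ (Gk k) Y) (hY0 : Y ≠ ⊥) {c : ℂ} (hc : ∀ y ∈ Y, zz ρ k y = c • y) :
    σ c = c := by
  classical
  have hβ0 : β ≠ 0 := by rintro rfl; apply h2; rw [← hβ]; simp
  have hβr : β ^ r ≠ 0 := pow_ne_zero _ hβ0
  have h1 : trOn Y (zz ρ k) = c * Module.finrank ℂ Y := trOn_scalar hc
  have h3 : σ (trOn Y (zz ρ k)) = trOn Y (zz ρ k) := by
    unfold zz
    rw [map_sum, map_sum]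
    refine Finset.sum_bij' (fun v _ => β ^ r • v) (fun v _ => (β ^ r)⁻¹ • v) ?_ ?_ ?_ ?_ ?_
    · intro v hv
      simp only [Finset.mem_filter, Finset.mem_univ, true_and] at hv ⊢
      exact Submodule.smul_mem _ _ hv
    · intro v hv
      simp only [Finset.mem_filter, Finset.mem_univ, true_and] at hv ⊢
      exact Submodule.smul_mem _ _ hv
    · intro v _; rw [smul_smul, inv_mul_cancel₀ hβr, one_smul]
    · intro v _; rw [smul_smul, mul_inv_cancel₀ hβr, one_smul]
    · intro v hv
      simp only [Finset.mem_filter, Finset.mem_univ, true_and] at hv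
      exact sig_tv hσ hβ hY 1 hv
  rw [h1, map_mul, map_natCast] at h3
  have hd : (Module.finrank ℂ Y : ℂ) ≠ 0 := by
    rw [Nat.cast_ne_zero]
    intro h
    exact hY0 (Submodule.finrank_eq_zero.1 h)
  exact mul_right_cancel₀ hd h3

end SigTv

end SpP


namespace SpP

set_option linter.unusedSectionVars false
set_option linter.unusedVariables false
set_option linter.unusedSimpArgs false

section IsoSec

variable {n : ℕ} {F : Type} [Field F] [Fintype F]
variable {X : Type} [AddCommGroup X] [Module ℂ X] [FiniteDimensional ℂ X]

/-- sum of a representation and its twist -/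
def PR (σ : ℂ ≃+* ℂ) (ρ : Representation ℂ (GT n F) X) : Representation ℂ (GT n F) (X × Tw σ X) where
  toFun g := LinearMap.prodMap (ρ g) (twr σ ρ g)
  map_one' := by rw [map_one, map_one]; rfl
  map_mul' g h := by rw [map_mul, map_mul]; rfl

theorem PR_apply (σ : ℂ ≃+* ℂ) (ρ : Representation ℂ (GT n F) X) (g : GT n F) (x : X) (y : Tw σ X) :
    PR σ ρ g (x, y) = (ρ g x, twr σ ρ g y) := rfl

/-- `Y` is isomorphic to its twist. -/
def Iso (σ : ℂ ≃+* ℂ) (ρ : Representation ℂ (GT n F) X) (k : ℕ) (Y : Submodule ℂ X) : Prop :=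
  ∃ Γ : Submodule ℂ (X × Tw σ X), Stab (PR σ ρ) (Gk k) Γ ∧ (∀ p ∈ Γ, p.1 = 0 → p = 0) ∧
    (∀ p ∈ Γ, p.2 = 0 → p = 0) ∧ Γ.map (LinearMap.fst ℂ X (Tw σ X)) = Y ∧
    Γ.map (LinearMap.snd ℂ X (Tw σ X)) = tw σ Y

variable {ρ : Representation ℂ (GT n F) X} {ν : Fˣ} {σ : ℂ ≃+* ℂ}

theorem zz_PR (k : ℕ) (x : X) (y : X) :
    zz (PR σ ρ) k (x, toTw σ X y) = (zz ρ k x, toTw σ X (zz ρ k y)) := by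
  classical
  rw [zz_apply, zz_apply, zz_apply, map_sum]
  apply Prod.ext
  · rw [Prod.fst_sum]; rfl
  · rw [Prod.snd_sum]; rfl

theorem Gk_zero {g : GT n F} (hg : g ∈ (Gk 0 : Subgroup (GT n F))) : g = 1 := by
  apply Gk_ext hg (one_mem _)
  intro x hx
  rw [Wk_zero hx]; simp

theorem iso_zero {Y : Submodule ℂ X} (h : Module.finrank ℂ Y = 1) :
    Dist ρ ν 0 Y ∧ Iso σ ρ 0 Y := by
  obtain ⟨y0, hy0, hspan⟩ := finrank_eq_one_iff'.1 h
  have hY0 : (y0 : X) ≠ 0 := fun h => hy0 (Subtype.ext h)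
  have hYs : ∀ y ∈ Y, ∃ c : ℂ, y = c • (y0 : X) := by
    intro y hy
    obtain ⟨c, hc⟩ := hspan ⟨y, hy⟩
    exact ⟨c, by rw [← Submodule.coe_smul, hc]⟩
  constructor
  · refine ⟨fun g hg y hy => by rw [Gk_zero hg, rho_one]; exact hy, ?_, ?_⟩
    · intro hb; exact hY0 ((Submodule.mem_bot ℂ).1 (hb ▸ y0.2))
    · intro Z hZ _
      by_cases hz : Z = ⊥
      · exact Or.inl hz
      right
      obtain ⟨z, hz, hz0⟩ := Submodule.exists_mem_ne_zero_of_ne_bot hz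
      obtain ⟨c, hc⟩ := hYs z (hZ hz)
      have hc0 : c ≠ 0 := by rintro rfl; apply hz0; rw [hc, zero_smul]
      apply le_antisymm hZ
      intro y hy
      obtain ⟨c', rfl⟩ := hYs y hy
      have : (y0 : X) = c⁻¹ • z := by rw [hc, smul_smul, inv_mul_cancel₀ hc0, one_smul]
      rw [this]
      exact Z.smul_mem _ (Z.smul_mem _ hz)
  · refine ⟨Submodule.span ℂ {((y0 : X), toTw σ X y0)}, ?_, ?_, ?_, ?_, ?_⟩
    · intro g hg y hy; rw [Gk_zero hg, rho_one]; exact hy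
    · intro p hp h
      obtain ⟨c, rfl⟩ := Submodule.mem_span_singleton.1 hp
      have : c • (y0 : X) = 0 := h
      rcases smul_eq_zero.1 this with h | h
      · rw [h, zero_smul]
      · exact absurd h hY0
    · intro p hp h
      obtain ⟨c, rfl⟩ := Submodule.mem_span_singleton.1 hp
      have : c • (toTw σ X (y0 : X)) = 0 := h
      rcases smul_eq_zero.1 this with h | h
      · rw [h, zero_smul]
      · exact absurd h hY0
    · rw [Submodule.map_span, Set.image_singleton]
      apply le_antisymm
      · rw [Submodule.span_le, Set.singleton_subset_iff]; exact y0.2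
      · intro y hy
        obtain ⟨c, rfl⟩ := hYs y hy
        exact Submodule.smul_mem _ _ (Submodule.mem_span_singleton_self _)
    · rw [Submodule.map_span, Set.image_singleton]
      apply le_antisymm
      · rw [Submodule.span_le, Set.singleton_subset_iff]; exact y0.2
      · intro y hy
        obtain ⟨y, rfl⟩ := (toTw σ X).surjective y
        obtain ⟨c, rfl⟩ := hYs y hy
        rw [toTw_smul]
        exact Submodule.smul_mem _ _ (Submodule.mem_span_singleton_self _)

theorem Dist.rank_one {Y : Submodule ℂ X} (hI : Irr ρ (Gk 1) Y) (h : Y ⊓ fix ρ (U 0) = ⊥) :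
    Dist ρ ν 1 Y := by
  refine ⟨hI, ?_, ?_⟩
  · intro y hy hy'
    have : y ∈ Y ⊓ fix ρ (U 0) := ⟨hy, hy'⟩
    rw [h, Submodule.mem_bot] at this
    rw [this]; simp
  · intro l d
    left
    rw [eq_bot_iff, ← h]
    intro y hy
    exact ⟨hy.1, (mem_Lab.1 hy.2).1⟩

theorem iso_step (hν : ∀ a : Fˣ, ∃ m : ℕ, a = ν ^ m) {r : ℕ} (hσ : SigOK σ r (Fintype.card F)) {β : F}
    (hβ : β ^ 2 = 2) (h2 : (2 : F) ≠ 0) {k : ℕ} (hk : k < n) {Y A : Submodule ℂ X}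
    (hI : Irr ρ (Gk (k+1)) Y) (hA : A ≤ Y ⊓ fix ρ (U k)) {l : ℂ} (hl2 : l ^ 2 = 1)
    (hl : ∀ a ∈ A, ρ (hh k ν) a = l • a) (hD : Dist ρ ν k A) (hiso : Iso σ ρ k A) :
    Dist ρ ν (k+1) Y ∧ Iso σ ρ (k+1) Y := by
  obtain ⟨c, hc⟩ := schur hI (zz ρ (k+1)) (fun y hy => zz_stab hI.1 hy) (fun g hg y hy => zz_comm hg y)
  have hσc : σ c = c := sig_zz hσ hβ h2 hI.1 hI.2.1 hc
  have hσl : σ l = l := by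
    have : l = 1 ∨ l = -1 := by simpa using hl2
    rcases this with rfl | rfl <;> simp
  have hAY : A ≤ Y := fun a ha => (hA ha).1
  have hA0 : A ≠ ⊥ := hD.irr.2.1
  constructor
  · have h := S_all hν k hk A (fun a ha => (hA ha).2) hD l hl2 hl c (fun y hy => hc y (hAY hy))
    have hg : gspan ρ (Gk (k+1)) A ≤ Y := gspan_le hI.1 hAY
    rcases hI.2.2 _ hg (gspan_stab ρ _ A) with h' | h'
    · exfalso; apply hA0; rw [eq_bot_iff, ← h']; exact le_gspan ρ _ A
    · rw [← h']; exact h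
  obtain ⟨Γ, hΓs, hΓ1, hΓ2, hΓf, hΓg⟩ := hiso
  have hm1 : ∀ p ∈ Γ, p.1 ∈ A := by
    intro p hp; rw [← hΓf]; exact ⟨p, hp, rfl⟩
  have hm2 : ∀ p ∈ Γ, p.2 ∈ tw σ A := by
    intro p hp; rw [← hΓg]; exact ⟨p, hp, rfl⟩
  have hΓD : Dist (PR σ ρ) ν k Γ := by
    rw [← Dist_map (ρ₂ := ρ) (LinearMap.fst ℂ X (Tw σ X)) k hk.le hΓs (fun g hg y hy => rfl) hΓ1, hΓf]
    exact hD
  have hS := S_all hν k hk Γ (fun p hp g hg => by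
      obtain ⟨x, y⟩ := p
      obtain ⟨y, rfl⟩ := (toTw σ X).surjective y
      rw [PR_apply, twr_apply, (hA (hm1 _ hp)).2 g hg, (hA (show y ∈ A from hm2 _ hp)).2 g hg]) hΓD l hl2
      (fun p hp => by
        obtain ⟨x, y⟩ := p
        obtain ⟨y, rfl⟩ := (toTw σ X).surjective y
        rw [PR_apply, twr_apply, hl _ (hm1 _ hp), hl _ (show y ∈ A from hm2 _ hp), toTw_smul, hσl]; rfl)
      c (fun p hp => by
        obtain ⟨x, y⟩ := p
        obtain ⟨y, rfl⟩ := (toTw σ X).surjective y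
        rw [zz_PR, hc _ (hAY (hm1 _ hp)), hc _ (hAY (show y ∈ A from hm2 _ hp)), toTw_smul, hσc]; rfl)
  have hN := hS.irr
  set N := gspan (PR σ ρ) (Gk (k+1)) Γ with hNd
  have hΓN : Γ ≤ N := le_gspan _ _ _
  obtain ⟨a, ha, ha0⟩ := Submodule.exists_mem_ne_zero_of_ne_bot hA0
  have ht : Irr (twr σ ρ) (Gk (k+1)) (tw σ Y) := irr_tw hI
  have e1 : ∀ p ∈ N, p.1 = 0 → p = 0 := by
    rcases hN.2.2 (N ⊓ LinearMap.ker (LinearMap.fst ℂ X (Tw σ X))) inf_le_left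
      (fun g hg y hy => ⟨hN.1 g hg y hy.1, by
        have h : y.1 = 0 := hy.2
        show (ρ g y.1) = 0
        rw [h, map_zero]⟩) with h | h
    · intro p hp h0
      have : p ∈ N ⊓ LinearMap.ker (LinearMap.fst ℂ X (Tw σ X)) := ⟨hp, h0⟩
      rw [h] at this; exact (Submodule.mem_bot ℂ).1 this
    · exfalso
      rw [← hΓf] at ha
      obtain ⟨p, hp, rfl⟩ := ha
      have := hΓN hp
      rw [← h] at this
      exact ha0 this.2
  have e2 : ∀ p ∈ N, p.2 = 0 → p = 0 := by
    rcases hN.2.2 (N ⊓ LinearMap.ker (LinearMap.snd ℂ X (Tw σ X))) inf_le_left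
      (fun g hg y hy => ⟨hN.1 g hg y hy.1, by
        have h : y.2 = 0 := hy.2
        show (twr σ ρ g y.2) = 0
        rw [h, map_zero]⟩) with h | h
    · intro p hp h0
      have : p ∈ N ⊓ LinearMap.ker (LinearMap.snd ℂ X (Tw σ X)) := ⟨hp, h0⟩
      rw [h] at this; exact (Submodule.mem_bot ℂ).1 this
    · exfalso
      have ha' : toTw σ X a ∈ tw σ A := ha
      rw [← hΓg] at ha'
      obtain ⟨p, hp, hpa⟩ := ha'
      have := hΓN hp
      rw [← h] at this
      have h3 : p.2 = 0 := this.2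
      apply ha0
      have h4 : p.2 = toTw σ X a := hpa
      rw [h3] at h4
      exact h4.symm
  have hΓ0 : ∃ p ∈ N, p ≠ 0 := Submodule.exists_mem_ne_zero_of_ne_bot hN.2.1
  obtain ⟨p, hpN, hp0⟩ := hΓ0
  refine ⟨N, hN.1, e1, e2, ?_, ?_⟩
  · have hle : N.map (LinearMap.fst ℂ X (Tw σ X)) ≤ Y := by
      rw [Submodule.map_le_iff_le_comap]
      apply gspan_le
      · intro g hg y hy; exact hI.1 g hg _ hy
      · intro q hq; exact hAY (hm1 q hq)
    rcases hI.2.2 _ hle (by rintro g hg _ ⟨y, hy, rfl⟩; exact ⟨_, hN.1 g hg y hy, rfl⟩) with h | h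
    · exfalso
      apply hp0
      apply e1 p hpN
      have : p.1 ∈ N.map (LinearMap.fst ℂ X (Tw σ X)) := ⟨p, hpN, rfl⟩
      rw [h] at this; exact (Submodule.mem_bot ℂ).1 this
    · exact h
  · have hle : N.map (LinearMap.snd ℂ X (Tw σ X)) ≤ tw σ Y := by
      rw [Submodule.map_le_iff_le_comap]
      apply gspan_le
      · intro g hg y hy; exact ht.1 g hg _ hy
      · intro q hq; exact hAY (mem_tw.1 (hm2 q hq))
    rcases ht.2.2 _ hle (by rintro g hg _ ⟨y, hy, rfl⟩; exact ⟨_, hN.1 g hg y hy, rfl⟩) with h | h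
    · exfalso
      apply hp0
      apply e2 p hpN
      have : p.2 ∈ N.map (LinearMap.snd ℂ X (Tw σ X)) := ⟨p, hpN, rfl⟩
      rw [h] at this; exact (Submodule.mem_bot ℂ).1 this
    · exact h

theorem good_iso (hν : ∀ a : Fˣ, ∃ m : ℕ, a = ν ^ m) {r : ℕ} (hσ : SigOK σ r (Fintype.card F)) {β : F}
    (hβ : β ^ 2 = 2) (h2 : (2 : F) ≠ 0)
    (hcusp : ∀ Y : Submodule ℂ X, Irr ρ (Gk 1) Y → Y ⊓ fix ρ (U 0) = ⊥ → Odd (Module.finrank ℂ Y) →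
      Iso σ ρ 1 Y) (k : ℕ) : k ≤ n → ∀ Y : Submodule ℂ X, Good ρ ν k Y → Dist ρ ν k Y ∧ Iso σ ρ k Y := by
  induction k with
  | zero => intro _ Y hY; exact iso_zero hY
  | succ k ih =>
    intro hk Y hY
    obtain ⟨hI, ⟨rfl, h1, h3⟩ | ⟨A, hA, l, hl2, hl, hG⟩⟩ := hY
    · exact ⟨Dist.rank_one hI h1, hcusp Y hI h1 h3⟩
    · obtain ⟨hD, hi⟩ := ih (by omega) A hG
      exact iso_step hν hσ hβ h2 hk hI hA hl2 hl hD hi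

/-- an isomorphism with the twist gives Galois invariant traces -/
theorem iso_trace {k : ℕ} {Y : Submodule ℂ X} (hY : Stab ρ (Gk k) Y) (h : Iso σ ρ k Y) {g : GT n F}
    (hg : g ∈ (Gk k : Subgroup (GT n F))) : σ (trOn Y (ρ g)) = trOn Y (ρ g) := by
  obtain ⟨Γ, hs, h1, h2, hf, hs2⟩ := h
  have key : ∀ {X' : Type} [AddCommGroup X'] [Module ℂ X'] [FiniteDimensional ℂ X']
      (q : X × Tw σ X →ₗ[ℂ] X') (A : X' →ₗ[ℂ] X') (hinj : ∀ p ∈ Γ, q p = 0 → p = 0)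
      (hA : ∀ p ∈ Γ, A (q p) = q (PR σ ρ g p)),
      trOn (Γ.map q) A = trOn Γ (PR σ ρ g) := by
    intro X' _ _ _ q A hinj hA
    have hst : ∀ y ∈ Γ.map q, A y ∈ Γ.map q := by
      rintro _ ⟨p, hp, rfl⟩; rw [hA p hp]; exact ⟨_, hs g hg p hp, rfl⟩
    rw [trOn_eq hst, trOn_eq (hs g hg)]
    let q' : Γ →ₗ[ℂ] (Γ.map q) := q.restrict (fun p hp => ⟨p, hp, rfl⟩)
    have hb : Function.Bijective q' := by
      constructor
      · rw [← LinearMap.ker_eq_bot, eq_bot_iff]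
        intro p hp
        have : q p = 0 := congrArg Subtype.val (LinearMap.mem_ker.1 hp)
        rw [Submodule.mem_bot]
        exact Subtype.ext (hinj p p.2 this)
      · rintro ⟨_, p, hp, rfl⟩; exact ⟨⟨p, hp⟩, rfl⟩
    let e := LinearEquiv.ofBijective q' hb
    rw [← LinearMap.trace_conj' ((PR σ ρ g).restrict (hs g hg)) e]
    congr 1
    ext y
    obtain ⟨p, rfl⟩ := e.surjective y
    rw [LinearEquiv.conj_apply]
    simp only [LinearMap.comp_apply, LinearEquiv.coe_coe, LinearEquiv.symm_apply_apply]
    exact hA p p.2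
  have k1 := key (LinearMap.fst ℂ X (Tw σ X)) (ρ g) h1 (fun p _ => rfl)
  have k2 := key (LinearMap.snd ℂ X (Tw σ X)) (twr σ ρ g) h2 (fun p _ => rfl)
  rw [hf] at k1
  rw [hs2] at k2
  rw [← trOn_tw σ (hY g hg), k1]
  exact k2

end IsoSec

end SpP


namespace SpP

set_option linter.unusedSectionVars false
set_option linter.unusedVariables false
set_option linter.unusedSimpArgs false

section Fourier

variable {F : Type} [Field F] [Fintype F]

theorem fourier_one {ψ : AddChar F ℂ} (hψ : ψ.IsPrimitive) (c : F → ℂ) (N : F → ℕ)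
    (h : ∀ a, (N a : ℂ) = (Fintype.card F : ℂ)⁻¹ * ∑ b, ψ (-(a * b)) * c b) :
    ∑ a, (N a : ℂ) = c 0 := by
  classical
  have hq : (Fintype.card F : ℂ) ≠ 0 := Nat.cast_ne_zero.2 Fintype.card_ne_zero
  simp_rw [h]
  rw [← Finset.mul_sum, Finset.sum_comm]
  simp_rw [← Finset.sum_mul]
  have : ∀ b : F, ∑ a, ψ (-(a * b)) = if b = 0 then (Fintype.card F : ℂ) else 0 := by
    intro b
    have h := AddChar.sum_mulShift (-b) hψ
    simp only [neg_eq_zero, mul_neg] at h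
    rw [h]; split_ifs <;> simp
  simp_rw [this]
  simp

theorem fourier_two {ψ : AddChar F ℂ} (hψ : ψ.IsPrimitive) (c : F → ℂ) (N : F → ℕ)
    (h : ∀ a, (N a : ℂ) = (Fintype.card F : ℂ)⁻¹ * ∑ b, ψ (-(a * b)) * c b) :
    (Fintype.card F : ℂ) * ∑ a, (N a : ℂ) ^ 2 = ∑ b, c b * c (-b) := by
  classical
  have hq : (Fintype.card F : ℂ) ≠ 0 := Nat.cast_ne_zero.2 Fintype.card_ne_zero
  have e : ∀ b b' : F, ∑ a, ψ (-(a * (b + b'))) = if b' = -b then (Fintype.card F : ℂ) else 0 := by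
    intro b b'
    have h := AddChar.sum_mulShift (-(b + b')) hψ
    simp only [neg_eq_zero, mul_neg] at h
    have h3 : b + b' = 0 ↔ b' = -b := by
      constructor
      · intro h; linear_combination h
      · rintro rfl; ring
    rw [h]; simp only [h3]; split_ifs <;> simp
  have e2 : ∀ a : F, (N a : ℂ) ^ 2 = (Fintype.card F : ℂ)⁻¹ ^ 2 *
      ∑ b, ∑ b', ψ (-(a * (b + b'))) * (c b * c b') := by
    intro a
    rw [h, mul_pow, sq (∑ b, _), Finset.sum_mul_sum]
    congr 1
    refine Finset.sum_congr rfl fun b _ => Finset.sum_congr rfl fun b' _ => ?_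
    have : -(a * (b + b')) = -(a * b) + -(a * b') := by ring
    rw [this, AddChar.map_add_eq_mul]; ring
  simp_rw [e2]
  rw [← Finset.mul_sum, Finset.sum_comm]
  have e3 : ∀ b : F, ∑ a : F, ∑ b' : F, ψ (-(a * (b + b'))) * (c b * c b') =
      (Fintype.card F : ℂ) * (c b * c (-b)) := by
    intro b
    rw [Finset.sum_comm]
    simp_rw [← Finset.sum_mul, e]
    simp
  simp_rw [e3]
  rw [← Finset.mul_sum]
  field_simp

/-- sum of a function depending on square classes only -/
theorem sum_sq {ν : Fˣ} (hν : ∀ a : Fˣ, ∃ m : ℕ, a = ν ^ m) (g : F → ℝ)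
    (hg : ∀ (a : F) (s : Fˣ), g (a * (s : F) ^ 2) = g a) :
    2 * ∑ a : Fˣ, g a = (Fintype.card F - 1 : ℝ) * (g 1 + g ν) := by
  classical
  have h1 : ∑ a : Fˣ, g a = ∑ a : Fˣ, g ((ν * a : Fˣ) : F) :=
    (Fintype.sum_equiv (Equiv.mulLeft ν) _ _ (fun a => rfl)).symm
  have h2 : ∀ a : Fˣ, g a + g ((ν * a : Fˣ) : F) = g 1 + g ν := by
    intro a
    obtain ⟨m, rfl⟩ := hν a
    rcases Nat.even_or_odd' m with ⟨j, rfl | rfl⟩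
    · have e1 := hg 1 (ν ^ j)
      have e2 := hg ν (ν ^ j)
      rw [← e1, ← e2]
      push_cast
      congr 2 <;> ring
    · have e1 := hg ν (ν ^ j)
      have e2 := hg 1 (ν ^ (j + 1))
      rw [← e1, ← e2, add_comm]
      push_cast
      congr 2 <;> ring
  have h3 : 2 * ∑ a : Fˣ, g a = ∑ a : Fˣ, (g a + g ((ν * a : Fˣ) : F)) := by
    rw [Finset.sum_add_distrib, ← h1]; ring
  rw [h3, Finset.sum_congr rfl (fun a _ => h2 a), Finset.sum_const, nsmul_eq_mul, Finset.card_univ,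
    ← Nat.card_eq_fintype_card, Nat.card_units, Nat.card_eq_fintype_card, Nat.cast_sub Fintype.card_pos]
  simp

end Fourier

section Weights

variable {n : ℕ} {F : Type} [Field F] [Fintype F]
variable {X : Type} [AddCommGroup X] [Module ℂ X] [FiniteDimensional ℂ X]
variable {ρ : Representation ℂ (GT n F) X} {ν : Fˣ}

theorem weight_nat {k : ℕ} {Y : Submodule ℂ X} (hY : Stab ρ (Gk k) Y) {v : W n F}
    (hv : v ∈ (Wk k : Submodule F (W n F))) (ψ : AddChar F ℂ) (a : F) :
    ∃ N : ℕ, (N : ℂ) = (Fintype.card F : ℂ)⁻¹ * ∑ b, ψ (-(a * b)) * trOn Y (ρ (tv b v)) := by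
  have hq : (Fintype.card F : ℂ) ≠ 0 := Nat.cast_ne_zero.2 Fintype.card_ne_zero
  set P : X →ₗ[ℂ] X := (Fintype.card F : ℂ)⁻¹ • ∑ b, ψ (-(a * b)) • ρ (tv b v) with hP
  have hPa : ∀ x, P x = (Fintype.card F : ℂ)⁻¹ • ∑ b, ψ (-(a * b)) • ρ (tv b v) x := by
    intro x; simp [hP, LinearMap.sum_apply]
  have htr : trOn Y P = (Fintype.card F : ℂ)⁻¹ * ∑ b, ψ (-(a * b)) * trOn Y (ρ (tv b v)) := by
    rw [hP, map_smul, map_sum]; simp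
  have hst : ∀ y ∈ Y, P y ∈ Y := by
    intro y hy
    rw [hPa]
    exact Y.smul_mem _ (Y.sum_mem fun b _ => Y.smul_mem _ (hY _ (tv_mem_Gk b hv) y hy))
  have hid : ∀ x, P (P x) = P x := by
    intro x
    have e1 : ∀ b, ρ (tv b v) (P x) = ψ (a * b) • P x := by
      intro b
      rw [hPa, map_smul, map_sum, smul_comm]
      congr 1
      rw [Finset.smul_sum]
      refine Fintype.sum_equiv (Equiv.addLeft b) _ _ fun b' => ?_
      rw [map_smul, ← rho_mul, tv_add, smul_smul, Equiv.coe_addLeft, ← AddChar.map_add_eq_mul]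
      congr 2; ring
    conv_lhs => rw [hPa]
    simp_rw [e1, smul_smul, ← AddChar.map_add_eq_mul, neg_add_cancel, AddChar.map_zero_eq_one, one_smul]
    rw [Finset.sum_const, Finset.card_univ, ← Nat.cast_smul_eq_nsmul ℂ, smul_smul, inv_mul_cancel₀ hq, one_smul]
  have hid' : IsIdempotentElem (P.restrict hst) := by
    ext y; exact hid y
  refine ⟨Module.finrank ℂ (LinearMap.range (P.restrict hst)), ?_⟩
  rw [← htr, trOn_eq hst]
  exact (LinearMap.IsProj.trace ((LinearMap.isProj_range_iff_isIdempotentElem _).2 hid')).symm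

/-- main estimate on a root subgroup -/
theorem cusp_est (hn : 0 < n) (hν : ∀ a : Fˣ, ∃ m : ℕ, a = ν ^ m) (hq : Odd (Fintype.card F))
    {Y : Submodule ℂ X} (hY : Stab ρ (Gk 1) Y)
    (h0 : Y ⊓ fix ρ (U 0) = ⊥) (hodd : Odd (Module.finrank ℂ Y)) :
    ∃ r : ℕ, 1 ≤ r ∧ 2 * (Module.finrank ℂ Y : ℝ) = (Fintype.card F - 1 : ℝ) * r ∧
      (Fintype.card F - 1 : ℝ) * (Fintype.card F + r ^ 2) ≤
        4 * ∑ b : Fˣ, ‖trOn Y (ρ (tv (b : F) (e 0)))‖ ^ 2 := by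
  classical
  have hqc : (Fintype.card F : ℂ) ≠ 0 := Nat.cast_ne_zero.2 Fintype.card_ne_zero
  have hψ := AddChar.FiniteField.primitiveChar_to_Complex_isPrimitive F
  set ψ := AddChar.FiniteField.primitiveChar_to_Complex F
  have he1 : (e 0 : W n F) ∈ (Wk 1 : Submodule F (W n F)) := e_mem_Wk (by omega)
  have he0 : (e 0 : W n F) ≠ 0 := by
    intro h
    have := B_ef (F := F) hn
    rw [h] at this; simp at this
  set c : F → ℂ := fun b => trOn Y (ρ (tv b (e 0 : W n F))) with hc
  choose N hN using fun a => weight_nat hY he1 ψ a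
  have f1 := fourier_one hψ c N hN
  have f2 := fourier_two hψ c N hN
  have hc0 : c 0 = Module.finrank ℂ Y := by
    simp only [hc]; rw [tv_zero, map_one]; exact trOn_id Y
  have hcs : ∀ (b : F) (s : Fˣ), c (b * (s : F) ^ 2) = c b := by
    intro b s
    simp only [hc]
    rw [← tv_scale]
    exact tr_tv_conj hY b (Submodule.smul_mem _ _ he1) (smul_ne_zero s.ne_zero he0) he1 he0
  have hcn : ∀ b : F, c b * c (-b) = ((‖c b‖ ^ 2 : ℝ) : ℂ) := by
    intro b
    have h := trOn_conj_inv hY (tv_mem_Gk b he1)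
    have h' : (tv b (e 0 : W n F))⁻¹ = tv (-b) (e 0) := by
      rw [inv_eq_iff_mul_eq_one, tv_add, add_neg_cancel, tv_zero]
    rw [h'] at h
    show c b * trOn Y (ρ (tv (-b) (e 0))) = _
    rw [← h]
    show c b * (starRingEnd ℂ) (c b) = _
    rw [Complex.mul_conj, Complex.normSq_eq_norm_sq]
  have hN0 : N 0 = 0 := by
    have h := hN 0
    have h' := tr_RR (ρ := ρ) hn hY he1 he0
    rw [h0, finrank_bot] at h'
    unfold RR at h'
    rw [map_sum] at h'
    simp only [zero_mul, neg_zero, AddChar.map_zero_eq_one, one_mul] at h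
    rw [h'] at h
    simp at h
    exact h
  have hNs : ∀ (a : F) (s : Fˣ), (N (a * (s : F) ^ 2) : ℝ) = N a := by
    intro a s
    have : (N (a * (s : F) ^ 2) : ℂ) = N a := by
      rw [hN, hN]
      congr 1
      have hs : ((s : F) ^ 2) ≠ 0 := pow_ne_zero _ s.ne_zero
      refine Fintype.sum_equiv (Equiv.mulRight₀ ((s : F) ^ 2) hs) _ _ fun b => ?_
      have h3 := hcs b s
      simp only [hc] at h3
      have h4 : (Equiv.mulRight₀ ((s : F) ^ 2) hs) b = b * (s : F) ^ 2 := rfl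
      rw [h4, h3]
      congr 2; ring
    exact_mod_cast this
  have g1 := sum_sq hν (fun a => (N a : ℝ)) hNs
  have g2 := sum_sq hν (fun a => (N a : ℝ) ^ 2) (fun a s => by simp only [hNs a s])
  have f1' : ∑ a : F, (N a : ℝ) = Module.finrank ℂ Y := by
    rw [hc0] at f1; exact_mod_cast f1
  have f2' : (Fintype.card F : ℝ) * ∑ a : F, (N a : ℝ) ^ 2 = ∑ b : F, ‖c b‖ ^ 2 := by
    rw [Finset.sum_congr rfl (fun b _ => hcn b)] at f2
    exact_mod_cast f2
  rw [sum_units] at f1'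
  rw [sum_units, sum_units (g := fun b => ‖c b‖ ^ 2)] at f2'
  rw [hN0] at f1' f2'
  simp only [Nat.cast_zero, zero_add] at f1' f2'
  set d := Module.finrank ℂ Y
  have hn0 : ‖c 0‖ = d := by rw [hc0]; simp
  rw [hn0] at f2'
  set x := N 1
  set y := N (ν : F)
  rw [f1'] at g1
  set S := ∑ b : Fˣ, ‖c b‖ ^ 2 with hS
  refine ⟨x + y, ?_, by push_cast; exact g1, ?_⟩
  · by_contra hlt
    have : x + y = 0 := by omega
    have hx : x = 0 := by omega
    have hy : y = 0 := by omega
    rw [hx, hy] at g1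
    simp at g1
    rw [g1] at hodd; simp at hodd
  · have hxy : x ≠ y := by
      intro hxy
      rw [← hxy] at g1
      obtain ⟨m, hm⟩ := hq
      rw [hm] at g1
      have : (d : ℝ) = 2 * (m * x) := by push_cast at g1; linarith
      have h5 : d = 2 * (m * x) := by exact_mod_cast this
      rw [h5] at hodd
      exact (Nat.not_odd_iff_even.2 ⟨m * x, by ring⟩) hodd
    have hsq : (1 : ℝ) ≤ ((x : ℝ) - y) ^ 2 := by
      have h6 : (1 : ℤ) ≤ ((x : ℤ) - y) ^ 2 := by
        have : ((x : ℤ) - y) ≠ 0 := by omega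
        have := sq_pos_of_ne_zero this
        omega
      exact_mod_cast h6
    have hq1 : (1 : ℝ) ≤ Fintype.card F := by exact_mod_cast Fintype.card_pos
    show _ ≤ 4 * S
    push_cast
    set Q : ℝ := ((Fintype.card F : ℕ) : ℝ)
    have h7 : 4 * S = 2 * Q * ((Q - 1) * ((x : ℝ) ^ 2 + (y : ℝ) ^ 2)) - (2 * d : ℝ) ^ 2 := by
      rw [← g2]; linarith
    rw [h7, g1]
    have h8 : 0 ≤ Q * (Q - 1) * (((x : ℝ) - y) ^ 2 - 1) := by
      apply mul_nonneg
      · apply mul_nonneg <;> linarith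
      · linarith
    nlinarith

end Weights

end SpP


namespace SpP

set_option linter.unusedSectionVars false
set_option linter.unusedVariables false
set_option linter.unusedSimpArgs false

section Orth

variable {G : Type} [Group G] [Fintype G]
variable {X : Type} [AddCommGroup X] [Module ℂ X] [FiniteDimensional ℂ X]
variable {X' : Type} [AddCommGroup X'] [Module ℂ X'] [FiniteDimensional ℂ X']

/-- restricted representation -/
def srep {ρ : Representation ℂ G X} {H : Subgroup G} {Y : Submodule ℂ X} (hY : Stab ρ H Y) :
    Representation ℂ H Y where
  toFun g := (ρ (g : G)).restrict (hY g g.2)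
  map_one' := by ext y; simp
  map_mul' g h := by ext y; simp

theorem srep_irr {ρ : Representation ℂ G X} {H : Subgroup G} {Y : Submodule ℂ X} (hY : Irr ρ H Y) :
    (srep hY.1).IsIrreducible := by
  have hnt : Nontrivial (Subrepresentation (srep hY.1)) := by
    refine ⟨⊥, ⊤, ?_⟩
    intro h
    apply hY.2.1
    rw [eq_bot_iff]
    intro y hy
    have h1 : (⟨y, hy⟩ : Y) ∈ (⊤ : Subrepresentation (srep hY.1)) := Submodule.mem_top
    rw [← h] at h1
    have h2 : (⟨y, hy⟩ : Y) = 0 := (Submodule.mem_bot ℂ).1 h1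
    exact (Submodule.mem_bot ℂ).2 (congrArg Subtype.val h2)
  refine { eq_bot_or_eq_top := ?_ }
  intro Z
  rcases hY.2.2 (Z.toSubmodule.map Y.subtype) (Submodule.map_subtype_le _ _) (by
    rintro g hg _ ⟨y, hy, rfl⟩
    exact ⟨_, Z.apply_mem_toSubmodule ⟨g, hg⟩ hy, rfl⟩) with h | h
  · left
    apply Subrepresentation.toSubmodule_injective
    show Z.toSubmodule = ⊥
    rw [eq_bot_iff]
    intro y hy
    have h5 : (y : X) ∈ Z.toSubmodule.map Y.subtype := ⟨y, hy, rfl⟩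
    rw [h] at h5
    exact (Submodule.mem_bot ℂ).2 (Subtype.ext ((Submodule.mem_bot ℂ).1 h5))
  · right
    apply Subrepresentation.toSubmodule_injective
    show Z.toSubmodule = ⊤
    rw [eq_top_iff]
    intro y _
    have : (y : X) ∈ Z.toSubmodule.map Y.subtype := by rw [h]; exact y.2
    obtain ⟨z, hz, hzy⟩ := this
    have : z = y := Subtype.ext hzy
    rwa [← this]

theorem srep_char {ρ : Representation ℂ G X} {H : Subgroup G} {Y : Submodule ℂ X} (hY : Stab ρ H Y)
    (g : H) : (srep hY).character g = trOn Y (ρ (g : G)) := by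
  rw [trOn_eq (hY g g.2)]; rfl

open Classical in
theorem orth_self {ρ : Representation ℂ G X} {H : Subgroup G} {Y : Submodule ℂ X} (hY : Irr ρ H Y) :
    ∑ g : H, trOn Y (ρ (g : G)) * trOn Y (ρ (g : G)⁻¹) = Nat.card H := by
  have h0 := card_sub_ne H
  let _ : Invertible (Nat.card H : ℂ) := invertibleOfNonzero h0
  have := srep_irr hY
  have h := Representation.char_orthonormal (srep hY.1) (srep hY.1)
  rw [if_pos ⟨Representation.Equiv.refl _⟩] at h
  simp only [srep_char, Subgroup.coe_inv] at h
  field_simp at h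
  simpa using h

open Classical in
theorem orth_ne {ρ : Representation ℂ G X} {ρ' : Representation ℂ G X'} {H : Subgroup G}
    {Y : Submodule ℂ X} {Y' : Submodule ℂ X'} (hY : Irr ρ H Y) (hY' : Irr ρ' H Y')
    (hne : IsEmpty (Representation.Equiv (srep hY'.1) (srep hY.1))) :
    ∑ g : H, trOn Y (ρ (g : G)) * trOn Y' (ρ' (g : G)⁻¹) = 0 := by
  have h0 := card_sub_ne H
  let _ : Invertible (Nat.card H : ℂ) := invertibleOfNonzero h0
  have := srep_irr hY
  have := srep_irr hY'
  have h := Representation.char_orthonormal (srep hY.1) (srep hY'.1)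
  rw [if_neg (not_nonempty_iff.2 hne)] at h
  simp only [srep_char, Subgroup.coe_inv] at h
  rcases mul_eq_zero.1 h with h | h
  · exact absurd h (inv_ne_zero h0)
  · simpa using h

open Classical in
/-- two irreducible representations that are not isomorphic -/
theorem orth_norm {ρ : Representation ℂ G X} {ρ' : Representation ℂ G X'} {H : Subgroup G}
    {Y : Submodule ℂ X} {Y' : Submodule ℂ X'} (hY : Irr ρ H Y) (hY' : Irr ρ' H Y')
    (hne : IsEmpty (Representation.Equiv (srep hY'.1) (srep hY.1))) :
    ∑ g : H, ‖trOn Y (ρ (g : G)) + trOn Y' (ρ' (g : G))‖ ^ 2 = 2 * (Nat.card H : ℝ) := by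
  have hne' : IsEmpty (Representation.Equiv (srep hY.1) (srep hY'.1)) := ⟨fun φ => hne.1 φ.symm⟩
  have key : ∑ g : H, (trOn Y (ρ (g : G)) + trOn Y' (ρ' (g : G))) *
      (trOn Y (ρ (g : G)⁻¹) + trOn Y' (ρ' (g : G)⁻¹)) = 2 * (Nat.card H : ℂ) := by
    simp_rw [add_mul, mul_add]
    rw [Finset.sum_add_distrib, Finset.sum_add_distrib, Finset.sum_add_distrib, orth_self hY, orth_self hY',
      orth_ne hY hY' hne, orth_ne hY' hY hne']
    ring
  have e : ∀ g : H, (trOn Y (ρ (g : G)) + trOn Y' (ρ' (g : G))) *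
      (trOn Y (ρ (g : G)⁻¹) + trOn Y' (ρ' (g : G)⁻¹)) =
      ((‖trOn Y (ρ (g : G)) + trOn Y' (ρ' (g : G))‖ ^ 2 : ℝ) : ℂ) := by
    intro g
    rw [← trOn_conj_inv hY.1 g.2, ← trOn_conj_inv hY'.1 g.2, ← map_add, Complex.mul_conj,
      Complex.normSq_eq_norm_sq]
  rw [Finset.sum_congr rfl (fun g _ => e g)] at key
  exact_mod_cast key

end Orth

section IsoEquiv

variable {n : ℕ} {F : Type} [Field F] [Fintype F]
variable {X : Type} [AddCommGroup X] [Module ℂ X] [FiniteDimensional ℂ X]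
variable {ρ : Representation ℂ (GT n F) X} {σ : ℂ ≃+* ℂ}

theorem iso_of_equiv {k : ℕ} {Y : Submodule ℂ X} (hY : Irr ρ (Gk k) Y)
    (hY' : Irr (twr σ ρ) (Gk k) (tw σ Y))
    (h : Nonempty (Representation.Equiv (srep hY'.1) (srep hY.1))) : Iso σ ρ k Y := by
  obtain ⟨φ⟩ := h
  let a : (tw σ Y) ≃ₗ[ℂ] Y := φ.toLinearEquiv
  have ha : ∀ (g : Gk k) (x : tw σ Y), a (srep hY'.1 g x) = srep hY.1 g (a x) := by
    intro g x
    exact Representation.IntertwiningMap.isIntertwining _ _ φ.toIntertwiningMap g x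
  refine ⟨LinearMap.range ((Y.subtype ∘ₗ a.toLinearMap).prod (tw σ Y).subtype), ?_, ?_, ?_, ?_, ?_⟩
  · rintro g hg _ ⟨x, rfl⟩
    refine ⟨srep hY'.1 ⟨g, hg⟩ x, ?_⟩
    have := ha ⟨g, hg⟩ x
    apply Prod.ext
    · show ((a (srep hY'.1 ⟨g, hg⟩ x) : Y) : X) = _
      rw [this]; rfl
    · rfl
  · rintro _ ⟨x, rfl⟩ h
    have h1 : ((a x : Y) : X) = 0 := h
    have h2 : a x = 0 := Subtype.ext h1
    have h3 : x = 0 := by simpa using h2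
    rw [h3, map_zero]
  · rintro _ ⟨x, rfl⟩ h
    have h1 : (x : Tw σ X) = 0 := h
    have h3 : x = 0 := Subtype.ext h1
    rw [h3, map_zero]
  · ext y
    constructor
    · rintro ⟨_, ⟨x, rfl⟩, rfl⟩
      exact (a x).2
    · intro hy
      refine ⟨_, ⟨a.symm ⟨y, hy⟩, rfl⟩, ?_⟩
      show ((a (a.symm ⟨y, hy⟩) : Y) : X) = y
      rw [LinearEquiv.apply_symm_apply]
  · ext y
    constructor
    · rintro ⟨_, ⟨x, rfl⟩, rfl⟩
      exact x.2
    · intro hy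
      exact ⟨_, ⟨⟨y, hy⟩, rfl⟩, rfl⟩

end IsoEquiv

end SpP


namespace SpP

set_option linter.unusedSectionVars false
set_option linter.unusedVariables false
set_option linter.unusedSimpArgs false

section SLtwo

variable {n : ℕ} {F : Type} [Field F] [Fintype F]

def mA (g : GT n F) : F := B (g • (e 0 : W n F)) (f 0)
def mC (g : GT n F) : F := - B (g • (e 0 : W n F)) (e 0)
def mA' (g : GT n F) : F := B (g • (f 0 : W n F)) (f 0)
def mC' (g : GT n F) : F := - B (g • (f 0 : W n F)) (e 0)

theorem m_e (hn : 0 < n) {g : GT n F} (hg : g ∈ Gk (n := n) (F := F) 1) :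
    g • (e 0 : W n F) = mA g • e 0 + mC g • f 0 :=
  Wk1_form hn (smul_mem_Wk hg (e_mem_Wk (by omega)))

theorem m_f (hn : 0 < n) {g : GT n F} (hg : g ∈ Gk (n := n) (F := F) 1) :
    g • (f 0 : W n F) = mA' g • e 0 + mC' g • f 0 :=
  Wk1_form hn (smul_mem_Wk hg (f_mem_Wk (by omega)))

theorem m_det (hn : 0 < n) {g : GT n F} (hg : g ∈ Gk (n := n) (F := F) 1) :
    mA g * mC' g - mC g * mA' g = 1 := by
  have h := B_smul g (e 0) (f 0)
  rw [m_e hn hg, m_f hn hg, B_ef hn] at h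
  simp only [map_add, LinearMap.add_apply, map_smul, LinearMap.smul_apply, smul_eq_mul, B_self,
    B_ef hn, B_fe hn] at h
  linear_combination h

theorem m_ext (hn : 0 < n) {g h : GT n F} (hg : g ∈ Gk (n := n) (F := F) 1)
    (hh : h ∈ Gk (n := n) (F := F) 1) (h1 : mA g = mA h) (h2 : mC g = mC h)
    (h3 : mA' g = mA' h) (h4 : mC' g = mC' h) : g = h := by
  refine Gk_ext' hn hg hh ?_ ?_ ?_
  · rw [m_e hn hg, m_e hn hh, h1, h2]
  · rw [m_f hn hg, m_f hn hh, h3, h4]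
  · intro x hx
    rw [Wk_zero hx, smul_def', smul_def', map_zero, map_zero]

theorem card_G1 (hn : 0 < n) : Nat.card (Gk (n := n) (F := F) 1) ≤
    (Fintype.card F ^ 2 - 1) * Fintype.card F := by
  classical
  let φ : Gk (n := n) (F := F) 1 → {u : F × F // u ≠ 0} × F := fun g =>
    (⟨(mA g.1, mC g.1), by
      intro h
      have hd := m_det hn g.2
      have h1 : mA g.1 = 0 := congrArg Prod.fst h
      have h2 : mC g.1 = 0 := congrArg Prod.snd h
      rw [h1, h2] at hd
      simp at hd⟩, if mA g.1 = 0 then mC' g.1 else mA' g.1)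
  have hφ : Function.Injective φ := by
    intro g h hgh
    have e1 : mA g.1 = mA h.1 := congrArg (fun z => z.1.1.1) hgh
    have e2 : mC g.1 = mC h.1 := congrArg (fun z => z.1.1.2) hgh
    have e3 : (if mA g.1 = 0 then mC' g.1 else mA' g.1) =
      (if mA h.1 = 0 then mC' h.1 else mA' h.1) := congrArg (fun z => z.2) hgh
    have d1 := m_det hn g.2
    have d2 := m_det hn h.2
    rw [← e1, ← e2] at d2
    rw [← e1] at e3
    apply Subtype.ext
    by_cases hA : mA g.1 = 0
    · rw [if_pos hA, if_pos hA] at e3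
      rw [hA] at d1 d2
      have hC : mC g.1 ≠ 0 := by
        intro h; rw [h] at d1; simp at d1
      refine m_ext hn g.2 h.2 e1 e2 ?_ e3
      apply mul_left_cancel₀ hC
      linear_combination d2 - d1
    · rw [if_neg hA, if_neg hA] at e3
      refine m_ext hn g.2 h.2 e1 e2 e3 ?_
      apply mul_left_cancel₀ hA
      rw [e3] at d1
      linear_combination d1 - d2
  refine (Nat.card_le_card_of_injective φ hφ).trans ?_
  rw [Nat.card_prod, Nat.card_eq_fintype_card, Nat.card_eq_fintype_card, Fintype.card_subtype_compl]
  simp [Fintype.card_prod, sq]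

/-- minus the identity on the plane -/
noncomputable def hm : GT n F := hh 0 (-1)

theorem hm_mem (hn : 0 < n) : (hm : GT n F) ∈ Gk (n := n) (F := F) 1 := hh_mem hn _

theorem hm_smul (hn : 0 < n) {v : W n F} (hv : v ∈ (Wk 1 : Submodule F (W n F))) :
    (hm : GT n F) • v = - v := by
  have h1 := hh_e hn (-1 : Fˣ)
  have h2 := hh_f hn (-1 : Fˣ)
  rw [Wk1_form hn hv, smul_add, smul_lin, smul_lin, hm, h1, h2]
  simp [neg_add, add_comm]

theorem hm_comm (hn : 0 < n) {g : GT n F} (hg : g ∈ Gk (n := n) (F := F) 1) :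
    hm * g = g * hm := by
  refine Gk_ext (mul_mem (hm_mem hn) hg) (mul_mem hg (hm_mem hn)) ?_
  intro x hx
  rw [mul_smul, mul_smul, hm_smul hn hx, hm_smul hn (smul_mem_Wk hg hx), smul_def', smul_def', map_neg]

theorem hm_sq (hn : 0 < n) : (hm : GT n F) * hm = 1 := by
  refine Gk_ext (mul_mem (hm_mem hn) (hm_mem hn)) (one_mem _) ?_
  intro x hx
  rw [mul_smul, hm_smul hn hx, hm_smul hn (Submodule.neg_mem _ hx), neg_neg, one_smul]

theorem m_hm (hn : 0 < n) {g : GT n F} (hg : g ∈ Gk (n := n) (F := F) 1) :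
    mA (hm * g) = - mA g ∧ mC (hm * g) = - mC g ∧ mA' (hm * g) = - mA' g ∧ mC' (hm * g) = - mC' g := by
  have he := smul_mem_Wk hg (e_mem_Wk (n := n) (F := F) (k := 1) (l := 0) (by omega))
  have hf := smul_mem_Wk hg (f_mem_Wk (n := n) (F := F) (k := 1) (l := 0) (by omega))
  simp only [mA, mC, mA', mC', mul_smul, hm_smul hn he, hm_smul hn hf, map_neg, LinearMap.neg_apply,
    and_self]

theorem m_tve (hn : 0 < n) (b : F) : mA (tv b (e 0 : W n F)) = 1 ∧ mC (tv b (e 0 : W n F)) = 0 ∧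
    mA' (tv b (e 0 : W n F)) = - b ∧ mC' (tv b (e 0 : W n F)) = 1 := by
  simp [mA, mC, mA', mC', tv_smul, B_self, B_ef hn, B_fe hn]

theorem m_tvf (hn : 0 < n) (b x : F) : mA (tv b (f 0 + x • e 0 : W n F)) = 1 + b * x ∧
    mC (tv b (f 0 + x • e 0 : W n F)) = b ∧
    mA' (tv b (f 0 + x • e 0 : W n F)) = - b * x ^ 2 ∧ mC' (tv b (f 0 + x • e 0 : W n F)) = 1 - b * x := by
  simp [mA, mC, mA', mC', tv_smul, B_self, B_ef hn, B_fe hn]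
  constructor <;> ring

theorem m_one (hn : 0 < n) : mA (1 : GT n F) = 1 ∧ mC (1 : GT n F) = 0 ∧
    mA' (1 : GT n F) = 0 ∧ mC' (1 : GT n F) = 1 := by
  simp [mA, mC, mA', mC', B_self, B_ef hn, B_fe hn]

/-- directions of transvections -/
def dir : Option F → W n F
  | none => e 0
  | some x => f 0 + x • e 0

theorem dir_mem (o : Option F) : (dir o : W n F) ∈ (Wk 1 : Submodule F (W n F)) := by
  cases o with
  | none => exact e_mem_Wk (by omega)
  | some x =>
    exact Submodule.add_mem _ (f_mem_Wk (by omega)) (Submodule.smul_mem _ _ (e_mem_Wk (by omega)))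

theorem dir_ne (hn : 0 < n) (o : Option F) : (dir o : W n F) ≠ 0 := by
  cases o with
  | none =>
    intro h
    have h1 : B (e 0 : W n F) (f 0) = 1 := B_ef hn
    have h' : (e 0 : W n F) = 0 := h
    rw [h'] at h1; simp at h1
  | some x =>
    intro h
    have h' : (f 0 + x • e 0 : W n F) = 0 := h
    have h1 : B (f 0 + x • e 0 : W n F) (e 0) = -1 := by simp [B_self, B_fe hn]
    rw [h'] at h1; simp at h1

/-- unipotent elements -/
noncomputable def un : Option (Option F × Fˣ) → GT n F
  | none => 1
  | some (o, b) => tv (b : F) (dir o)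

theorem un_mem (u : Option (Option F × Fˣ)) : (un u : GT n F) ∈ Gk (n := n) (F := F) 1 := by
  rcases u with _ | ⟨o, b⟩
  · exact one_mem _
  · exact tv_mem_Gk _ (dir_mem o)

theorem un_tr (hn : 0 < n) (u : Option (Option F × Fˣ)) :
    mA (un u : GT n F) + mC' (un u : GT n F) = 2 := by
  rcases u with _ | ⟨_ | x, b⟩
  · show mA (1 : GT n F) + mC' (1 : GT n F) = 2
    obtain ⟨h1, h2, h3, h4⟩ := m_one (n := n) (F := F) hn
    rw [h1, h4]; norm_num
  · show mA (tv (b : F) (e 0 : W n F)) + mC' (tv (b : F) (e 0 : W n F)) = 2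
    obtain ⟨h1, h2, h3, h4⟩ := m_tve (n := n) (F := F) hn b
    rw [h1, h4]; norm_num
  · show mA (tv (b : F) (f 0 + x • e 0 : W n F)) + mC' (tv (b : F) (f 0 + x • e 0 : W n F)) = 2
    obtain ⟨h1, h2, h3, h4⟩ := m_tvf (n := n) (F := F) hn b x
    rw [h1, h4]; ring

theorem un_inj (hn : 0 < n) : Function.Injective (un : Option (Option F × Fˣ) → GT n F) := by
  have a0 := m_one (n := n) (F := F) hn
  have a1 := fun b => m_tve (n := n) (F := F) hn b
  have a2 := fun b x => m_tvf (n := n) (F := F) hn b x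
  have d0 : (un none : GT n F) = 1 := rfl
  have d1 : ∀ b : Fˣ, (un (some (none, b)) : GT n F) = tv (b : F) (e 0) := fun _ => rfl
  have d2 : ∀ (b : Fˣ) (x : F), (un (some (some x, b)) : GT n F) = tv (b : F) (f 0 + x • e 0) := fun _ _ => rfl
  intro u w h
  have c1 := congrArg mA h
  have c2 := congrArg mC h
  have c3 := congrArg mA' h
  rcases u with _ | ⟨_ | x, b⟩ <;> rcases w with _ | ⟨_ | y, c⟩ <;>
    simp only [d0, d1, d2, a0.1, a0.2.1, a0.2.2.1, (a1 _).1, (a1 _).2.1, (a1 _).2.2.1, (a2 _ _).1,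
      (a2 _ _).2.1, (a2 _ _).2.2.1] at c1 c2 c3
  · rfl
  · exact absurd (neg_eq_zero.1 c3.symm) c.ne_zero
  · exact absurd c2.symm c.ne_zero
  · exact absurd (neg_eq_zero.1 c3) b.ne_zero
  · have : b = c := Units.ext (neg_injective c3)
    rw [this]
  · exact absurd c2.symm c.ne_zero
  · exact absurd c2 b.ne_zero
  · exact absurd c2 b.ne_zero
  · have hbc : b = c := Units.ext c2
    subst hbc
    have : x = y := mul_left_cancel₀ b.ne_zero (add_left_cancel c1)
    rw [this]

/-- elements with eigenvalue one or minus one -/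
noncomputable def jj (hn : 0 < n) (z : Bool × Option (Option F × Fˣ)) : Gk (n := n) (F := F) 1 :=
  match z with
  | (true, u) => ⟨un u, un_mem u⟩
  | (false, u) => ⟨hm * un u, mul_mem (hm_mem hn) (un_mem u)⟩

theorem jj_inj (hn : 0 < n) (h2 : (2 : F) ≠ 0) : Function.Injective (jj (F := F) hn) := by
  have key : ∀ u w : Option (Option F × Fˣ), (un u : GT n F) ≠ hm * un w := by
    intro u w h
    have c1 := un_tr hn u
    have c2 := un_tr hn w
    obtain ⟨h1, _, _, h4⟩ := m_hm hn (un_mem (n := n) w)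
    rw [h, h1, h4] at c1
    have : (2 : F) * 2 = 0 := by linear_combination -c1 - c2
    exact h2 (by simpa using this)
  rintro ⟨b, u⟩ ⟨c, w⟩ h
  have h' := congrArg Subtype.val h
  cases b <;> cases c
  · have : un u = (un w : GT n F) := mul_left_cancel h'
    rw [un_inj hn this]
  · exact absurd h'.symm (key _ _)
  · exact absurd h' (key _ _)
  · have : un u = (un w : GT n F) := h'
    rw [un_inj hn this]

end SLtwo

end SpP


namespace SpP

set_option linter.unusedSectionVars false
set_option linter.unusedVariables false
set_option linter.unusedSimpArgs false

section Cusp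

variable {n : ℕ} {F : Type} [Field F] [Fintype F]
variable {X : Type} [AddCommGroup X] [Module ℂ X] [FiniteDimensional ℂ X]
variable {ρ : Representation ℂ (GT n F) X} {σ : ℂ ≃+* ℂ} {ν : Fˣ} {r : ℕ} {β : F}

theorem tr_hm (hn : 0 < n) {Y : Submodule ℂ X} (hY : Irr ρ (Gk 1) Y) :
    ∃ ε : ℂ, σ ε = ε ∧ ‖ε‖ = 1 ∧ ∀ g ∈ Gk (n := n) (F := F) 1,
      trOn Y (ρ (hm * g)) = ε * trOn Y (ρ g) := by
  obtain ⟨ε, hε⟩ := schur hY (ρ hm) (hY.1 _ (hm_mem hn)) (by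
    intro g hg y hy
    rw [← rho_mul, ← rho_mul, hm_comm hn hg])
  have hsq : ε ^ 2 = 1 := by
    obtain ⟨y, hy, hy0⟩ := Submodule.exists_mem_ne_zero_of_ne_bot hY.2.1
    have h1 : ρ hm (ρ hm y) = y := by rw [← rho_mul, hm_sq hn, rho_one]
    rw [hε y hy, map_smul, hε y hy, smul_smul] at h1
    have h3 : (ε * ε - 1) • y = 0 := by rw [sub_smul, h1, one_smul, sub_self]
    rcases smul_eq_zero.1 h3 with h | h
    · rw [sq]; exact sub_eq_zero.1 h
    · exact absurd h hy0
  have hcase : ε = 1 ∨ ε = -1 := by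
    apply sq_eq_sq_iff_eq_or_eq_neg.1
    rw [hsq, one_pow]
  refine ⟨ε, ?_, ?_, ?_⟩
  · rcases hcase with h | h <;> simp [h]
  · rcases hcase with h | h <;> simp [h]
  · intro g hg
    rw [← smul_eq_mul (a := ε), ← map_smul]
    apply trOn_congr
    intro y hy
    rw [rho_mul, hε _ (hY.1 g hg y hy), LinearMap.smul_apply]

theorem un_fixed (hn : 0 < n) (h2 : (2 : F) ≠ 0) (hσ : SigOK σ r (Fintype.card F)) (hβ : β ^ 2 = 2)
    {Y : Submodule ℂ X} (hY : Stab ρ (Gk 1) Y) (u : Option (Option F × Fˣ)) :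
    σ (trOn Y (ρ (un u))) = trOn Y (ρ (un u)) := by
  have hβ0 : β ≠ 0 := by
    rintro rfl
    exact h2 (by rw [← hβ]; simp)
  rcases u with _ | ⟨o, b⟩
  · show σ (trOn Y (ρ 1)) = trOn Y (ρ 1)
    rw [map_one]
    have := trOn_id Y
    change trOn Y 1 = _ at this
    rw [this, map_natCast]
  · show σ (trOn Y (ρ (tv (b : F) (dir o)))) = trOn Y (ρ (tv (b : F) (dir o)))
    rw [sig_tv hσ hβ hY (b : F) (dir_mem o)]
    exact tr_tv_conj hY _ (Submodule.smul_mem _ _ (dir_mem o))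
      (smul_ne_zero (pow_ne_zero _ hβ0) (dir_ne hn o)) (dir_mem o) (dir_ne hn o)

theorem cusp_iso (hn : 0 < n) (hν : ∀ a : Fˣ, ∃ m : ℕ, a = ν ^ m) (hq : Odd (Fintype.card F))
    (h2 : (2 : F) ≠ 0) (hσ : SigOK σ r (Fintype.card F)) (hβ : β ^ 2 = 2)
    (Y : Submodule ℂ X) (hY : Irr ρ (Gk 1) Y)
    (h0 : Y ⊓ fix ρ (U 0) = ⊥) (hodd : Odd (Module.finrank ℂ Y)) : Iso σ ρ 1 Y := by
  obtain ⟨s, hs, hd, hS⟩ := cusp_est hn hν hq hY.1 h0 hodd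
  have hY' : Irr (twr σ ρ) (Gk 1) (tw σ Y) := irr_tw hY
  by_contra hI
  have hne : IsEmpty (Representation.Equiv (srep hY'.1) (srep hY.1)) := by
    rw [← not_nonempty_iff]
    intro h
    exact hI (iso_of_equiv hY hY' h)
  classical
  have hsum := orth_norm hY hY' hne
  obtain ⟨ε, hε1, hε2, hε3⟩ := tr_hm (σ := σ) hn hY
  have hval : ∀ g ∈ Gk (n := n) (F := F) 1, trOn (tw σ Y) (twr σ ρ g) = σ (trOn Y (ρ g)) :=
    fun g hg => trOn_tw σ (hY.1 g hg)
  have hT : ∀ z : Bool × Option (Option F × Fˣ),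
      ‖trOn Y (ρ (jj hn z : GT n F)) + trOn (tw σ Y) (twr σ ρ (jj hn z : GT n F))‖ ^ 2 =
        4 * ‖trOn Y (ρ (un z.2))‖ ^ 2 := by
    rintro ⟨b, u⟩
    rw [hval _ (jj hn (b, u)).2]
    have hu := un_fixed (ρ := ρ) hn h2 hσ hβ hY.1 u
    cases b
    · show ‖trOn Y (ρ (hm * un u)) + σ (trOn Y (ρ (hm * un u)))‖ ^ 2 = 4 * ‖trOn Y (ρ (un u))‖ ^ 2
      rw [hε3 _ (un_mem u), map_mul, hε1, hu, ← two_mul, norm_mul, norm_mul, hε2]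
      simp; ring
    · show ‖trOn Y (ρ (un u)) + σ (trOn Y (ρ (un u)))‖ ^ 2 = 4 * ‖trOn Y (ρ (un u))‖ ^ 2
      rw [hu, ← two_mul, norm_mul]
      simp; ring
  have hle : ∑ z : Bool × Option (Option F × Fˣ), 4 * ‖trOn Y (ρ (un z.2))‖ ^ 2 ≤
      2 * (Nat.card (Gk (n := n) (F := F) 1) : ℝ) := by
    rw [← hsum, Finset.sum_congr rfl (fun z _ => (hT z).symm)]
    rw [← Finset.sum_image (s := Finset.univ) (g := jj hn)
      (f := fun g : Gk (n := n) (F := F) 1 => ‖trOn Y (ρ (g : GT n F)) + trOn (tw σ Y) (twr σ ρ (g : GT n F))‖ ^ 2)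
      (fun a _ b _ h => jj_inj hn h2 h)]
    exact Finset.sum_le_univ_sum_of_nonneg (fun g => by positivity)
  have hL : ∑ z : Bool × Option (Option F × Fˣ), 4 * ‖trOn Y (ρ (un z.2))‖ ^ 2 =
      8 * ((Module.finrank ℂ Y : ℝ) ^ 2 + ((Fintype.card F : ℝ) + 1) *
        ∑ b : Fˣ, ‖trOn Y (ρ (tv (b : F) (e 0)))‖ ^ 2) := by
    rw [Fintype.sum_prod_type]
    simp only [Finset.sum_const, Finset.card_univ, Fintype.card_bool]
    rw [← Finset.mul_sum, Fintype.sum_option, Fintype.sum_prod_type]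
    have e1 : trOn Y (ρ (un none)) = (Module.finrank ℂ Y : ℂ) := by
      show trOn Y (ρ 1) = _
      rw [map_one]
      exact trOn_id Y
    have e2 : ∀ (o : Option F) (b : Fˣ), trOn Y (ρ (un (some (o, b)))) = trOn Y (ρ (tv (b : F) (e 0))) := by
      intro o b
      exact tr_tv_conj hY.1 _ (dir_mem o) (dir_ne hn o) (dir_mem none) (dir_ne hn none)
    simp only [e1, e2, Finset.sum_const, Finset.card_univ, Fintype.card_option, nsmul_eq_mul]
    rw [Complex.norm_natCast]
    push_cast
    ring
  have hcard : (Nat.card (Gk (n := n) (F := F) 1) : ℝ) ≤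
      ((Fintype.card F : ℝ) ^ 2 - 1) * (Fintype.card F : ℝ) := by
    have h := card_G1 (F := F) hn
    have h1 : 1 ≤ Fintype.card F ^ 2 := Nat.one_le_pow _ _ Fintype.card_pos
    have h' : (Nat.card (Gk (n := n) (F := F) 1) : ℝ) ≤
      (((Fintype.card F ^ 2 - 1) * Fintype.card F : ℕ) : ℝ) := by exact_mod_cast h
    rw [Nat.cast_mul, Nat.cast_sub h1] at h'
    simpa using h'
  rw [hL] at hle
  have hq1 : (1 : ℝ) < Fintype.card F := by exact_mod_cast Fintype.one_lt_card (α := F)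
  have hs1 : (1 : ℝ) ≤ s := by exact_mod_cast hs
  have hS' : ((Fintype.card F : ℝ) - 1) * (Fintype.card F + (s : ℝ) ^ 2) ≤
      4 * ∑ b : Fˣ, ‖trOn Y (ρ (tv (b : F) (e 0)))‖ ^ 2 := by
    convert hS using 3
  generalize (∑ b : Fˣ, ‖trOn Y (ρ (tv (b : F) (e 0)))‖ ^ 2) = S at hle hS'
  generalize ((Nat.card (Gk (n := n) (F := F) 1) : ℕ) : ℝ) = N at hle hcard
  generalize ((Module.finrank ℂ Y : ℕ) : ℝ) = d at hle hd
  generalize ((Fintype.card F : ℕ) : ℝ) = Q at *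
  generalize (s : ℝ) = t at *
  have a1 : (2 * d) ^ 2 = ((Q - 1) * t) ^ 2 := by rw [hd]
  have a2 := mul_le_mul_of_nonneg_left hS' (show (0 : ℝ) ≤ Q + 1 by linarith)
  have a3 : 2 * ((Q - 1) * t) ^ 2 + 2 * ((Q + 1) * ((Q - 1) * (Q + t ^ 2))) ≤ 2 * ((Q ^ 2 - 1) * Q) := by
    nlinarith
  have a4 : 0 < (Q - 1) * (Q * t ^ 2) := by
    have b1 : 0 < Q - 1 := by linarith
    have b2 : 0 < Q := by linarith
    have b3 : 0 < t := by linarith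
    positivity
  nlinarith

end Cusp

end SpP


namespace SpP

set_option linter.unusedSectionVars false
set_option linter.unusedVariables false
set_option linter.unusedSimpArgs false

section Main

variable {n : ℕ} {F : Type} [Field F] [Fintype F]
variable {X : Type} [AddCommGroup X] [Module ℂ X] [FiniteDimensional ℂ X]
variable {ρ : Representation ℂ (GT n F) X} {σ : ℂ ≃+* ℂ} {ν : Fˣ} {r : ℕ} {β : F}

theorem main_GT (hn : 0 < n) (hν : ∀ a : Fˣ, ∃ m : ℕ, a = ν ^ m) (hq : Odd (Fintype.card F))
    (h2 : (2 : F) ≠ 0) (hσ : SigOK σ r (Fintype.card F)) (hβ : β ^ 2 = 2)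
    (hI : ∀ Z : Submodule ℂ X, (∀ g, ∀ z ∈ Z, ρ g z ∈ Z) → Z = ⊥ ∨ Z = ⊤)
    (hodd : Odd (Module.finrank ℂ X)) (g : GT n F) :
    σ (LinearMap.trace ℂ X (ρ g)) = LinearMap.trace ℂ X (ρ g) := by
  obtain ⟨Y, hle, hY⟩ := Par (ρ := ρ) hν hq h2 n le_rfl ⊤ (fun _ _ _ _ => Submodule.mem_top)
    (by rwa [finrank_top])
  have hi := (good_iso hν hσ hβ h2 (fun Y h1 h3 h4 => cusp_iso hn hν hq h2 hσ hβ Y h1 h3 h4) n le_rfl Y hY).2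
  have hirr : Irr ρ (Gk n) Y := by
    obtain ⟨k, rfl⟩ : ∃ k, n = k + 1 := ⟨n - 1, by omega⟩
    exact hY.1
  have hgm : ∀ g : GT n F, g ∈ (Gk n : Subgroup (GT n F)) := by
    intro g; rw [Gk_top le_rfl]; exact Subgroup.mem_top g
  have htop : Y = ⊤ := by
    rcases hI Y (fun g => hirr.1 g (hgm g)) with h | h
    · exact absurd h hirr.2.1
    · exact h
  subst htop
  have h := iso_trace hirr.1 hi (hgm g)
  have e : trOn (⊤ : Submodule ℂ X) (ρ g) = LinearMap.trace ℂ X (ρ g) := by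
    rw [trOn_eq (fun _ _ => Submodule.mem_top)]
    rw [← LinearMap.trace_conj' _ (Submodule.topEquiv (R := ℂ) (M := X))]
    congr 1
  rwa [e] at h

end Main

section Bridge

variable {n : ℕ} {F : Type} [Field F] [Fintype F]

/-- coordinates -/
def LL : W n F ≃ₗ[F] (Fin n ⊕ Fin n → F) where
  toFun x := Sum.elim (fun i => (x i).1) (fun i => (x i).2)
  map_add' x y := by ext (i | i) <;> rfl
  map_smul' c x := by ext (i | i) <;> rfl
  invFun v i := (v (Sum.inl i), v (Sum.inr i))
  left_inv x := rfl
  right_inv v := by ext (i | i) <;> rfl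

theorem LL_inl (x : W n F) (i : Fin n) : LL x (Sum.inl i) = (x i).1 := rfl
theorem LL_inr (x : W n F) (i : Fin n) : LL x (Sum.inr i) = (x i).2 := rfl

open Matrix in
theorem B_LL (x y : W n F) : B x y = - (LL x ⬝ᵥ (Matrix.J (Fin n) F *ᵥ LL y)) := by
  have h : Matrix.J (Fin n) F *ᵥ LL y = Sum.elim (fun i => - (y i).2) (fun i => (y i).1) := by
    rw [Matrix.J, Matrix.fromBlocks_mulVec]
    ext (i | i) <;> simp [LL_inl, LL_inr, Matrix.neg_mulVec]
  rw [h, B_apply, dotProduct, Fintype.sum_sum_type, ← Finset.sum_add_distrib, ← Finset.sum_neg_distrib]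
  refine Finset.sum_congr rfl fun l _ => ?_
  simp [LL_inl, LL_inr]; ring

open Matrix in
theorem mat_ext {M N : Matrix (Fin n ⊕ Fin n) (Fin n ⊕ Fin n) F}
    (h : ∀ u v, u ⬝ᵥ (M *ᵥ v) = u ⬝ᵥ (N *ᵥ v)) : M = N := by
  ext i j
  have := h (Pi.single i 1) (Pi.single j 1)
  simpa using this

/-- matrix of an isometry -/
noncomputable def mt (g : GT n F) : Matrix (Fin n ⊕ Fin n) (Fin n ⊕ Fin n) F :=
  LinearMap.toMatrix' (LL.toLinearMap ∘ₗ g.1.toLinearMap ∘ₗ LL.symm.toLinearMap)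

open Matrix in
theorem mt_mulVec (g : GT n F) (x : W n F) : mt g *ᵥ LL x = LL (g • x) := by
  rw [mt, ← Matrix.toLin'_apply, Matrix.toLin'_toMatrix']
  simp [smul_def']

open Matrix in
theorem mem_symp_iff {A : Matrix (Fin n ⊕ Fin n) (Fin n ⊕ Fin n) F} :
    A ∈ Matrix.symplecticGroup (Fin n) F ↔
      ∀ x y : W n F, (A *ᵥ LL x) ⬝ᵥ (Matrix.J (Fin n) F *ᵥ (A *ᵥ LL y)) =
        LL x ⬝ᵥ (Matrix.J (Fin n) F *ᵥ LL y) := by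
  rw [SymplecticGroup.mem_iff']
  have key : ∀ u v, u ⬝ᵥ ((Aᵀ * Matrix.J (Fin n) F * A) *ᵥ v) =
      (A *ᵥ u) ⬝ᵥ (Matrix.J (Fin n) F *ᵥ (A *ᵥ v)) := by
    intro u v
    rw [← Matrix.mulVec_mulVec, ← Matrix.mulVec_mulVec, Matrix.dotProduct_mulVec, Matrix.vecMul_transpose]
  constructor
  · intro h x y
    rw [← key, h]
  · intro h
    apply mat_ext
    intro u v
    rw [key]
    have := h (LL.symm u) (LL.symm v)
    simpa using this

theorem mt_mem (g : GT n F) : mt g ∈ Matrix.symplecticGroup (Fin n) F := by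
  rw [mem_symp_iff]
  intro x y
  rw [mt_mulVec, mt_mulVec]
  apply neg_injective
  rw [← B_LL, ← B_LL, B_smul]

open Matrix in
theorem mt_mul (g h : GT n F) : mt (g * h) = mt g * mt h := by
  apply mat_ext
  intro u v
  obtain ⟨x, rfl⟩ := LL.surjective v
  rw [← Matrix.mulVec_mulVec, mt_mulVec, mt_mulVec, mt_mulVec, mul_smul]

/-- the comparison map -/
noncomputable def Phi : GT n F →* ↥(Matrix.symplecticGroup (Fin n) F) :=
  MonoidHom.mk' (fun g => ⟨mt g, mt_mem g⟩) (fun g h => Subtype.ext (mt_mul g h))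

open Matrix in
theorem Phi_surj : Function.Surjective (Phi : GT n F →* ↥(Matrix.symplecticGroup (Fin n) F)) := by
  rintro ⟨A, hA⟩
  let φ : W n F →ₗ[F] W n F := LL.symm.toLinearMap ∘ₗ Matrix.toLin' A ∘ₗ LL.toLinearMap
  have hφ : ∀ x, LL (φ x) = A *ᵥ LL x := by
    intro x
    simp [φ]
  have hφB : ∀ x y, B (φ x) (φ y) = B x y := by
    intro x y
    rw [B_LL, B_LL, hφ, hφ, mem_symp_iff.1 hA]
  refine ⟨mkG φ, ?_⟩
  apply Subtype.ext
  show mt (mkG φ) = A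
  apply mat_ext
  intro u v
  obtain ⟨x, rfl⟩ := LL.surjective v
  rw [mt_mulVec, mkG_smul hφB, hφ]

end Bridge

section Cat

open CategoryTheory

theorem simple_irr {G : Type} [Group G] (V : FDRep ℂ G) [Simple V] (Z : Submodule ℂ V)
    (hZ : ∀ g, ∀ z ∈ Z, V.ρ g z ∈ Z) : Z = ⊥ ∨ Z = ⊤ := by
  let τ : Representation ℂ G Z :=
    { toFun := fun g => (V.ρ g).restrict (hZ g)
      map_one' := by ext y; simp
      map_mul' := fun g h => by ext y; simp }
  let i : FDRep.of τ ⟶ V :=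
    ⟨InducedCategory.homMk (ModuleCat.ofHom Z.subtype), fun g => by
      ext1
      rfl⟩
  have hi : ∀ z : Z, i.hom.hom.hom z = (z : V) := fun z => rfl
  have hmono : Mono i := by
    constructor
    intro A g h hgh
    apply Action.Hom.ext
    ext x
    have := congrArg (fun k => k.hom.hom.hom x) hgh
    exact this
  by_cases h0 : i = 0
  · left
    rw [eq_bot_iff]
    intro z hz
    have h1 : i.hom.hom.hom (⟨z, hz⟩ : Z) = 0 := by rw [h0]; rfl
    exact h1
  · right
    have hiso : IsIso i := (Simple.mono_isIso_iff_nonzero i).2 h0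
    rw [eq_top_iff]
    intro v _
    have h1 := congrArg (fun k => k.hom.hom.hom v) (IsIso.inv_hom_id i)
    have h2 : i.hom.hom.hom ((inv i).hom.hom.hom v) = v := h1
    rw [← h2]
    exact Subtype.property _

end Cat

end SpP

/-- For `q ≡ ±1 (mod 8)` a power of an odd prime and `n ≥ 2`, every
odd-degree irreducible character of `S = PSp_{2n}(q)` is fixed by every `σ ∈ ℋ_2`. -/
theorem stmt_11 (p a : ℕ) (hp : p.Prime) (hpodd : Odd p) (ha : 0 < a)
    (hq : p ^ a % 8 = 1 ∨ p ^ a % 8 = 7)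
    (n : ℕ) (hn : 2 ≤ n)
    (F : Type) [Field F] [Fintype F] (hF : Fintype.card F = p ^ a)
    (χ : PSp n F → ℂ) (hχ : IsIrrChar (PSp n F) χ) (hχodd : ∃ d : ℕ, Odd d ∧ χ 1 = (d : ℂ))
    (σ : ℂ ≃+* ℂ) (hσ : InGalH2 σ) :
    (fun g => σ (χ g)) = χ := by
  have hcardodd : Odd (Fintype.card F) := by rw [hF]; exact hpodd.pow
  obtain ⟨V, hV, rfl⟩ := hχ
  obtain ⟨d, hd, hd1⟩ := hχodd
  obtain ⟨r, hr⟩ := hσ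
  have hrank : Module.finrank ℂ V = d := by
    rw [FDRep.char_one] at hd1
    exact_mod_cast hd1
  have h2 : (2 : F) ≠ 0 := by
    have hc : ringChar F ≠ 2 := by
      intro h
      have := FiniteField.even_card_of_char_two h
      rw [Nat.odd_iff] at hcardodd
      omega
    exact Ring.two_ne_zero hc
  obtain ⟨β, hβ⟩ : ∃ β : F, β ^ 2 = 2 := by
    have hs : IsSquare (2 : F) := by
      rw [FiniteField.isSquare_two_iff, hF]
      omega
    obtain ⟨β, hβ⟩ := hs
    exact ⟨β, by rw [hβ, sq]⟩
  obtain ⟨ν, hν⟩ : ∃ ν : Fˣ, ∀ a : Fˣ, ∃ m : ℕ, a = ν ^ m := by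
    obtain ⟨ν, hν⟩ := IsCyclic.exists_monoid_generator (α := Fˣ)
    refine ⟨ν, fun a => ?_⟩
    obtain ⟨m, hm⟩ := Submonoid.mem_powers_iff _ _ |>.1 (hν a)
    exact ⟨m, hm.symm⟩
  have hSig : SpP.SigOK σ r (Fintype.card F) := by
    intro x hx
    refine hr _ x ?_ hx
    rw [Nat.odd_iff] at hcardodd
    omega
  let θ : SpP.GT n F →* PSp n F :=
    (QuotientGroup.mk' (Subgroup.center (Sp n F))).comp SpP.Phi
  have hθ : Function.Surjective θ :=
    (QuotientGroup.mk'_surjective _).comp SpP.Phi_surj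
  let ρ : Representation ℂ (SpP.GT n F) V := V.ρ.comp θ
  funext g
  obtain ⟨h, rfl⟩ := hθ g
  exact SpP.main_GT (ρ := ρ) (by omega) hν hcardodd h2 hSig hβ (fun Z hZ => by
    apply SpP.simple_irr V Z
    intro g z hz
    obtain ⟨k, rfl⟩ := hθ g
    exact hZ k z hz) (by rw [hrank]; exact hd) h
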